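/- Let (n, θ) be a closed cycle with the θ i not all equal, and fix m and even k ≥ 2 as in the run condition. Let f′ be the cycle with n − k edges whose lengths are obtained from θ by deleting θ m, θ (m+1), …, θ (m+k−1) (so that edges m−1 and m+k become adjacent), its creases being the creases of the original cycle other than m, m+1, …, m+k together with one new crease between edges m−1 and m+k. Then f′ is again a closed cycle, and for every MV assignment μ : ZMod n → {mountain, valley} and each designation d ∈ {interior, exterior}: μ is flat foldable as a face with designation d if and only if the numbers of mountains and valleys among the creases m, m+1, …, m+k under μ differ by exactly 1, and the MV assignment μ′ on f′ that agrees with μ on the old creases and assigns the new crease the majority fold type among μ m, …, μ (m+k) is flat foldable as a face with designation d on f′. -/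

import Mathlib

/-- Mountain or valley fold type. -/
inductive MV
  | mountain
  | valley
deriving DecidableEq

/-- Designation of a face as interior or exterior. -/
inductive Des
  | interior
  | exterior
deriving DecidableEq

/-- The sign `ε` used at the top layer: `-1` for an interior face, `+1` for an
exterior face. -/
def epsOf : Des → ℝ
  | Des.interior => -1
  | Des.exterior => 1

/-- The folded coordinates of a closed cycle: `x 0 = 0` and
`x (i+1) = x i + (-1)^i * θ i`. -/
noncomputable def foldedX (n : ℕ) (θ : ZMod n → ℝ) : ZMod n → ℝ :=
  fun i => ∑ j ∈ Finset.range i.val, (-1 : ℝ) ^ j * θ (j : ZMod n)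

/-- `(n, θ)` is a closed cycle: `n` is even, `n ≥ 2`, all edge lengths are
positive, and the alternating sum of the edge lengths is zero. -/
noncomputable def IsClosedCycle (n : ℕ) (θ : ZMod n → ℝ) : Prop :=
  Even n ∧ 2 ≤ n ∧ (∀ i, 0 < θ i) ∧
    ∑ j ∈ Finset.range n, (-1 : ℝ) ^ j * θ (j : ZMod n) = 0

/-- The open interval whose endpoint set is `{a, b}`. -/
def betw (a b : ℝ) : Set ℝ := Set.Ioo (min a b) (max a b)

/-- `L` is a valid layering of the edges of a cycle folded to coordinates `x`:
`L` is injective; (i) no edge passes strictly between the two edges joined at a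
crease at the crease's coordinate; (ii) creases at the same coordinate opening in
the same direction are disjoint or nested. -/
def ValidLayering (n : ℕ) (x L : ZMod n → ℝ) : Prop :=
  Function.Injective L ∧
  (∀ i e : ZMod n, x i ∈ betw (x e) (x (e + 1)) →
      L e ∉ betw (L (i - 1)) (L i)) ∧
  (∀ i j : ZMod n, i ≠ j → x i = x j →
      Real.sign (x (i + 1) - x i) = Real.sign (x (j + 1) - x j) →
      Disjoint (betw (L (i - 1)) (L i)) (betw (L (j - 1)) (L j)) ∨
        betw (L (i - 1)) (L i) ⊆ betw (L (j - 1)) (L j) ∨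
        betw (L (j - 1)) (L j) ⊆ betw (L (i - 1)) (L i))

/-- The layering `L` realizes the MV assignment `μ` with top-layer sign `ε`:
taking `t` to be the index maximizing `L` and `s` the alternating `±1` map with
`s t = ε`, each crease `i` is a valley iff `s (i-1)` equals the sign of
`L i - L (i-1)`. -/
def Realizes (n : ℕ) (L : ZMod n → ℝ) (μ : ZMod n → MV) (ε : ℝ) : Prop :=
  ∃ t : ZMod n, (∀ j, L j ≤ L t) ∧
    ∃ s : ZMod n → ℝ, (∀ i, s i = 1 ∨ s i = -1) ∧ (∀ i, s (i + 1) = -s i) ∧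
      s t = ε ∧
      ∀ i, μ i = MV.valley ↔ s (i - 1) = Real.sign (L i - L (i - 1))

/-- The MV assignment `μ` on the closed cycle `(n, θ)` is flat foldable as a
face with designation `d`: some valid layering of the folded cycle realizes it. -/
noncomputable def FlatFoldable (n : ℕ) (θ : ZMod n → ℝ) (μ : ZMod n → MV)
    (d : Des) : Prop :=
  ∃ L : ZMod n → ℝ, ValidLayering n (foldedX n θ) L ∧ Realizes n L μ (epsOf d)

/-- The folded diameter of a closed cycle: `max x - min x` over the folded
coordinates. -/
noncomputable def foldedDiameter (n : ℕ) [NeZero n] (θ : ZMod n → ℝ) : ℝ :=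
  Finset.univ.sup' ⟨0, Finset.mem_univ 0⟩ (foldedX n θ) -
    Finset.univ.inf' ⟨0, Finset.mem_univ 0⟩ (foldedX n θ)

/-- The edge lengths of the reduced cycle `f'` in the even case: the lengths
`θ m, …, θ (m+k-1)` are deleted, edge `j` of `f'` corresponding to original edge
`m + k + j`; thus original edges `m - 1` and `m + k` become adjacent at the new
crease `0` of `f'`, and crease `j` of `f'` for `j ≠ 0` is original crease
`m + k + j`. -/
noncomputable def evenShrink (n : ℕ) (θ : ZMod n → ℝ) (m : ZMod n) (k : ℕ) :
    ZMod (n - k) → ℝ :=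
  fun j => θ (m + (k : ZMod n) + (j.val : ZMod n))

/-- The number of creases among `m, m+1, …, m+k` assigned fold type `t` by `μ`. -/
def runCount (n : ℕ) (μ : ZMod n → MV) (m : ZMod n) (k : ℕ) (t : MV) : ℕ :=
  ((Finset.range (k + 1)).filter fun j : ℕ => μ (m + (j : ZMod n)) = t).card

/-- The majority fold type among the creases `m, m+1, …, m+k` under `μ`. -/
def runMajority (n : ℕ) (μ : ZMod n → MV) (m : ZMod n) (k : ℕ) : MV :=
  if runCount n μ m k MV.valley < runCount n μ m k MV.mountain then MV.mountain
  else MV.valley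

/-- The MV assignment on the reduced cycle `f'` in the even case: it agrees with
`μ` on the old creases (crease `j ≠ 0` of `f'` is original crease `m + k + j`)
and assigns the new crease `0` the majority fold type among `μ m, …, μ (m+k)`. -/
def evenRestrict (n : ℕ) (μ : ZMod n → MV) (m : ZMod n) (k : ℕ) :
    ZMod (n - k) → MV :=
  fun j =>
    if j = 0 then runMajority n μ m k
    else μ (m + (k : ZMod n) + (j.val : ZMod n))

structure Sys {E : Type*} (A : Finset E) (l r : E → ℝ) (ρ lam : E → E) : Prop where
  lr : ∀ g ∈ A, l g < r g
  rm : ∀ g ∈ A, ρ g ∈ A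
  ri : ∀ g ∈ A, ρ (ρ g) = g
  rne : ∀ g ∈ A, ρ g ≠ g
  rr : ∀ g ∈ A, r (ρ g) = r g
  lm : ∀ g ∈ A, lam g ∈ A
  li : ∀ g ∈ A, lam (lam g) = g
  lne : ∀ g ∈ A, lam g ≠ g
  ll : ∀ g ∈ A, l (lam g) = l g

structure Val {E : Type*} (A : Finset E) (l r : E → ℝ) (ρ lam : E → E) (L : E → ℝ) : Prop where
  inj : ∀ g ∈ A, ∀ h ∈ A, L g = L h → g = h
  rv : ∀ g ∈ A, ∀ h ∈ A, l h < r g → r g < r h → L g < L h → L h < L (ρ g) → False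
  rn : ∀ g ∈ A, ∀ h ∈ A, r g = r h → L g < L h → L h < L (ρ g) → L (ρ g) < L (ρ h) → False
  lv : ∀ g ∈ A, ∀ h ∈ A, l h < l g → l g < r h → L g < L h → L h < L (lam g) → False
  ln : ∀ g ∈ A, ∀ h ∈ A, l g = l h → L g < L h → L h < L (lam g) → L (lam g) < L (lam h) → False

lemma Val.neg {E : Type*} {A : Finset E} {l r : E → ℝ} {ρ lam : E → E} {L : E → ℝ}
    (S : Sys A l r ρ lam) (V : Val A l r ρ lam L) : Val A l r ρ lam (fun g => - L g) := by
  refine ⟨?_, ?_, ?_, ?_, ?_⟩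
  · intro g hg h hh e
    exact V.inj g hg h hh (by simpa using e)
  · intro g hg h hh a b c d
    refine V.rv (ρ g) (S.rm g hg) h hh (by rwa [S.rr g hg]) (by rwa [S.rr g hg]) (by linarith) ?_
    rw [S.ri g hg]; linarith
  · intro g hg h hh a b c d
    refine V.rn (ρ h) (S.rm h hh) (ρ g) (S.rm g hg) ?_ (by linarith) ?_ ?_
    · rw [S.rr g hg, S.rr h hh, a]
    · rw [S.ri h hh]; linarith
    · rw [S.ri h hh, S.ri g hg]; linarith
  · intro g hg h hh a b c d
    refine V.lv (lam g) (S.lm g hg) h hh (by rwa [S.ll g hg]) (by rwa [S.ll g hg]) (by linarith) ?_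
    rw [S.li g hg]; linarith
  · intro g hg h hh a b c d
    refine V.ln (lam h) (S.lm h hh) (lam g) (S.lm g hg) ?_ (by linarith) ?_ ?_
    · rw [S.ll g hg, S.ll h hh, a]
    · rw [S.li h hh]; linarith
    · rw [S.li h hh, S.li g hg]; linarith

lemma Val.congr {E : Type*} {A : Finset E} {l r : E → ℝ} {ρ ρ' lam : E → E} {L : E → ℝ}
    (V : Val A l r ρ lam L) (h : ∀ g ∈ A, ρ' g = ρ g) : Val A l r ρ' lam L := by
  refine ⟨V.inj, ?_, ?_, V.lv, V.ln⟩
  · intro g hg f hf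
    rw [h g hg]; exact V.rv g hg f hf
  · intro g hg f hf
    rw [h g hg, h f hf]; exact V.rn g hg f hf

/-- symmetric two-sided versions -/
lemma Val.rv_iff {E : Type*} {A : Finset E} {l r : E → ℝ} {ρ lam : E → E} {L : E → ℝ}
    (S : Sys A l r ρ lam) (V : Val A l r ρ lam L) {g h : E} (hg : g ∈ A) (hh : h ∈ A)
    (h1 : l h < r g) (h2 : r g < r h) : L g < L h ↔ L (ρ g) < L h := by
  have a := V.rv g hg h hh h1 h2
  have b := V.rv (ρ g) (S.rm g hg) h hh (by rwa [S.rr g hg]) (by rwa [S.rr g hg])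
  rw [S.ri g hg] at b
  have c : L g ≠ L h := fun e => by
    have := V.inj g hg h hh e; subst this; exact lt_irrefl _ h2
  have d : L (ρ g) ≠ L h := fun e => by
    have := V.inj _ (S.rm g hg) h hh e; subst this; rw [S.rr g hg] at h2; exact lt_irrefl _ h2
  grind

lemma Val.lv_iff {E : Type*} {A : Finset E} {l r : E → ℝ} {ρ lam : E → E} {L : E → ℝ}
    (S : Sys A l r ρ lam) (V : Val A l r ρ lam L) {g h : E} (hg : g ∈ A) (hh : h ∈ A)
    (h1 : l h < l g) (h2 : l g < r h) : L g < L h ↔ L (lam g) < L h := by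
  have a := V.lv g hg h hh h1 h2
  have b := V.lv (lam g) (S.lm g hg) h hh (by rwa [S.ll g hg]) (by rwa [S.ll g hg])
  rw [S.li g hg] at b
  have c : L g ≠ L h := fun e => by
    have := V.inj g hg h hh e; subst this; exact lt_irrefl _ h1
  have d : L (lam g) ≠ L h := fun e => by
    have := V.inj _ (S.lm g hg) h hh e; subst this; rw [S.ll g hg] at h1; exact lt_irrefl _ h1
  grind

/-- two arcs with ends `L h ≤ L (ρ h)`: an arc inside stays inside -/
lemma Val.rn_in {E : Type*} {A : Finset E} {l r : E → ℝ} {ρ lam : E → E} {L : E → ℝ}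
    (S : Sys A l r ρ lam) (V : Val A l r ρ lam L) {g h : E} (hg : g ∈ A) (hh : h ∈ A)
    (h1 : r g = r h) (h2 : L h < L g) (h3 : L g < L (ρ h)) :
    L h < L (ρ g) ∧ L (ρ g) < L (ρ h) := by
  have hg' := S.rm g hg
  have hh' := S.rm h hh
  have a := V.rn h hh g hg h1.symm h2 h3
  have b := V.rn (ρ g) hg' h hh (by rw [S.rr g hg, h1])
  rw [S.ri g hg] at b
  have c : L (ρ g) ≠ L h := fun e => by
    have := V.inj _ hg' h hh e
    rw [← this, S.ri g hg] at h3; exact lt_irrefl _ h3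
  have d : L (ρ g) ≠ L (ρ h) := fun e => by
    have := V.inj _ hg' _ hh' e
    have h4 := congrArg ρ this
    rw [S.ri g hg, S.ri h hh] at h4; subst h4; exact lt_irrefl _ h2
  grind

lemma Val.ln_in {E : Type*} {A : Finset E} {l r : E → ℝ} {ρ lam : E → E} {L : E → ℝ}
    (S : Sys A l r ρ lam) (V : Val A l r ρ lam L) {g h : E} (hg : g ∈ A) (hh : h ∈ A)
    (h1 : l g = l h) (h2 : L h < L g) (h3 : L g < L (lam h)) :
    L h < L (lam g) ∧ L (lam g) < L (lam h) := by
  have hg' := S.lm g hg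
  have hh' := S.lm h hh
  have a := V.ln h hh g hg h1.symm h2 h3
  have b := V.ln (lam g) hg' h hh (by rw [S.ll g hg, h1])
  rw [S.li g hg] at b
  have c : L (lam g) ≠ L h := fun e => by
    have := V.inj _ hg' h hh e
    rw [← this, S.li g hg] at h3; exact lt_irrefl _ h3
  have d : L (lam g) ≠ L (lam h) := fun e => by
    have := V.inj _ hg' _ hh' e
    have h4 := congrArg lam this
    rw [S.li g hg, S.li h hh] at h4; subst h4; exact lt_irrefl _ h2
  grind

lemma exists_gap {E : Type*} (A : Finset E) (L : E → ℝ) (c : ℝ) :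
    ∃ δ > 0, ∀ g ∈ A, L g ≠ c → δ < |L g - c| := by
  induction A using Finset.cons_induction with
  | empty => exact ⟨1, one_pos, by simp⟩
  | cons a s ha ih =>
    obtain ⟨δ, hδ, h⟩ := ih
    by_cases e : L a = c
    · refine ⟨δ, hδ, ?_⟩
      intro g hg hne
      rcases Finset.mem_cons.1 hg with rfl | hg
      · exact absurd e hne
      · exact h g hg hne
    · have : 0 < |L a - c| := abs_pos.2 (sub_ne_zero.2 e)
      refine ⟨min δ (|L a - c| / 2), by positivity, ?_⟩
      intro g hg hne
      rcases Finset.mem_cons.1 hg with rfl | hg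
      · exact lt_of_le_of_lt (min_le_right _ _) (by linarith)
      · exact lt_of_le_of_lt (min_le_left _ _) (h g hg hne)

set_option maxHeartbeats 4000000 in
lemma core_removal {E : Type*} {A A' : Finset E} {l r : E → ℝ} {ρ ρ' lam : E → E} {L : E → ℝ}
    (S : Sys A l r ρ lam) (V : Val A l r ρ lam L) {a b : ℝ} {e e' u v : E}
    (he : e ∈ A) (hlam : lam e = e') (hu : ρ e = u) (hv : ρ e' = v)
    (hle : l e = a) (hre : r e = b) (hre' : r e' = b)
    (hlu : l u ≤ a) (hlv : l v ≤ a)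
    (o1 : L e < L e') (o2 : L e' < L v) (o3 : L u < L e ∨ L v < L u)
    (hA' : ∀ g, g ∈ A' ↔ g ∈ A ∧ g ≠ e ∧ g ≠ e')
    (hr1 : ρ' u = v) (hr2 : ρ' v = u) (hr3 : ∀ g ∈ A', g ≠ u → g ≠ v → ρ' g = ρ g) :
    ∃ L' : E → ℝ, Val A' l r ρ' lam L' ∧
      (∀ f ∈ A', ∀ g ∈ A', l f < a → l g < a → (L' f < L' g ↔ L f < L g)) ∧
      (∀ g ∈ A', g ≠ u → g ≠ v → (L' g < L' (ρ g) ↔ L g < L (ρ g))) ∧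
      (∀ g ∈ A', (L' g < L' (lam g) ↔ L g < L (lam g))) ∧
      (L' u < L' v ↔ L u < L v) := by
  classical
  have he' : e' ∈ A := hlam ▸ S.lm e he
  have huA : u ∈ A := hu ▸ S.rm e he
  have hvA : v ∈ A := hv ▸ S.rm e' he'
  have hlam' : lam e' = e := by rw [← hlam, S.li e he]
  have hu' : ρ u = e := by rw [← hu, S.ri e he]
  have hv' : ρ v = e' := by rw [← hv, S.ri e' he']
  have hle' : l e' = a := by rw [← hlam, S.ll e he, hle]
  have hru : r u = b := by rw [← hu, S.rr e he, hre]
  have hrv : r v = b := by rw [← hv, S.rr e' he', hre']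
  have hab : a < b := by rw [← hle, ← hre]; exact S.lr e he
  have fP : ∀ g ∈ A, L e < L g → L g < L e' → r g ≤ a ∨ a ≤ l g := by
    intro g hg h1 h2
    by_contra! hc
    exact V.lv e he g hg (by rw [hle]; exact hc.2) (by rw [hle]; exact hc.1) h1 (by rwa [hlam])
  have fS : ∀ g ∈ A, L e' < L g → L g < L v → r g ≤ b ∨ b ≤ l g := by
    intro g hg h1 h2
    by_contra! hc
    exact V.rv e' he' g hg (by rw [hre']; exact hc.2) (by rw [hre']; exact hc.1) h1 (by rwa [hv])
  have fU : ∀ g ∈ A, L v < L u → L e < L g → L g < L u → r g ≤ b ∨ b ≤ l g := by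
    intro g hg _ h1 h2
    by_contra! hc
    exact V.rv e he g hg (by rw [hre]; exact hc.2) (by rw [hre]; exact hc.1) h1 (by rwa [hu])
  have fU' : ∀ g ∈ A, L u < L e → L u < L g → L g < L e → r g ≤ b ∨ b ≤ l g := by
    intro g hg _ h1 h2
    by_contra! hc
    exact V.rv u huA g hg (by rw [hru]; exact hc.2) (by rw [hru]; exact hc.1) h1 (by rwa [hu'])
  -- mates
  have m1 : ∀ w, w = e ∨ w = e' ∨ w = v → ∀ g ∈ A, a < r g → r g < b →
      (L g < L w ↔ L (ρ g) < L w) := by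
    intro w hw g hg h1 h2
    rcases hw with rfl | rfl | rfl
    · exact V.rv_iff S hg he (by linarith) (by linarith)
    · exact V.rv_iff S hg he' (by linarith) (by linarith)
    · exact V.rv_iff S hg hvA (by linarith) (by linarith)
  have m1' : ∀ w, w = e ∨ w = e' ∨ w = v → ∀ g ∈ A, a < l g → l g < b →
      (L g < L w ↔ L (lam g) < L w) := by
    intro w hw g hg h1 h2
    rcases hw with rfl | rfl | rfl
    · exact V.lv_iff S hg he (by linarith) (by linarith)
    · exact V.lv_iff S hg he' (by linarith) (by linarith)
    · exact V.lv_iff S hg hvA (by linarith) (by linarith)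
  have m2 : ∀ g ∈ A, r g = b → L e' < L g → L g < L v → L e' < L (ρ g) ∧ L (ρ g) < L v := by
    intro g hg h1 h2 h3
    have := V.rn_in S hg he' (by rw [h1, hre']) h2 (by rwa [hv])
    rwa [hv] at this
  have m3 : ∀ g ∈ A, r g = b → L v < L u → L e < L g → L g < L u →
      L e < L (ρ g) ∧ L (ρ g) < L u := by
    intro g hg h1 _ h2 h3
    have := V.rn_in S hg he (by rw [h1, hre]) h2 (by rwa [hu])
    rwa [hu] at this
  have m4 : ∀ g ∈ A, r g = b → L u < L e → L u < L g → L g < L e →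
      L u < L (ρ g) ∧ L (ρ g) < L e := by
    intro g hg h1 _ h2 h3
    have := V.rn_in S hg huA (by rw [h1, hru]) h2 (by rwa [hu'])
    rwa [hu'] at this
  have m5 : ∀ g ∈ A, l g = a → L e < L g → L g < L e' → L e < L (lam g) ∧ L (lam g) < L e' := by
    intro g hg h1 h2 h3
    have := V.ln_in S hg he (by rw [h1, hle]) h2 (by rwa [hlam])
    rwa [hlam] at this
  have hne : ∀ g ∈ A', L g ≠ L e ∧ L g ≠ L e' := by
    intro g hg
    obtain ⟨h1, h2, h3⟩ := (hA' g).1 hg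
    exact ⟨fun h => h2 (V.inj _ h1 _ he h), fun h => h3 (V.inj _ h1 _ he' h)⟩
  have hnv : ∀ g ∈ A', L g = L v → g = v := fun g hg h =>
    V.inj _ ((hA' g).1 hg).1 _ hvA h
  have hnu : ∀ g ∈ A', L g = L u → g = u := fun g hg h =>
    V.inj _ ((hA' g).1 hg).1 _ huA h
  have hvA' : v ∈ A' := (hA' v).2 ⟨hvA, by rintro rfl; linarith, by rintro rfl; linarith⟩
  have huA' : u ∈ A' := (hA' u).2 ⟨huA, by rintro rfl; rcases o3 with o | o <;> linarith,
    by rintro rfl; rcases o3 with o | o <;> linarith⟩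
  have huv : u ≠ v := by rintro rfl; rcases o3 with o | o <;> linarith
  have hρA' : ∀ g ∈ A', g ≠ u → g ≠ v → ρ g ∈ A' ∧ ρ g ≠ u ∧ ρ g ≠ v := by
    intro g hg h1 h2
    obtain ⟨h3, h4, h5⟩ := (hA' g).1 hg
    have key : ∀ w, ρ g = w → g = ρ w := fun w hw => by rw [← hw, S.ri g h3]
    refine ⟨(hA' _).2 ⟨S.rm g h3, fun h => ?_, fun h => ?_⟩, fun h => ?_, fun h => ?_⟩
    · exact h1 ((key _ h).trans hu)
    · exact h2 ((key _ h).trans hv)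
    · exact h4 ((key _ h).trans hu')
    · exact h5 ((key _ h).trans hv')
  have hlA' : ∀ g ∈ A', lam g ∈ A' := by
    intro g hg
    obtain ⟨h3, h4, h5⟩ := (hA' g).1 hg
    have key : ∀ w, lam g = w → g = lam w := fun w hw => by rw [← hw, S.li g h3]
    refine (hA' _).2 ⟨S.lm g h3, fun h => ?_, fun h => ?_⟩
    · exact h5 ((key _ h).trans hlam)
    · exact h4 ((key _ h).trans hlam')
  obtain ⟨δ, hδ, hgap⟩ := exists_gap A L (L v)
  obtain ⟨R, hR⟩ : ∃ R : E → Prop, ∀ g, R g ↔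
    (L e < L g ∧ L g < L e' ∧ a ≤ l g) ∨ (L e' < L g ∧ L g < L v ∧ b ≤ l g) := ⟨_, fun _ => Iff.rfl⟩
  obtain ⟨N, hN⟩ : ∃ N : E → Prop, ∀ g, N g ↔ (L e < L g ∧ L g ≤ L v ∧ ¬ R g) :=
    ⟨_, fun _ => Iff.rfl⟩
  have hRr : ∀ g ∈ A', R g → a < r g := by
    intro g hg h
    have := S.lr g ((hA' g).1 hg).1
    rcases (hR g).1 h with h | h <;> linarith
  have hNc : ∀ g ∈ A', N g → (L e < L g ∧ L g < L e' ∧ r g ≤ a) ∨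
      (L e' < L g ∧ L g < L v ∧ r g ≤ b) ∨ g = v := by
    intro g hg h
    have h1 := fP g ((hA' g).1 hg).1
    have h2 := fS g ((hA' g).1 hg).1
    have h3 := hne g hg
    have h4 := hnv g hg
    have h5 := (hN g).1 h
    have h6 := hR g
    grind
  have hvN : N v := by
    have := hR v
    rw [hN]; grind
  have huR : ¬ R u := by
    have := hR u
    grind
  have huN : ¬ N u := by
    have := hN u
    grind
  obtain ⟨L', hL'⟩ : ∃ L' : E → ℝ, ∀ g, L' g =
    if R g then L v + δ * ((L g - L e) / (L v - L e)) else L g := ⟨_, fun _ => rfl⟩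
  have hev : 0 < L v - L e := by linarith
  have hRe : ∀ g, R g → L e < L g ∧ L g < L v := by
    intro g h
    rcases (hR g).1 h with h | h <;> exact ⟨by linarith, by linarith⟩
  have hRL : ∀ g, R g → L v < L' g ∧ L' g < L v + δ := by
    intro g h
    have h1 := hRe g h
    rw [hL' g, if_pos h]
    have : 0 < (L g - L e) / (L v - L e) := div_pos (by linarith) hev
    have h3 : (L g - L e) / (L v - L e) < 1 := by rw [div_lt_one hev]; linarith
    constructor <;> nlinarith
  have hRn : ∀ g, ¬ R g → L' g = L g := fun g h => by rw [hL' g, if_neg h]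
  have c1 : ∀ f g, R f → R g → (L' f < L' g ↔ L f < L g) := by
    intro f g h1 h2
    rw [hL' f, hL' g, if_pos h1, if_pos h2, add_lt_add_iff_left, mul_lt_mul_iff_right₀ hδ,
      div_lt_div_iff_of_pos_right hev]
    constructor <;> intro h <;> linarith
  have c2 : ∀ f g, ¬ R f → ¬ R g → (L' f < L' g ↔ L f < L g) := by
    intro f g h1 h2
    rw [hRn f h1, hRn g h2]
  have c3 : ∀ f ∈ A', ∀ g ∈ A', R f → ¬ R g → (L' f < L' g ↔ L v < L g) := by
    intro f _ g hg h1 h2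
    have h3 := hRL f h1
    rw [hRn g h2]
    constructor
    · intro h; linarith
    · intro h
      have := hgap g ((hA' g).1 hg).1 (by linarith)
      rw [abs_of_pos (by linarith)] at this
      linarith
  have c4 : ∀ f ∈ A', ∀ g ∈ A', R f → ¬ R g → (L' g < L' f ↔ L g ≤ L v) := by
    intro f _ g hg h1 h2
    have h3 := hRL f h1
    rw [hRn g h2]
    constructor
    · intro h
      by_contra! hc
      have := hgap g ((hA' g).1 hg).1 (by linarith)
      rw [abs_of_pos (by linarith)] at this
      linarith
    · intro h; linarith
  -- comparison summary : if not (one R and the other N), the order is the same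
  have cs : ∀ f ∈ A', ∀ g ∈ A', ¬ (R f ∧ N g) → ¬ (N f ∧ R g) → (L' f < L' g ↔ L f < L g) := by
    intro f hf g hg h1 h2
    have := hne f hf
    have := hne g hg
    have := hN f
    have := hN g
    have := hRe f
    have := hRe g
    have := c1 f g
    have := c2 f g
    have := c3 f hf g hg
    have := c4 g hg f hf
    grind
  have cRN : ∀ f ∈ A', ∀ g ∈ A', R f → N g → L' g < L' f := by
    intro f hf g hg h1 h2
    have h3 := (hN g).1 h2
    exact (c4 f hf g hg h1 h3.2.2).2 h3.2.1
  -- closure facts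
  have K1 : ∀ g ∈ A', g ≠ u → g ≠ v → R g → ¬ N (ρ g) := by
    intro g hg h1 h2 h3 h4
    have hgA := ((hA' g).1 hg).1
    obtain ⟨k1, k2, k3⟩ := hρA' g hg h1 h2
    have k4 := hNc _ k1 h4
    rw [S.rr g hgA] at k4
    have k5 := (hR g).1 h3
    have k6 := S.lr g hgA
    have k7 := m1 e (by simp) g hgA
    have k8 := m1 e' (by simp) g hgA
    have k9 := m1 v (by simp) g hgA
    have k10 := m2 (ρ g) (S.rm g hgA)
    rw [S.rr g hgA, S.ri g hgA] at k10
    grind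
  have K2 : ∀ g ∈ A', R g → ¬ N (lam g) := by
    intro g hg h3 h4
    have hgA := ((hA' g).1 hg).1
    have k1 := hlA' g hg
    have k4 := hNc _ k1 h4
    have k5 := (hR g).1 h3
    have k6 := S.lr _ (S.lm g hgA)
    rw [S.ll g hgA] at k6
    have k7 := m1' e (by simp) g hgA
    have k8 := m1' e' (by simp) g hgA
    have k9 := m1' v (by simp) g hgA
    have k10 := m5 g hgA
    have k11 := S.ll g hgA
    grind
  have K1' : ∀ g ∈ A', g ≠ u → g ≠ v → N g → ¬ R (ρ g) := by
    intro g hg h1 h2 h3 h4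
    have hgA := ((hA' g).1 hg).1
    obtain ⟨k1, k2, k3⟩ := hρA' g hg h1 h2
    exact K1 _ k1 k2 k3 h4 (by rwa [S.ri g hgA])
  have K2' : ∀ g ∈ A', N g → ¬ R (lam g) := by
    intro g hg h3 h4
    have hgA := ((hA' g).1 hg).1
    exact K2 _ (hlA' g hg) h4 (by rwa [S.li g hgA])
  -- crossing facts
  have H1 : ∀ g ∈ A', ∀ h ∈ A', R h → N g → g ≠ v → l h < r g → r g ≤ r h →
      N (ρ g) := by
    intro g hg h hh h1 h2 h3 h4 h5
    have h0 : g ≠ u := fun e => huN (e ▸ h2)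
    have hgA := ((hA' g).1 hg).1
    obtain ⟨k1, k2, k3⟩ := hρA' g hg h0 h3
    have k4 := hNc g hg h2
    have k5 := (hR h).1 h1
    have k6 := K1' g hg h0 h3 h2
    have k7 := m1 e (by simp) g hgA
    have k8 := m1 e' (by simp) g hgA
    have k9 := m1 v (by simp) g hgA
    have k10 := m2 g hgA
    have k11 := hN (ρ g)
    have k12 := hne _ k1
    have k13 := hnv _ k1
    grind
  have H2 : ∀ g ∈ A', ∀ h ∈ A', N h → R g → g ≠ v → l h < r g → r g < r h →
      R (ρ g) := by
    intro g hg h hh h1 h2 h3 h4 h5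
    have h0 : g ≠ u := fun e => huR (e ▸ h2)
    have hgA := ((hA' g).1 hg).1
    obtain ⟨k1, k2, k3⟩ := hρA' g hg h0 h3
    have k4 := hNc h hh h1
    have k5 := (hR g).1 h2
    have k6 := K1 g hg h0 h3 h2
    have k7 := m1 e (by simp) g hgA
    have k8 := m1 e' (by simp) g hgA
    have k9 := m1 v (by simp) g hgA
    have k10 := S.lr g hgA
    have k11 := hN (ρ g)
    have k12 := hne _ k1
    have k13 := hnv _ k1
    grind
  have H3 : ∀ g ∈ A', ∀ h ∈ A', R h → N g → l h < l g → l g < r h →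
      N (lam g) := by
    intro g hg h hh h1 h2 h4 h5
    have hgA := ((hA' g).1 hg).1
    have k1 := hlA' g hg
    have k4 := hNc g hg h2
    have k5 := (hR h).1 h1
    have k6 := K2' g hg h2
    have k7 := m1' e (by simp) g hgA
    have k8 := m1' e' (by simp) g hgA
    have k9 := m1' v (by simp) g hgA
    have k10 := S.lr g hgA
    have k11 := hN (lam g)
    have k12 := hne _ k1
    have k13 := hnv _ k1
    grind
  have H4 : ∀ g ∈ A', ∀ h ∈ A', N h → R g → l h ≤ l g → l g < r h →
      R (lam g) := by
    intro g hg h hh h1 h2 h4 h5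
    have hgA := ((hA' g).1 hg).1
    have k1 := hlA' g hg
    have k4 := hNc h hh h1
    have k5 := (hR g).1 h2
    have k6 := K2 g hg h2
    have k7 := m1' e (by simp) g hgA
    have k8 := m1' e' (by simp) g hgA
    have k9 := m1' v (by simp) g hgA
    have k10 := m5 g hgA
    have k11 := hN (lam g)
    have k12 := hne _ k1
    have k13 := hnv _ k1
    grind
  have csρ : ∀ g ∈ A', g ≠ u → g ≠ v → (L' g < L' (ρ g) ↔ L g < L (ρ g)) := by
    intro g hg h1 h2
    exact cs g hg _ (hρA' g hg h1 h2).1 (fun h => K1 g hg h1 h2 h.1 h.2)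
      (fun h => K1' g hg h1 h2 h.1 h.2)
  have csl : ∀ g ∈ A', (L' g < L' (lam g) ↔ L g < L (lam g)) := by
    intro g hg
    exact cs g hg _ (hlA' g hg) (fun h => K2 g hg h.1 h.2) (fun h => K2' g hg h.1 h.2)
  have csuv : (L' u < L' v ↔ L u < L v) := 
    cs u huA' v hvA' (fun h => huR h.1) (fun h => huN h.1)
  have csvu : (L' v < L' u ↔ L v < L u) := 
    cs v hvA' u huA' (fun h => huN h.2) (fun h => huR h.2)
  have vR : ¬ R v := ((hN v).1 hvN).2.2
  have hin' : ∀ g ∈ A', ∀ h ∈ A', L' g = L' h → g = h := by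
    intro g hg h hh heq
    have k1 := cs g hg h hh
    have k2 := cs h hh g hg
    have k3 := cRN g hg h hh
    have k4 := cRN h hh g hg
    by_cases x1 : R g ∧ N h
    · exact absurd (k3 x1.1 x1.2) (by rw [heq]; exact lt_irrefl _)
    by_cases x2 : N g ∧ R h
    · exact absurd (k4 x2.2 x2.1) (by rw [heq]; exact lt_irrefl _)
    have k5 := k1 x1 x2
    have k6 := k2 (fun z => x2 z.symm) (fun z => x1 z.symm)
    refine V.inj g ((hA' g).1 hg).1 h ((hA' h).1 hh).1 ?_
    rcases lt_trichotomy (L g) (L h) with z | z | z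
    · exact absurd (k5.2 z) (by rw [heq]; exact lt_irrefl _)
    · exact z
    · exact absurd (k6.2 z) (by rw [heq]; exact lt_irrefl _)
  -- new crease: no crossing edge
  have Z1 : ∀ h ∈ A', l h < b → b < r h →
      ¬ (L' u < L' h ∧ L' h < L' v) ∧ ¬ (L' v < L' h ∧ L' h < L' u) := by
    intro h hh h1 h2
    have hhA := ((hA' h).1 hh).1
    have k0 := hne h hh
    have k1 := hNc h hh
    have k2 := hR h
    have k3 := hN h
    have k4 := cs u huA' h hh
    have k4' := cs h hh u huA'
    have k5 := cs v hvA' h hh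
    have k5' := cs h hh v hvA'
    have k6 := cRN h hh v hvA'
    have k7 := fS h hhA
    have k8 := fU h hhA
    have k9 := fU' h hhA
    grind
  -- new crease: closure
  have Z2 : ∀ h ∈ A', h ≠ u → h ≠ v → r h = b → L' u < L' h → L' h < L' v →
      L' u < L' (ρ h) ∧ L' (ρ h) < L' v := by
    intro h hh n1 n2 h1 h2 h3
    have hhA := ((hA' h).1 hh).1
    obtain ⟨q1, q2, q3⟩ := hρA' h hh n1 n2
    have k0 := hne h hh
    have k1 := hNc h hh
    have k2 := hR h
    have k3 := hN h
    have k4 := cs u huA' h hh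
    have k5' := cs h hh v hvA'
    have k6 := cRN h hh v hvA'
    have k7 := m2 h hhA h1
    have k9 := m4 h hhA h1
    have w0 := hne _ q1
    have w2 := hR (ρ h)
    have w3 := hN (ρ h)
    have w4 := cs u huA' _ q1
    have w5' := cs _ q1 v hvA'
    have w6 := cRN _ q1 v hvA'
    have w7 := K1 h hh n1 n2
    have w8 := K1' h hh n1 n2
    grind
  have Z3 : ∀ h ∈ A', h ≠ u → h ≠ v → r h = b → L' v < L' h → L' h < L' u →
      L' v < L' (ρ h) ∧ L' (ρ h) < L' u := by
    intro h hh n1 n2 h1 h2 h3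
    have hhA := ((hA' h).1 hh).1
    obtain ⟨q1, q2, q3⟩ := hρA' h hh n1 n2
    have k0 := hne h hh
    have k1 := hNc h hh
    have k2 := hR h
    have k3 := hN h
    have k4 := cs h hh u huA'
    have k5' := cs v hvA' h hh
    have k6 := cRN h hh v hvA'
    have k7 := m2 _ (S.rm h hhA)
    rw [S.rr h hhA, S.ri h hhA] at k7
    have k9 := m3 h hhA h1
    have w0 := hne _ q1
    have w00 := hnv _ q1
    have w1 := fP _ ((hA' _).1 q1).1
    rw [S.rr h hhA] at w1
    have w2 := hR (ρ h)
    have w3 := hN (ρ h)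
    have w4 := cs _ q1 u huA'
    have w5' := cs v hvA' _ q1
    have w6 := cRN _ q1 v hvA'
    have w7 := K1 h hh n1 n2
    have w8 := K1' h hh n1 n2
    grind
  refine ⟨L', ⟨hin', ?_, ?_, ?_, ?_⟩, ?_, csρ, csl, csuv⟩
  · intro g hg h hh h1 h2 h3 h4
    by_cases gu : g = u
    · subst gu; rw [hr1] at h4; rw [hru] at h1 h2; exact (Z1 h hh h1 h2).1 ⟨h3, h4⟩
    by_cases gv : g = v
    · subst gv; rw [hr2] at h4; rw [hrv] at h1 h2; exact (Z1 h hh h1 h2).2 ⟨h3, h4⟩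
    rw [hr3 g hg gu gv] at h4
    have hgA := ((hA' g).1 hg).1
    have hhA := ((hA' h).1 hh).1
    obtain ⟨q1, q2, q3⟩ := hρA' g hg gu gv
    have k1 := V.rv g hgA h hhA h1 h2
    have k2 := cs g hg h hh
    have k3 := cs h hh _ q1
    have k4 := cRN g hg h hh
    have k5 := cRN h hh _ q1
    have k6 := H1 g hg h hh
    have k7 := H1 _ q1 h hh
    have k8 := H2 g hg h hh
    have k9 := H2 _ q1 h hh
    rw [S.rr g hgA, S.ri g hgA] at k7 k9
    by_cases x1 : R h ∧ (N g ∨ N (ρ g))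
    · have : N (ρ g) := x1.2.elim (fun z => k6 x1.1 z gv h1 h2.le) id
      exact absurd (cRN h hh _ q1 x1.1 this) (not_lt.2 h4.le)
    by_cases x2 : N h ∧ (R g ∨ R (ρ g))
    · have : R g := x2.2.elim id (fun z => k9 x2.1 z q3 h1 h2)
      exact absurd (cRN g hg h hh this x2.1) (not_lt.2 h3.le)
    exact k1 ((k2 (fun z => x2 ⟨z.2, .inl z.1⟩) (fun z => x1 ⟨z.2, .inl z.1⟩)).1 h3)
      ((k3 (fun z => x1 ⟨z.1, .inr z.2⟩) (fun z => x2 ⟨z.1, .inr z.2⟩)).1 h4)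
  · intro g hg h hh h1 h2 h3 h4
    by_cases gu : g = u
    · subst gu
      rw [hr1] at h3 h4
      have hu1 : h ≠ g := by rintro rfl; exact lt_irrefl _ h2
      have hv1 : h ≠ v := by rintro rfl; exact lt_irrefl _ h3
      rw [hr3 h hh hu1 hv1] at h4
      have := Z2 h hh hu1 hv1 (by rw [← h1, hru]) h2 h3
      linarith
    by_cases gv : g = v
    · subst gv
      rw [hr2] at h3 h4
      have hu1 : h ≠ u := by rintro rfl; exact lt_irrefl _ h3
      have hv1 : h ≠ g := by rintro rfl; exact lt_irrefl _ h2
      rw [hr3 h hh hu1 hv1] at h4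
      have := Z3 h hh hu1 hv1 (by rw [← h1, hrv]) h2 h3
      linarith
    have hgA := ((hA' g).1 hg).1
    have hhA := ((hA' h).1 hh).1
    rw [hr3 g hg gu gv] at h3 h4
    obtain ⟨q1, q2, q3⟩ := hρA' g hg gu gv
    by_cases eu : h = u
    · subst eu
      rw [hr1] at h4
      have := Z2 _ q1 q2 q3 (by rw [S.rr g hgA, h1, hru]) h3 h4
      rw [S.ri g hgA] at this
      linarith
    by_cases ev : h = v
    · subst ev
      rw [hr2] at h4
      have := Z3 _ q1 q2 q3 (by rw [S.rr g hgA, h1, hrv]) h3 h4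
      rw [S.ri g hgA] at this
      linarith
    rw [hr3 h hh eu ev] at h4
    obtain ⟨t1, t2, t3⟩ := hρA' h hh eu ev
    have k1 := V.rn g hgA h hhA h1
    have k2 := cs g hg h hh
    have k3 := cs h hh _ q1
    have k4 := cs _ q1 _ t1
    have k5 := cRN g hg h hh
    have k6 := cRN h hh _ q1
    have k7 := cRN _ q1 _ t1
    have lg := S.lr g hgA
    have lh := S.lr h hhA
    have lg' := S.lr _ (S.rm g hgA)
    have lh' := S.lr _ (S.rm h hhA)
    have k8 := H1 g hg h hh
    have k9 := H1 _ q1 h hh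
    have k10 := H1 g hg _ t1
    have k11 := H1 _ q1 _ t1
    have j8 := H1 h hh g hg
    have j9 := H1 h hh _ q1
    have j10 := H1 _ t1 g hg
    have j11 := H1 _ t1 _ q1
    rw [S.rr g hgA] at k9 k11 j9 j11 lg'
    rw [S.rr h hhA] at k10 k11 j10 j11 lh'
    rw [S.ri g hgA] at k9 k11
    rw [S.ri h hhA] at j10 j11
    have y1 := K1 g hg gu gv
    have y2 := K1' g hg gu gv
    have y3 := K1 h hh eu ev
    have y4 := K1' h hh eu ev
    by_cases X1 : (R g ∨ R (ρ g)) ∧ (N h ∨ N (ρ h))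
    · have hNh : N h ∧ N (ρ h) := by
        clear k1 k2 k3 k4 k5 k6 k7 k8 k9 k10 k11 y1 y2
        grind
      rcases X1.1 with x | x
      · exact absurd (cRN g hg h hh x hNh.1) (by linarith)
      · exact absurd (cRN _ q1 _ t1 x hNh.2) (by linarith)
    by_cases X2 : (R h ∨ R (ρ h)) ∧ (N g ∨ N (ρ g))
    · have hNg : N g ∧ N (ρ g) := by
        clear k1 k2 k3 k4 k5 k6 k7 j8 j9 j10 j11 y3 y4
        grind
      rcases X2.1 with x | x
      · exact absurd (cRN _ hh _ q1 x hNg.2) (by linarith)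
      · have z1 : ¬ R h := fun z => absurd (cRN _ hh _ q1 z hNg.2) (by linarith)
        have z2 : ¬ N h := fun z => y4 z x
        have z3 := (k2 (fun z => z2 z.2) (fun z => z1 z.2)).1 h2
        have z4 := (k3 (fun z => z1 z.1) (fun z => z2 z.1)).1 h3
        have z5 := (hN g).1 hNg.1
        have z6 := (hN (ρ g)).1 hNg.2
        exact z2 ((hN h).2 ⟨by linarith, by linarith, z1⟩)
    exact k1
      ((k2 (fun z => X1 ⟨.inl z.1, .inl z.2⟩) (fun z => X2 ⟨.inl z.2, .inl z.1⟩)).1 h2)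
      ((k3 (fun z => X2 ⟨.inl z.1, .inr z.2⟩) (fun z => X1 ⟨.inr z.2, .inl z.1⟩)).1 h3)
      ((k4 (fun z => X1 ⟨.inr z.1, .inr z.2⟩) (fun z => X2 ⟨.inr z.2, .inr z.1⟩)).1 h4)
  · intro g hg h hh h1 h2 h3 h4
    have hgA := ((hA' g).1 hg).1
    have hhA := ((hA' h).1 hh).1
    have q1 := hlA' g hg
    have k1 := V.lv g hgA h hhA h1 h2
    have k2 := cs g hg h hh
    have k3 := cs h hh _ q1
    have k4 := cRN g hg h hh
    have k5 := cRN h hh _ q1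
    have k6 := H3 g hg h hh
    have k7 := H3 _ q1 h hh
    have k8 := H4 g hg h hh
    have k9 := H4 _ q1 h hh
    rw [S.ll g hgA, S.li g hgA] at k7 k9
    by_cases x1 : R h ∧ (N g ∨ N (lam g))
    · have : N (lam g) := x1.2.elim (fun z => k6 x1.1 z h1 h2) id
      exact absurd (cRN h hh _ q1 x1.1 this) (not_lt.2 h4.le)
    by_cases x2 : N h ∧ (R g ∨ R (lam g))
    · have : R g := x2.2.elim id (fun z => k9 x2.1 z h1.le h2)
      exact absurd (cRN g hg h hh this x2.1) (not_lt.2 h3.le)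
    exact k1 ((k2 (fun z => x2 ⟨z.2, .inl z.1⟩) (fun z => x1 ⟨z.2, .inl z.1⟩)).1 h3)
      ((k3 (fun z => x1 ⟨z.1, .inr z.2⟩) (fun z => x2 ⟨z.1, .inr z.2⟩)).1 h4)
  · intro g hg h hh h1 h2 h3 h4
    have hgA := ((hA' g).1 hg).1
    have hhA := ((hA' h).1 hh).1
    have q1 := hlA' g hg
    have t1 := hlA' h hh
    have k1 := V.ln g hgA h hhA h1
    have k2 := cs g hg h hh
    have k3 := cs h hh _ q1
    have k4 := cs _ q1 _ t1
    have lg := S.lr g hgA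
    have lh := S.lr h hhA
    have lg' := S.lr _ (S.lm g hgA)
    have lh' := S.lr _ (S.lm h hhA)
    have k8 := H4 g hg h hh
    have k9 := H4 _ q1 h hh
    have k10 := H4 g hg _ t1
    have k11 := H4 _ q1 _ t1
    have j8 := H4 h hh g hg
    have j9 := H4 h hh _ q1
    have j10 := H4 _ t1 g hg
    have j11 := H4 _ t1 _ q1
    rw [S.ll g hgA] at k9 k11 j9 j11 lg'
    rw [S.ll h hhA] at k10 k11 j10 j11 lh'
    rw [S.li g hgA] at k9 k11
    rw [S.li h hhA] at j10 j11
    have y1 := K2 g hg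
    have y2 := K2' g hg
    by_cases X1 : (R g ∨ R (lam g)) ∧ (N h ∨ N (lam h))
    · have hRg : R g ∧ R (lam g) := by
        clear k1 k2 k3 k4 j8 j9 j10 j11 y1 y2
        grind
      rcases X1.2 with x | x
      · exact absurd (cRN g hg h hh hRg.1 x) (by linarith)
      · exact absurd (cRN _ q1 _ t1 hRg.2 x) (by linarith)
    by_cases X2 : (R h ∨ R (lam h)) ∧ (N g ∨ N (lam g))
    · have hRh : R h ∧ R (lam h) := by
        clear k1 k2 k3 k4 k8 k9 k10 k11 y1 y2
        grind
      by_cases x : N (lam g)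
      · exact absurd (cRN _ hh _ q1 hRh.1 x) (by linarith)
      · have z : N g := X2.2.resolve_right x
        have z1 := y2 z
        have z2 := (c3 h hh _ q1 hRh.1 z1).1 h3
        have z3 := (c4 _ t1 _ q1 hRh.2 z1).1 h4
        linarith
    exact k1
      ((k2 (fun z => X1 ⟨.inl z.1, .inl z.2⟩) (fun z => X2 ⟨.inl z.2, .inl z.1⟩)).1 h2)
      ((k3 (fun z => X2 ⟨.inl z.1, .inr z.2⟩) (fun z => X1 ⟨.inr z.2, .inl z.1⟩)).1 h3)
      ((k4 (fun z => X1 ⟨.inr z.1, .inr z.2⟩) (fun z => X2 ⟨.inr z.2, .inr z.1⟩)).1 h4)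
  · intro f hf g hg h1 h2
    apply cs f hf g hg
    · rintro ⟨h3, -⟩
      rcases (hR f).1 h3 with h | h <;> linarith
    · rintro ⟨-, h3⟩
      rcases (hR g).1 h3 with h | h <;> linarith

def InS {E : Type*} (Q : Finset E) (p q g : E) : Prop := g = p ∨ g = q ∨ g ∈ Q

structure Run {E : Type*} (A : Finset E) (l r : E → ℝ) (ρ lam : E → E) (Q : Finset E) (p q : E)
    (a b : ℝ) : Prop where
  QA : ∀ g ∈ Q, g ∈ A
  pA : p ∈ A
  qA : q ∈ A
  pq : p ≠ q
  pQ : p ∉ Q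
  qQ : q ∉ Q
  Ql : ∀ g ∈ Q, l g = a
  Qr : ∀ g ∈ Q, r g = b
  pr : r p = b
  qr : r q = b
  pl : l p < a
  ql : l q < a
  Qlam : ∀ g ∈ Q, lam g ∈ Q
  Qrho : ∀ g, InS Q p q g → InS Q p q (ρ g)
  conn : ∀ C : E → Prop, (∃ g, InS Q p q g ∧ C g) → (∀ g, InS Q p q g → C g → C (ρ g)) →
    (∀ g ∈ Q, C g → C (lam g)) → ∀ g, InS Q p q g → C g

def swp {E : Type*} [DecidableEq E] (ρ : E → E) (u v : E) : E → E :=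
  fun g => if g = u then v else if g = v then u else ρ g

lemma Run.inA {E : Type*} {A : Finset E} {l r : E → ℝ} {ρ lam : E → E} {Q : Finset E} {p q : E}
    {a b : ℝ} (H : Run A l r ρ lam Q p q a b) {g : E} (h : InS Q p q g) : g ∈ A := by
  rcases h with rfl | rfl | h
  · exact H.pA
  · exact H.qA
  · exact H.QA g h

lemma Run.facts {E : Type*} {A : Finset E} {l r : E → ℝ} {ρ lam : E → E}
    {Q : Finset E} {p q : E} {a b : ℝ} (S : Sys A l r ρ lam)
    (H : Run A l r ρ lam Q p q a b) {e : E} (he : e ∈ Q) :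
    e ≠ lam e ∧ ρ e ≠ e ∧ ρ e ≠ lam e ∧ ρ (lam e) ≠ e ∧ ρ (lam e) ≠ lam e ∧ ρ e ≠ ρ (lam e) := by
  have heA := H.QA e he
  have he' := H.Qlam e he
  have he'A := S.lm e heA
  have h1 : ρ e ≠ lam e := by
    intro h
    have := H.conn (fun g => g = e ∨ g = lam e) ⟨e, Or.inr (Or.inr he), Or.inl rfl⟩ ?_ ?_ p
      (Or.inl rfl)
    · rcases this with rfl | h
      · exact H.pQ he
      · exact H.pQ (h ▸ he')
    · rintro g - (rfl | rfl)
      · exact Or.inr h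
      · left; rw [← h, S.ri e heA]
    · rintro g - (rfl | rfl)
      · exact Or.inr rfl
      · left; rw [S.li e heA]
  refine ⟨(S.lne e heA).symm, S.rne e heA, h1, ?_, S.rne _ he'A, ?_⟩
  · intro h
    apply h1
    rw [← h, S.ri _ he'A, h]
  · intro h
    have := congrArg ρ h
    rw [S.ri e heA, S.ri _ he'A] at this
    exact S.lne e heA this.symm

lemma Run.reduce {E : Type*} [DecidableEq E] {A : Finset E} {l r : E → ℝ} {ρ lam : E → E}
    {Q : Finset E} {p q : E} {a b : ℝ} (S : Sys A l r ρ lam)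
    (H : Run A l r ρ lam Q p q a b) {e : E} (he : e ∈ Q) :
    Sys (A \ {e, lam e}) l r (swp ρ (ρ e) (ρ (lam e))) lam ∧
    Run (A \ {e, lam e}) l r (swp ρ (ρ e) (ρ (lam e))) lam (Q \ {e, lam e}) p q a b := by
  obtain ⟨f1, f2, f3, f4, f5, f6⟩ := H.facts S he
  have heA := H.QA e he
  have he' := H.Qlam e he
  have he'A := S.lm e heA
  have hle := S.li e heA
  obtain ⟨e', hE⟩ : ∃ e', e' = lam e := ⟨_, rfl⟩
  obtain ⟨u, hu⟩ : ∃ u, u = ρ e := ⟨_, rfl⟩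
  obtain ⟨v, hv⟩ : ∃ v, v = ρ (lam e) := ⟨_, rfl⟩
  rw [← hu] at f2 f3 f6 ⊢
  rw [← hv] at f4 f5 f6 ⊢
  rw [← hE] at f1 f3 f5 he' he'A hle hv ⊢
  have hρu : ρ u = e := by rw [hu, S.ri e heA]
  have hρv : ρ v = e' := by rw [hv, S.ri e' he'A]
  have huA : u ∈ A := hu ▸ S.rm e heA
  have hvA : v ∈ A := hv ▸ S.rm e' he'A
  have hru : r u = b := by rw [hu, S.rr e heA, H.Qr e he]
  have hrv : r v = b := by rw [hv, S.rr e' he'A, H.Qr e' he']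
  have mem : ∀ g, g ∈ A \ {e, e'} ↔ g ∈ A ∧ g ≠ e ∧ g ≠ e' := by
    intro g; simp
  have memQ : ∀ g, g ∈ Q \ {e, e'} ↔ g ∈ Q ∧ g ≠ e ∧ g ≠ e' := by
    intro g; simp
  have sm : ∀ g ∈ A, g ≠ u → g ≠ v → g ≠ e → g ≠ e' → ρ g ≠ e ∧ ρ g ≠ e' ∧ ρ g ≠ u ∧ ρ g ≠ v := by
    intro g hg h1 h2 h3 h4
    have := S.ri g hg
    refine ⟨?_, ?_, ?_, ?_⟩ <;> intro h <;> rw [h] at this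
    · exact h1 (by rw [← this, hu])
    · exact h2 (by rw [← this, hv])
    · exact h3 (by rw [← this, hρu])
    · exact h4 (by rw [← this, hρv])
  have lmm : ∀ g ∈ A, g ≠ e → g ≠ e' → lam g ≠ e ∧ lam g ≠ e' := by
    intro g hg h3 h4
    have := S.li g hg
    refine ⟨?_, ?_⟩ <;> intro h <;> rw [h] at this
    · exact h4 (by rw [← this, hE])
    · exact h3 (by rw [← this, hle])
  have s1 : swp ρ u v u = v := by simp [swp]
  have s2 : swp ρ u v v = u := by simp [swp, f6.symm]
  have s3 : ∀ g, g ≠ u → g ≠ v → swp ρ u v g = ρ g := by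
    intro g h1 h2; simp [swp, h1, h2]
  have pe : p ≠ e := fun h => H.pQ (h ▸ he)
  have pe' : p ≠ e' := fun h => H.pQ (h ▸ he')
  have qe : q ≠ e := fun h => H.qQ (h ▸ he)
  have qe' : q ≠ e' := fun h => H.qQ (h ▸ he')
  have inS' : ∀ g, InS (Q \ {e, e'}) p q g ↔ InS Q p q g ∧ g ≠ e ∧ g ≠ e' := by
    intro g
    unfold InS
    rw [memQ]
    constructor
    · rintro (rfl | rfl | h)
      · exact ⟨Or.inl rfl, pe, pe'⟩
      · exact ⟨Or.inr (Or.inl rfl), qe, qe'⟩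
      · exact ⟨Or.inr (Or.inr h.1), h.2⟩
    · rintro ⟨rfl | rfl | h, h2⟩
      · exact Or.inl rfl
      · exact Or.inr (Or.inl rfl)
      · exact Or.inr (Or.inr ⟨h, h2⟩)
  have uS : InS Q p q u := hu ▸ H.Qrho e (Or.inr (Or.inr he))
  have vS : InS Q p q v := hv ▸ H.Qrho e' (Or.inr (Or.inr he'))
  refine ⟨⟨?_, ?_, ?_, ?_, ?_, ?_, ?_, ?_, ?_⟩, ⟨?_, ?_, ?_, H.pq, ?_, ?_, ?_, ?_, H.pr, H.qr,
    H.pl, H.ql, ?_, ?_, ?_⟩⟩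
  · intro g hg; exact S.lr g ((mem g).1 hg).1
  · intro g hg
    obtain ⟨h1, h2, h3⟩ := (mem g).1 hg
    rw [mem]
    by_cases gu : g = u
    · subst gu; rw [s1]; exact ⟨hvA, f4, f5⟩
    by_cases gv : g = v
    · subst gv; rw [s2]; exact ⟨huA, f2, f3⟩
    rw [s3 g gu gv]
    have := sm g h1 gu gv h2 h3
    exact ⟨S.rm g h1, this.1, this.2.1⟩
  · intro g hg
    obtain ⟨h1, h2, h3⟩ := (mem g).1 hg
    by_cases gu : g = u
    · subst gu; rw [s1, s2]
    by_cases gv : g = v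
    · subst gv; rw [s2, s1]
    have := sm g h1 gu gv h2 h3
    rw [s3 g gu gv, s3 _ this.2.2.1 this.2.2.2, S.ri g h1]
  · intro g hg
    obtain ⟨h1, h2, h3⟩ := (mem g).1 hg
    by_cases gu : g = u
    · subst gu; rw [s1]; exact f6.symm
    by_cases gv : g = v
    · subst gv; rw [s2]; exact f6
    rw [s3 g gu gv]; exact S.rne g h1
  · intro g hg
    obtain ⟨h1, h2, h3⟩ := (mem g).1 hg
    by_cases gu : g = u
    · subst gu; rw [s1, hru, hrv]
    by_cases gv : g = v
    · subst gv; rw [s2, hru, hrv]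
    rw [s3 g gu gv, S.rr g h1]
  · intro g hg
    obtain ⟨h1, h2, h3⟩ := (mem g).1 hg
    rw [mem]
    exact ⟨S.lm g h1, lmm g h1 h2 h3⟩
  · intro g hg; exact S.li g ((mem g).1 hg).1
  · intro g hg; exact S.lne g ((mem g).1 hg).1
  · intro g hg; exact S.ll g ((mem g).1 hg).1
  · intro g hg
    obtain ⟨h1, h2⟩ := (memQ g).1 hg
    exact (mem g).2 ⟨H.QA g h1, h2⟩
  · exact (mem p).2 ⟨H.pA, pe, pe'⟩
  · exact (mem q).2 ⟨H.qA, qe, qe'⟩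
  · intro h; exact H.pQ ((memQ p).1 h).1
  · intro h; exact H.qQ ((memQ q).1 h).1
  · intro g hg; exact H.Ql g ((memQ g).1 hg).1
  · intro g hg; exact H.Qr g ((memQ g).1 hg).1
  · intro g hg
    obtain ⟨h1, h2, h3⟩ := (memQ g).1 hg
    rw [memQ]
    exact ⟨H.Qlam g h1, lmm g (H.QA g h1) h2 h3⟩
  · intro g hg
    obtain ⟨h1, h2, h3⟩ := (inS' g).1 hg
    rw [inS']
    by_cases gu : g = u
    · subst gu; rw [s1]; exact ⟨vS, f4, f5⟩
    by_cases gv : g = v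
    · subst gv; rw [s2]; exact ⟨uS, f2, f3⟩
    rw [s3 g gu gv]
    have := sm g (H.inA h1) gu gv h2 h3
    exact ⟨H.Qrho g h1, this.1, this.2.1⟩
  · intro C hex hρ hl
    by_cases hCu : C u
    · have hCv : C v := by
        have := hρ u ((inS' u).2 ⟨uS, f2, f3⟩) hCu
        rwa [s1] at this
      have := H.conn (fun g => C g ∨ g = e ∨ g = e') ⟨u, uS, Or.inl hCu⟩ ?_ ?_
      · intro g hg
        obtain ⟨h1, h2, h3⟩ := (inS' g).1 hg
        rcases this g h1 with h | h | h
        · exact h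
        · exact absurd h h2
        · exact absurd h h3
      · intro g hg hc
        by_cases ge : g = e
        · left; rw [ge, ← hu]; exact hCu
        by_cases ge' : g = e'
        · left; rw [ge', ← hv]; exact hCv
        have hCg : C g := by
          rcases hc with h | h | h
          · exact h
          · exact absurd h ge
          · exact absurd h ge'
        by_cases gu : g = u
        · right; left; rw [gu, hρu]
        by_cases gv : g = v
        · right; right; rw [gv, hρv]
        left
        have := hρ g ((inS' g).2 ⟨hg, ge, ge'⟩) hCg
        rwa [s3 g gu gv] at this
      · intro g hg hc
        by_cases ge : g = e
        · right; right; rw [ge, hE]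
        by_cases ge' : g = e'
        · right; left; rw [ge', hle]
        have hCg : C g := by
          rcases hc with h | h | h
          · exact h
          · exact absurd h ge
          · exact absurd h ge'
        left
        exact hl g ((memQ g).2 ⟨hg, ge, ge'⟩) hCg
    · have hCv : ¬ C v := by
        intro h
        have := hρ v ((inS' v).2 ⟨vS, f4, f5⟩) h
        rw [s2] at this
        exact hCu this
      exfalso
      obtain ⟨g0, hg0, hC0⟩ := hex
      have hg0' := (inS' g0).1 hg0
      have := H.conn (fun g => C g ∧ g ≠ e ∧ g ≠ e') ⟨g0, hg0'.1, hC0, hg0'.2⟩ ?_ ?_ u uS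
      · exact hCu this.1
      · rintro g hg ⟨h1, h2, h3⟩
        have gu : g ≠ u := fun h => hCu (h ▸ h1)
        have gv : g ≠ v := fun h => hCv (h ▸ h1)
        have k := sm g (H.inA hg) gu gv h2 h3
        have := hρ g ((inS' g).2 ⟨hg, h2, h3⟩) h1
        rw [s3 g gu gv] at this
        exact ⟨this, k.1, k.2.1⟩
      · rintro g hg ⟨h1, h2, h3⟩
        exact ⟨hl g ((memQ g).2 ⟨hg, h2, h3⟩) h1, lmm g (H.QA g hg) h2 h3⟩

lemma sgn_pos' {x y : ℝ} (h : x < y) : Real.sign (y - x) = 1 := Real.sign_of_pos (by linarith)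
lemma sgn_neg' {x y : ℝ} (h : x < y) : Real.sign (x - y) = -1 := Real.sign_of_neg (by linarith)

lemma Run.step {E : Type*} [DecidableEq E] {A : Finset E} {l r : E → ℝ} {ρ lam : E → E}
    {Q : Finset E} {p q : E} {a b : ℝ} {L : E → ℝ} (S : Sys A l r ρ lam)
    (V : Val A l r ρ lam L)
    (H : Run A l r ρ lam Q p q a b) (hQ : Q.Nonempty) : ∃ e ∈ Q, ∃ L' : E → ℝ,
    Val (A \ {e, lam e}) l r (swp ρ (ρ e) (ρ (lam e))) lam L' ∧
    (∀ f ∈ A \ {e, lam e}, ∀ g ∈ A \ {e, lam e}, l f < a → l g < a → (L' f < L' g ↔ L f < L g)) ∧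
    (∀ g ∈ A \ {e, lam e}, g ≠ ρ e → g ≠ ρ (lam e) → (L' g < L' (ρ g) ↔ L g < L (ρ g))) ∧
    (∀ g ∈ A \ {e, lam e}, (L' g < L' (lam g) ↔ L g < L (lam g))) ∧
    (L' (ρ e) < L' (ρ (lam e)) ↔ L (ρ e) < L (ρ (lam e))) ∧
    Real.sign (L e - L (ρ e)) - Real.sign (L (lam e) - L e) +
      Real.sign (L (ρ (lam e)) - L (lam e)) = Real.sign (L (ρ (lam e)) - L (ρ e)) := by
  obtain ⟨e, he, hlt, hmin⟩ : ∃ e ∈ Q, L e < L (lam e) ∧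
      ∀ g ∈ Q, |L e - L (lam e)| ≤ |L g - L (lam g)| := by
    obtain ⟨e, he, hmin⟩ := Finset.exists_min_image Q (fun g => |L g - L (lam g)|) hQ
    have heA := H.QA e he
    rcases lt_trichotomy (L e) (L (lam e)) with h | h | h
    · exact ⟨e, he, h, hmin⟩
    · exact absurd (V.inj _ heA _ (S.lm e heA) h).symm (S.lne e heA)
    · refine ⟨lam e, H.Qlam e he, by rwa [S.li e heA], ?_⟩
      rw [S.li e heA, abs_sub_comm]; exact hmin
  refine ⟨e, he, ?_⟩
  obtain ⟨S', H'⟩ := H.reduce S he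
  obtain ⟨f1, f2, f3, f4, f5, f6⟩ := H.facts S he
  have heA := H.QA e he
  have he' := H.Qlam e he
  have he'A := S.lm e heA
  have hle := S.li e heA
  obtain ⟨e', hE⟩ : ∃ e', e' = lam e := ⟨_, rfl⟩
  obtain ⟨u, hu⟩ : ∃ u, u = ρ e := ⟨_, rfl⟩
  obtain ⟨v, hv⟩ : ∃ v, v = ρ (lam e) := ⟨_, rfl⟩
  rw [← hu] at f2 f3 f6 S' ⊢
  rw [← hv] at f4 f5 f6 S' ⊢
  rw [← hE] at f1 f3 f5 he' he'A hle hv S' hlt hmin ⊢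
  have uS : InS Q p q u := hu ▸ H.Qrho e (Or.inr (Or.inr he))
  have vS : InS Q p q v := hv ▸ H.Qrho e' (Or.inr (Or.inr he'))
  have hla : ∀ g, InS Q p q g → l g ≤ a := by
    rintro g (rfl | rfl | h)
    · exact H.pl.le
    · exact H.ql.le
    · exact (H.Ql g h).le
  have hrb : ∀ g, InS Q p q g → r g = b := by
    rintro g (rfl | rfl | h)
    · exact H.pr
    · exact H.qr
    · exact H.Qr g h
  have uA := H.inA uS
  have vA := H.inA vS
  have hab : a < b := by have := S.lr e heA; rwa [H.Ql e he, H.Qr e he] at this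
  -- nothing in between
  have nob : ∀ g, InS Q p q g → L e < L g → L g < L e' → False := by
    intro g hg h1 h2
    by_cases gQ : g ∈ Q
    · have := V.ln_in S (H.QA g gQ) heA (by rw [H.Ql g gQ, H.Ql e he]) h1 (by rwa [← hE])
      rw [← hE] at this
      have h3 := hmin g gQ
      rw [abs_of_neg (by linarith : L e - L e' < 0)] at h3
      rcases abs_cases (L g - L (lam g)) with h | h <;> linarith [this.1, this.2]
    · have hl : l g < a := by
        rcases hg with rfl | rfl | h
        · exact H.pl
        · exact H.ql
        · exact absurd h gQ
      refine V.lv e heA g (H.inA hg) ?_ ?_ h1 (by rwa [← hE])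
      · rwa [H.Ql e he]
      · rwa [H.Ql e he, hrb g hg]
  have ue : L u ≠ L e := fun h => f2 (V.inj _ uA _ heA h)
  have ue' : L u ≠ L e' := fun h => f3 (V.inj _ uA _ he'A h)
  have ve : L v ≠ L e := fun h => f4 (V.inj _ vA _ heA h)
  have ve' : L v ≠ L e' := fun h => f5 (V.inj _ vA _ he'A h)
  have hru : r u = b := hrb u uS
  have hrv : r v = b := hrb v vS
  have hρu : ρ u = e := by rw [hu, S.ri e heA]
  have hρv : ρ v = e' := by rw [hv, S.ri e' he'A]
  have s1 : swp ρ u v u = v := by simp [swp]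
  have s2 : swp ρ u v v = u := by simp [swp, f6.symm]
  have s3 : ∀ g, g ≠ u → g ≠ v → swp ρ u v g = ρ g := by
    intro g h1 h2; simp [swp, h1, h2]
  have mem : ∀ g, g ∈ A \ {e, e'} ↔ g ∈ A ∧ g ≠ e ∧ g ≠ e' := by
    intro g; simp
  rcases lt_or_gt_of_ne ve with hv1 | hv1
  · -- v < e
    have k1 := V.rn_in S heA vA (by rw [H.Qr e he, hrv]) hv1 (by rw [hρv]; exact hlt)
    rw [← hu, hρv] at k1
    have k2 : L u < L e := by
      rcases lt_or_gt_of_ne ue with h | h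
      · exact h
      · exact (nob u uS h k1.2).elim
    obtain ⟨L', c1, c2, c3, c4, c5⟩ := core_removal (A' := A \ {e, e'}) (ρ' := swp ρ u v)
      (e := e') (e' := e) (u := v) (v := u) (a := a) (b := b) S (V.neg S) he'A hle hv.symm hu.symm
      (H.Ql _ he') (H.Qr _ he') (H.Qr _ he) (hla v vS) (hla u uS) (by simpa using hlt)
      (by simpa using k2) (Or.inr (by simpa using k1.1))
      (by intro g; rw [mem]; exact and_congr_right fun _ => and_comm) s2 s1
      (fun g _ h1 h2 => s3 g h2 h1)
    have key : ∀ g ∈ A \ {e, e'}, ∀ h ∈ A \ {e, e'}, g ≠ h →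
        ((L' g < L' h ↔ -L g < -L h) → (-L' g < -L' h ↔ L g < L h)) := by
      intro g hg h hh hne hi
      have h1 : L' g ≠ L' h := fun h => hne (c1.inj _ hg _ hh h)
      have h2 : L g ≠ L h := fun h => hne (V.inj _ ((mem _).1 hg).1 _ ((mem _).1 hh).1 h)
      rcases lt_or_gt_of_ne h2 with h2 | h2
      · have : ¬ (L' g < L' h) := fun h => by have := hi.1 h; linarith
        have : L' h < L' g := lt_of_le_of_ne (not_lt.1 this) h1.symm
        constructor <;> intro <;> linarith
      · have : L' g < L' h := hi.2 (by linarith)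
        constructor <;> intro <;> linarith
    refine ⟨fun g => - L' g, c1.neg S', ?_, ?_, ?_, ?_, ?_⟩
    · intro f hf g hg h1 h2
      by_cases fg : f = g
      · subst fg; simp
      · exact key f hf g hg fg (c2 f hf g hg h1 h2)
    · intro g hg h1 h2
      have := S'.rm g hg
      rw [s3 g h1 h2] at this
      exact key g hg _ this (S.rne g ((mem g).1 hg).1).symm (c3 g hg h2 h1)
    · intro g hg
      exact key g hg _ (S'.lm g hg) (S'.lne g hg).symm (c4 g hg)
    · have h1 := (key v ((mem v).2 ⟨vA, f4, f5⟩) u ((mem u).2 ⟨uA, f2, f3⟩) f6.symm c5).2 k1.1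
      constructor
      · intro h; exact absurd h (not_lt.2 h1.le)
      · intro h; exact absurd h (not_lt.2 k1.1.le)
    · rw [sgn_pos' k2, sgn_pos' hlt, sgn_neg' (hv1.trans hlt), sgn_neg' k1.1]; norm_num
  · have o2 : L e' < L v := by
      rcases lt_or_gt_of_ne ve' with h | h
      · exact (nob v vS hv1 h).elim
      · exact h
    have o3 : L u < L e ∨ L v < L u := by
      rcases lt_or_gt_of_ne ue with h | h
      · exact Or.inl h
      · right
        have h2 : L e' < L u := by
          rcases lt_or_gt_of_ne ue' with h' | h'
          · exact (nob u uS h h').elim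
          · exact h'
        have := V.rn_in S he'A heA (by rw [H.Qr e he, H.Qr _ he']) hlt (by rw [← hu]; exact h2)
        rw [← hu, ← hv] at this
        exact this.2
    obtain ⟨L', c1, c2, c3, c4, c5⟩ := core_removal (A' := A \ {e, e'}) (ρ' := swp ρ u v)
      (e := e) (e' := e') (u := u) (v := v) (a := a) (b := b) S V heA hE.symm hu.symm hv.symm
      (H.Ql _ he) (H.Qr _ he) (H.Qr _ he') (hla u uS) (hla v vS) hlt o2 o3
      mem s1 s2 (fun g _ h1 h2 => s3 g h1 h2)
    refine ⟨L', c1, c2, c3, c4, c5, ?_⟩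
    rcases o3 with h | h
    · rw [sgn_pos' h, sgn_pos' hlt, sgn_pos' o2, sgn_pos' (h.trans (hlt.trans o2))]; norm_num
    · rw [sgn_neg' (hlt.trans (o2.trans h)), sgn_pos' hlt, sgn_pos' o2, sgn_neg' h]; norm_num

lemma sgn_swap (x y : ℝ) : Real.sign (x - y) = - Real.sign (y - x) := by
  rw [← Real.sign_neg, neg_sub]

lemma sgn_congr {x y x' y' : ℝ} (h : x < y ↔ x' < y') (h1 : x ≠ y) (h2 : x' ≠ y') :
    Real.sign (y - x) = Real.sign (y' - x') := by
  rcases lt_or_gt_of_ne h1 with h3 | h3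
  · rw [sgn_pos' h3, sgn_pos' (h.1 h3)]
  · have : y' < x' := by
      rcases lt_or_gt_of_ne h2 with h4 | h4
      · exact absurd (h.2 h4) (by linarith)
      · exact h4
    rw [sgn_neg' h3, sgn_neg' this]

lemma sum_diff2 {E : Type*} [DecidableEq E] (T : Finset E) {u v : E} (hu : u ∈ T) (hv : v ∈ T)
    (huv : u ≠ v) (f g : E → ℝ) (h : ∀ x ∈ T, x ≠ u → x ≠ v → f x = g x) :
    ∑ x ∈ T, f x = ∑ x ∈ T, g x + (f u - g u) + (f v - g v) := by
  have hv' : v ∈ T.erase u := Finset.mem_erase.2 ⟨huv.symm, hv⟩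
  rw [← Finset.add_sum_erase T f hu, ← Finset.add_sum_erase T g hu,
    ← Finset.add_sum_erase _ f hv', ← Finset.add_sum_erase _ g hv']
  have : ∑ x ∈ (T.erase u).erase v, f x = ∑ x ∈ (T.erase u).erase v, g x := by
    apply Finset.sum_congr rfl
    intro x hx
    simp only [Finset.mem_erase] at hx
    exact h x hx.2.2 hx.2.1 hx.1
  rw [this]; ring

lemma sum_rem2 {E : Type*} [DecidableEq E] (T : Finset E) {u v : E} (hu : u ∈ T) (hv : v ∈ T)
    (huv : u ≠ v) (f : E → ℝ) :
    ∑ x ∈ T, f x = ∑ x ∈ T \ {u, v}, f x + f u + f v := by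
  have : ({u, v} : Finset E) ⊆ T := by
    intro x hx; simp at hx; rcases hx with rfl | rfl <;> assumption
  rw [← Finset.sum_sdiff this, Finset.sum_pair huv]; ring

theorem forward_ind {E : Type*} [DecidableEq E] {l r : E → ℝ} {lam : E → E}
    {p q : E} {a b : ℝ} (d : E → ℝ) (ρ0 : E → E) (hp0 : ρ0 p = q) (hq0 : ρ0 q = p) :
    ∀ (N : ℕ) (A : Finset E) (ρ : E → E) (Q : Finset E) (L : E → ℝ), Q.card = N →
    Sys A l r ρ lam → Val A l r ρ lam L → Run A l r ρ lam Q p q a b →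
    (∀ g, InS Q p q g → d (ρ g) = - d g) → (∀ g ∈ Q, d (lam g) = - d g) →
    (∀ g ∈ A, ¬ InS Q p q g → ρ0 g = ρ g) →
    ∃ L' : E → ℝ, Val (A \ Q) l r ρ0 lam L' ∧
    (∀ f ∈ A \ Q, ∀ g ∈ A \ Q, l f < a → l g < a → (L' f < L' g ↔ L f < L g)) ∧
    (∀ g ∈ A, ¬ InS Q p q g → (L' g < L' (ρ g) ↔ L g < L (ρ g))) ∧
    (∀ g ∈ A \ Q, (L' g < L' (lam g) ↔ L g < L (lam g))) ∧
    ∑ g ∈ insert p (insert q Q), d g * Real.sign (L (ρ g) - L g) +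
      ∑ g ∈ Q, d g * Real.sign (L (lam g) - L g) = 2 * (d p * Real.sign (L q - L p)) := by
  intro N
  induction N using Nat.strong_induction_on with
  | _ N ih =>
  intro A ρ Q L hN S V H dρ dl hρ0
  rcases Q.eq_empty_or_nonempty with rfl | hQ
  · have ρp : ρ p = q := by
      rcases H.Qrho p (Or.inl rfl) with h | h | h
      · exact absurd h (S.rne p H.pA)
      · exact h
      · simp at h
    have ρq : ρ q = p := by rw [← ρp, S.ri p H.pA]
    refine ⟨L, ?_, ?_, ?_, ?_, ?_⟩
    · rw [Finset.sdiff_empty]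
      apply V.congr
      intro g hg
      by_cases h1 : g = p
      · rw [h1, hp0, ρp]
      by_cases h2 : g = q
      · rw [h2, hq0, ρq]
      apply hρ0 g hg
      rintro (h | h | h)
      · exact h1 h
      · exact h2 h
      · simp at h
    · intros; rfl
    · intros; rfl
    · intros; rfl
    · have := dρ p (Or.inl rfl)
      rw [ρp] at this
      simp only [insert_empty_eq, Finset.sum_empty, add_zero]
      rw [Finset.sum_pair H.pq, ρp, ρq, this, sgn_swap (L p) (L q)]
      ring
  obtain ⟨e, he, L1, V1, c2, c3, c4, c5, c6⟩ := H.step S V hQ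
  obtain ⟨S', H'⟩ := H.reduce S he
  obtain ⟨f1, f2, f3, f4, f5, f6⟩ := H.facts S he
  have heA := H.QA e he
  have he' := H.Qlam e he
  have he'A := S.lm e heA
  have hle := S.li e heA
  obtain ⟨e', hE⟩ : ∃ e', e' = lam e := ⟨_, rfl⟩
  obtain ⟨u, hu⟩ : ∃ u, u = ρ e := ⟨_, rfl⟩
  obtain ⟨v, hv⟩ : ∃ v, v = ρ (lam e) := ⟨_, rfl⟩
  rw [← hu] at f2 f3 f6 S' H' V1 c3 c5 c6
  rw [← hv] at f4 f5 f6 S' H' V1 c3 c5 c6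
  rw [← hE] at f1 f3 f5 he' he'A hle hv S' H' V1 c2 c3 c4 c6
  have uS : InS Q p q u := hu ▸ H.Qrho e (Or.inr (Or.inr he))
  have vS : InS Q p q v := hv ▸ H.Qrho e' (Or.inr (Or.inr he'))
  have uA := H.inA uS
  have vA := H.inA vS
  have hρu : ρ u = e := by rw [hu, S.ri e heA]
  have hρv : ρ v = e' := by rw [hv, S.ri e' he'A]
  have s1 : swp ρ u v u = v := by simp [swp]
  have s2 : swp ρ u v v = u := by simp [swp, f6.symm]
  have s3 : ∀ g, g ≠ u → g ≠ v → swp ρ u v g = ρ g := by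
    intro g h1 h2; simp [swp, h1, h2]
  have mem : ∀ g, g ∈ A \ {e, e'} ↔ g ∈ A ∧ g ≠ e ∧ g ≠ e' := by
    intro g; simp
  have memQ : ∀ g, g ∈ Q \ {e, e'} ↔ g ∈ Q ∧ g ≠ e ∧ g ≠ e' := by
    intro g; simp
  have pe : p ≠ e := fun h => H.pQ (h ▸ he)
  have pe' : p ≠ e' := fun h => H.pQ (h ▸ he')
  have qe : q ≠ e := fun h => H.qQ (h ▸ he)
  have qe' : q ≠ e' := fun h => H.qQ (h ▸ he')
  have inS' : ∀ g, InS (Q \ {e, e'}) p q g ↔ InS Q p q g ∧ g ≠ e ∧ g ≠ e' := by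
    intro g
    unfold InS
    rw [memQ]
    constructor
    · rintro (rfl | rfl | h)
      · exact ⟨Or.inl rfl, pe, pe'⟩
      · exact ⟨Or.inr (Or.inl rfl), qe, qe'⟩
      · exact ⟨Or.inr (Or.inr h.1), h.2⟩
    · rintro ⟨rfl | rfl | h, h2⟩
      · exact Or.inl rfl
      · exact Or.inr (Or.inl rfl)
      · exact Or.inr (Or.inr ⟨h, h2⟩)
  have uS' := (inS' u).2 ⟨uS, f2, f3⟩
  have vS' := (inS' v).2 ⟨vS, f4, f5⟩
  have nS : ∀ g ∈ A, ¬ InS Q p q g → g ∈ A \ {e, e'} ∧ ¬ InS (Q \ {e, e'}) p q g ∧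
      g ≠ u ∧ g ≠ v := by
    intro g hg h
    have h1 : g ≠ e := fun k => h (Or.inr (Or.inr (k ▸ he)))
    have h2 : g ≠ e' := fun k => h (Or.inr (Or.inr (k ▸ he')))
    exact ⟨(mem g).2 ⟨hg, h1, h2⟩, fun k => h ((inS' g).1 k).1, fun k => h (k ▸ uS),
      fun k => h (k ▸ vS)⟩
  have du : d u = - d e := by rw [hu]; exact dρ e (Or.inr (Or.inr he))
  have de' : d e' = - d e := by rw [hE]; exact dl e he
  have dv : d v = - d e' := by rw [hv]; exact dρ e' (Or.inr (Or.inr he'))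
  have hAQ : (A \ {e, e'}) \ (Q \ {e, e'}) = A \ Q := by
    ext g
    simp only [Finset.mem_sdiff, Finset.mem_insert, Finset.mem_singleton]
    constructor
    · rintro ⟨⟨h1, h2⟩, h3⟩
      exact ⟨h1, fun h => h3 ⟨h, h2⟩⟩
    · rintro ⟨h1, h2⟩
      refine ⟨⟨h1, ?_⟩, fun h => h2 h.1⟩
      rintro (rfl | rfl)
      · exact h2 he
      · exact h2 he'
  have hcard : (Q \ {e, e'}).card < N := by
    rw [← hN]
    apply Finset.card_lt_card
    refine ⟨Finset.sdiff_subset, fun h => ?_⟩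
    have := h he
    simp at this
  obtain ⟨L', g1, g2, g3, g4, g5⟩ := ih _ hcard (A \ {e, e'}) (swp ρ u v) (Q \ {e, e'}) L1 rfl S' V1 H'
    (by
      intro g hg
      obtain ⟨h1, h2, h3⟩ := (inS' g).1 hg
      by_cases gu : g = u
      · rw [gu, s1, dv, de', du]
      by_cases gv : g = v
      · rw [gv, s2, dv, de', du]; ring
      rw [s3 g gu gv]; exact dρ g h1)
    (by
      intro g hg
      exact dl g ((memQ g).1 hg).1)
    (by
      intro g hg h
      obtain ⟨h1, h2, h3⟩ := (mem g).1 hg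
      have h4 : ¬ InS Q p q g := fun k => h ((inS' g).2 ⟨k, h2, h3⟩)
      have h5 := nS g h1 h4
      rw [s3 g h5.2.2.1 h5.2.2.2]; exact hρ0 g h1 h4)
  rw [hAQ] at g1 g2 g4
  have sub : ∀ g ∈ A \ Q, g ∈ A \ {e, e'} := by
    intro g hg
    rw [← hAQ] at hg
    exact (Finset.mem_sdiff.1 hg).1
  refine ⟨L', g1, ?_, ?_, ?_, ?_⟩
  · intro f hf g hg h1 h2
    rw [g2 f hf g hg h1 h2, c2 f (sub f hf) g (sub g hg) h1 h2]
  · intro g hg h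
    obtain ⟨h1, h2, h3, h4⟩ := nS g hg h
    have := g3 g h1 h2
    rw [s3 g h3 h4] at this
    rw [this, c3 g h1 h3 h4]
  · intro g hg
    rw [g4 g hg, c4 g (sub g hg)]
  -- the sum
  have pm := (mem p).2 ⟨H.pA, pe, pe'⟩
  have qm := (mem q).2 ⟨H.qA, qe, qe'⟩
  have um := (mem u).2 ⟨uA, f2, f3⟩
  have vm := (mem v).2 ⟨vA, f4, f5⟩
  have L1ne : ∀ g ∈ A \ {e, e'}, ∀ h ∈ A \ {e, e'}, g ≠ h → L1 g ≠ L1 h :=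
    fun g hg h hh hne k => hne (V1.inj g hg h hh k)
  have Lne : ∀ g ∈ A, ∀ h ∈ A, g ≠ h → L g ≠ L h :=
    fun g hg h hh hne k => hne (V.inj g hg h hh k)
  have hpq : Real.sign (L1 q - L1 p) = Real.sign (L q - L p) :=
    sgn_congr (c2 p pm q qm H.pl H.ql) (L1ne p pm q qm H.pq) (Lne p H.pA q H.qA H.pq)
  have huv : Real.sign (L1 v - L1 u) = Real.sign (L v - L u) :=
    sgn_congr c5 (L1ne u um v vm f6) (Lne u uA v vA f6)
  rw [hpq] at g5
  rw [← g5]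
  have mS : ∀ g, g ∈ insert p (insert q Q) ↔ InS Q p q g := by
    intro g; simp [InS]
  have mS' : ∀ g, g ∈ insert p (insert q (Q \ {e, e'})) ↔ InS (Q \ {e, e'}) p q g := by
    intro g; simp [InS]
  have hSS : insert p (insert q Q) \ {e, e'} = insert p (insert q (Q \ {e, e'})) := by
    ext g
    rw [mS', inS', Finset.mem_sdiff, mS]; simp
  have A1 := sum_rem2 (insert p (insert q Q)) ((mS e).2 (Or.inr (Or.inr he)))
    ((mS e').2 (Or.inr (Or.inr he'))) f1 (fun g => d g * Real.sign (L (ρ g) - L g))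
  rw [hSS] at A1
  have A2 := sum_rem2 Q he he' f1 (fun g => d g * Real.sign (L (lam g) - L g))
  have A3 := sum_diff2 (insert p (insert q (Q \ {e, e'}))) ((mS' u).2 uS') ((mS' v).2 vS') f6
    (fun g => d g * Real.sign (L (ρ g) - L g))
    (fun g => d g * Real.sign (L1 (swp ρ u v g) - L1 g)) (by
      intro g hg gu gv
      have h1 := (mS' g).1 hg
      have h2 := (inS' g).1 h1
      have gA := H.inA h2.1
      have gm := (mem g).2 ⟨gA, h2.2⟩
      have h3 := S'.rm g gm
      rw [s3 g gu gv] at h3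
      rw [s3 g gu gv]
      congr 1
      exact (sgn_congr (c3 g gm gu gv) (L1ne _ gm _ h3 (S.rne g gA).symm)
        (Lne _ gA _ (S.rm g gA) (S.rne g gA).symm)).symm)
  have A4 : ∑ g ∈ Q \ {e, e'}, d g * Real.sign (L (lam g) - L g) =
      ∑ g ∈ Q \ {e, e'}, d g * Real.sign (L1 (lam g) - L1 g) := by
    apply Finset.sum_congr rfl
    intro g hg
    have gA := H.QA g ((memQ g).1 hg).1
    have gm := (mem g).2 ⟨gA, ((memQ g).1 hg).2⟩
    congr 1
    exact (sgn_congr (c4 g gm) (L1ne _ gm _ (S'.lm g gm) (S.lne g gA).symm)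
        (Lne _ gA _ (S.lm g gA) (S.lne g gA).symm)).symm
  simp only [← hu, ← hv, hρu, hρv, ← hE, hle, s1, s2, du, dv, de'] at A1 A2 A3
  rw [A1, A2, A3, A4]
  rw [sgn_swap (L1 u) (L1 v), huv, ← c6, sgn_swap (L u) (L e), sgn_swap (L e) (L e'), sgn_swap (L e') (L v)]
  ring

lemma insertion_val {E : Type*} [DecidableEq E] {A : Finset E} {l r : E → ℝ} {ρ lam : E → E}
    {a b : ℝ} {L : E → ℝ} (S : Sys A l r ρ lam) {e e' u v w : E} (he : e ∈ A)
    (hE : lam e = e') (hu : ρ e = u) (hv : ρ e' = v) (hle : l e = a) (hle' : l e' = a)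
    (hre : r e = b) (hre' : r e' = b) (hlu : l u ≤ a) (hlv : l v ≤ a) (hab : a < b)
    (f1 : e ≠ e') (f2 : u ≠ e) (f3 : u ≠ e') (f4 : v ≠ e) (f5 : v ≠ e') (f6 : u ≠ v)
    (V : Val (A \ {e, e'}) l r (swp ρ u v) lam L)
    (hc1 : ∀ y ∈ A \ {e, e'}, y ≠ w → ((L e < L y ↔ L w < L y) ∧ (L y < L e ↔ L y < L w)))
    (hc2 : ∀ y ∈ A \ {e, e'}, y ≠ w → ((L e' < L y ↔ L w < L y) ∧ (L y < L e' ↔ L y < L w)))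
    (huv : L u < L v)
    (ho : (w = u ∧ L u < L e ∧ L e < L e') ∨ (w = v ∧ L v < L e' ∧ L e' < L e) ∨
      (w = u ∧ L e' < L e ∧ L e < L u)) : Val A l r ρ lam L := by
  have he' : e' ∈ A := hE ▸ S.lm e he
  have hle2 : lam e' = e := by rw [← hE, S.li e he]
  have hρu : ρ u = e := by rw [← hu, S.ri e he]
  have hρv : ρ v = e' := by rw [← hv, S.ri e' he']
  have uA : u ∈ A := hu ▸ S.rm e he
  have vA : v ∈ A := hv ▸ S.rm e' he'
  have hru : r u = b := by rw [← hu, S.rr e he, hre]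
  have hrv : r v = b := by rw [← hv, S.rr e' he', hre']
  have s1 : swp ρ u v u = v := by simp [swp]
  have s2 : swp ρ u v v = u := by simp [swp, f6.symm]
  have s3 : ∀ g, g ≠ u → g ≠ v → swp ρ u v g = ρ g := by
    intro g h1 h2; simp [swp, h1, h2]
  have mem : ∀ g, g ∈ A \ {e, e'} ↔ g ∈ A ∧ g ≠ e ∧ g ≠ e' := by
    intro g; simp
  have um := (mem u).2 ⟨uA, f2, f3⟩
  have vm := (mem v).2 ⟨vA, f4, f5⟩
  have hw : w = u ∨ w = v := by
    rcases ho with h | h | h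
    · exact Or.inl h.1
    · exact Or.inr h.1
    · exact Or.inl h.1
  have wm : w ∈ A \ {e, e'} := by
    rcases hw with h | h <;> rw [h] <;> assumption
  have hrw : r w = b := by
    rcases hw with h | h <;> rw [h] <;> assumption
  have hlw : l w ≤ a := by
    rcases hw with h | h <;> rw [h] <;> assumption
  -- order of the cluster
  have ew : L e ≠ L w := by
    rcases ho with h | h | h <;> rw [h.1] <;> intro k <;> linarith [h.2.1, h.2.2]
  have ew' : L e' ≠ L w := by
    rcases ho with h | h | h <;> rw [h.1] <;> intro k <;> linarith [h.2.1, h.2.2]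
  have ee' : L e ≠ L e' := by
    rcases ho with h | h | h <;> intro k <;> linarith [h.2.1, h.2.2]
  have nw1 : L e < L w → L w < L e' → False := by
    rcases ho with h | h | h <;> rw [h.1] <;> intros <;> linarith [h.2.1, h.2.2]
  have nw2 : L e' < L w → L w < L e → False := by
    rcases ho with h | h | h <;> rw [h.1] <;> intros <;> linarith [h.2.1, h.2.2]
  have nob1 : ∀ y ∈ A, L e < L y → L y < L e' → False := by
    intro y hy h1 h2
    by_cases y1 : y = e
    · subst y1; exact lt_irrefl _ h1
    by_cases y2 : y = e'
    · subst y2; exact lt_irrefl _ h2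
    by_cases y3 : y = w
    · subst y3; exact nw1 h1 h2
    have ym := (mem y).2 ⟨hy, y1, y2⟩
    exact lt_asymm ((hc1 y ym y3).1.1 h1) ((hc2 y ym y3).2.1 h2)
  have nob2 : ∀ y ∈ A, L e' < L y → L y < L e → False := by
    intro y hy h1 h2
    by_cases y1 : y = e
    · subst y1; exact lt_irrefl _ h2
    by_cases y2 : y = e'
    · subst y2; exact lt_irrefl _ h1
    by_cases y3 : y = w
    · subst y3; exact nw2 h1 h2
    have ym := (mem y).2 ⟨hy, y1, y2⟩
    exact lt_asymm ((hc2 y ym y3).1.1 h1) ((hc1 y ym y3).2.1 h2)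
  -- order of u v e e'
  have ord : (L u < L e ∧ L e < L e' ∧ L e' < L v) ∨ (L u < L v ∧ L v < L e' ∧ L e' < L e) ∨
      (L e' < L e ∧ L e < L u ∧ L u < L v) := by
    rcases ho with ⟨h, h1, h2⟩ | ⟨h, h1, h2⟩ | ⟨h, h1, h2⟩
    · left
      refine ⟨h1, h2, (hc2 v vm (by rw [h]; exact f6.symm)).1.2 (by rw [h]; exact huv)⟩
    · right; left; exact ⟨huv, h1, h2⟩
    · right; right; exact ⟨h1, h2, huv⟩
  obtain ⟨π, hπ⟩ : ∃ π : E → E, ∀ x, π x = if x = e ∨ x = e' then w else x := ⟨_, fun _ => rfl⟩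
  have πe : π e = w := by rw [hπ]; simp
  have πe' : π e' = w := by rw [hπ]; simp
  have πo : ∀ x, x ≠ e → x ≠ e' → π x = x := by
    intro x h1 h2; rw [hπ]; simp [h1, h2]
  have πm : ∀ x ∈ A, π x ∈ A \ {e, e'} := by
    intro x hx
    by_cases h1 : x = e
    · rw [h1, πe]; exact wm
    by_cases h2 : x = e'
    · rw [h2, πe']; exact wm
    rw [πo x h1 h2]; exact (mem x).2 ⟨hx, h1, h2⟩
  have lo : ∀ x, ∀ y ∈ A \ {e, e'}, y ≠ w → (L x < L y ↔ L (π x) < L y) := by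
    intro x y hy hne
    by_cases h1 : x = e
    · rw [h1, πe]; exact (hc1 y hy hne).1
    by_cases h2 : x = e'
    · rw [h2, πe']; exact (hc2 y hy hne).1
    rw [πo x h1 h2]
  have hi : ∀ x, ∀ y ∈ A \ {e, e'}, y ≠ w → (L y < L x ↔ L y < L (π x)) := by
    intro x y hy hne
    by_cases h1 : x = e
    · rw [h1, πe]; exact (hc1 y hy hne).2
    by_cases h2 : x = e'
    · rw [h2, πe']; exact (hc2 y hy hne).2
    rw [πo x h1 h2]
  -- special arcs
  have spec : ∀ g, (g = u ∨ g = v ∨ g = e ∨ g = e') → π g = π (ρ g) ∨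
      (swp ρ u v (π g) = π (ρ g)) := by
    rintro g (rfl | rfl | rfl | rfl)
    · rw [hρu, πe, πo _ f2 f3]
      rcases hw with h | h
      · left; exact h.symm
      · right; rw [s1, h]
    · rw [hρv, πe', πo _ f4 f5]
      rcases hw with h | h
      · right; rw [s2, h]
      · left; exact h.symm
    · rw [hu, πe, πo _ f2 f3]
      rcases hw with h | h
      · left; exact h
      · right; rw [h, s2]
    · rw [hv, πe', πo _ f4 f5]
      rcases hw with h | h
      · right; rw [h, s1]
      · left; exact h
  have rmate : ∀ g ∈ A, ¬ (g = u ∨ g = v ∨ g = e ∨ g = e') →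
      ¬ (ρ g = u ∨ ρ g = v ∨ ρ g = e ∨ ρ g = e') := by
    intro g hg h k
    have := S.ri g hg
    rcases k with k | k | k | k <;> rw [k] at this
    · exact h (Or.inr (Or.inr (Or.inl (by rw [← this, hρu]))))
    · exact h (Or.inr (Or.inr (Or.inr (by rw [← this, hρv]))))
    · exact h (Or.inl (by rw [← this, hu]))
    · exact h (Or.inr (Or.inl (by rw [← this, hv])))
  have nsp : ∀ g ∈ A, ¬ (g = u ∨ g = v ∨ g = e ∨ g = e') → g ∈ A \ {e, e'} ∧ g ≠ w ∧
      swp ρ u v g = ρ g := by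
    intro g hg h
    push Not at h
    refine ⟨(mem g).2 ⟨hg, h.2.2⟩, ?_, s3 g h.1 h.2.1⟩
    rcases hw with k | k <;> rw [k]
    · exact h.1
    · exact h.2.1
  have spr : ∀ g, (g = u ∨ g = v ∨ g = e ∨ g = e') → r g = b := by
    rintro g (rfl | rfl | rfl | rfl) <;> assumption
  have πr : ∀ g, (g = u ∨ g = v ∨ g = e ∨ g = e') → r (π g) = b := by
    intro g h
    rw [hπ]; split_ifs
    · exact hrw
    · exact spr g h
  have sprho : ∀ g, (g = u ∨ g = v ∨ g = e ∨ g = e') → (ρ g = u ∨ ρ g = v ∨ ρ g = e ∨ ρ g = e') := by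
    rintro g (rfl | rfl | rfl | rfl)
    · exact Or.inr (Or.inr (Or.inl hρu))
    · exact Or.inr (Or.inr (Or.inr hρv))
    · exact Or.inl hu
    · exact Or.inr (Or.inl hv)
  refine ⟨?_, ?_, ?_, ?_, ?_⟩
  · -- inj
    have aux : ∀ x, x = e ∨ x = e' → ∀ y ∈ A \ {e, e'}, L x = L y → False := by
      intro x hx y hy h
      by_cases yw : y = w
      · rw [yw] at h
        rcases hx with rfl | rfl
        · exact ew h
        · exact ew' h
      have h1 := lo x y hy yw
      have h2 := hi x y hy yw
      rw [h] at h1 h2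
      have hx' : π x = w := by rw [hπ]; simp [hx]
      rw [hx'] at h1 h2
      have : L w = L y := by
        rcases lt_trichotomy (L w) (L y) with k | k | k
        · exact absurd (h1.2 k) (lt_irrefl _)
        · exact k
        · exact absurd (h2.2 k) (lt_irrefl _)
      exact yw (V.inj w wm y hy this).symm
    intro g hg h hh hgh
    by_cases g1 : g = e ∨ g = e'
    · by_cases h1 : h = e ∨ h = e'
      · rcases g1 with rfl | rfl <;> rcases h1 with rfl | rfl
        · rfl
        · exact absurd hgh ee'
        · exact absurd hgh ee'.symm
        · rfl
      · push Not at h1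
        exact (aux g g1 h ((mem h).2 ⟨hh, h1⟩) hgh).elim
    · push Not at g1
      by_cases h1 : h = e ∨ h = e'
      · exact (aux h h1 g ((mem g).2 ⟨hg, g1⟩) hgh.symm).elim
      · push Not at h1
        exact V.inj g ((mem g).2 ⟨hg, g1⟩) h ((mem h).2 ⟨hh, h1⟩) hgh
  · -- rv
    intro g hg h hh h1 h2 h3 h4
    by_cases sg : g = u ∨ g = v ∨ g = e ∨ g = e'
    · have hrg := spr g sg
      have sh : ¬ (h = u ∨ h = v ∨ h = e ∨ h = e') := fun k => by
        have := spr h k; linarith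
      obtain ⟨hm, hnw, -⟩ := nsp h hh sh
      rw [lo g h hm hnw] at h3
      rw [hi (ρ g) h hm hnw] at h4
      rcases spec g sg with k | k
      · rw [k] at h3; exact lt_asymm h3 h4
      · rw [← k] at h4
        have hr := πr g sg
        exact V.rv (π g) (πm g hg) h hm (by rw [hr, ← hrg]; exact h1) (by rw [hr, ← hrg]; exact h2) h3 h4
    · obtain ⟨gm, gw, gs⟩ := nsp g hg sg
      obtain ⟨gm', gw', -⟩ := nsp (ρ g) (S.rm g hg) (rmate g hg sg)
      rw [hi h g gm gw] at h3
      rw [lo h _ gm' gw'] at h4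
      rw [← gs] at h4
      by_cases hx : h = e ∨ h = e'
      · have hlh : l h = a := by rcases hx with rfl | rfl <;> assumption
        have hrh : r h = b := by rcases hx with rfl | rfl <;> assumption
        have hx' : π h = w := by rw [hπ]; simp [hx]
        rw [hx'] at h3 h4
        exact V.rv g gm w wm (by linarith) (by rw [hrw, ← hrh]; exact h2) h3 h4
      · push Not at hx
        rw [πo h hx.1 hx.2] at h3 h4
        exact V.rv g gm h ((mem h).2 ⟨hh, hx⟩) h1 h2 h3 h4
  · -- rn
    intro g hg h hh h1 h2 h3 h4
    by_cases sg : g = u ∨ g = v ∨ g = e ∨ g = e'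
    · by_cases sh : h = u ∨ h = v ∨ h = e ∨ h = e'
      · rcases sg with rfl | rfl | rfl | rfl <;> rcases sh with rfl | rfl | rfl | rfl <;>
          simp only [hρu, hρv, hu, hv] at h3 h4 <;>
          rcases ord with ⟨o1, o2, o3⟩ | ⟨o1, o2, o3⟩ | ⟨o1, o2, o3⟩ <;> linarith
      · obtain ⟨hm, hnw, hs⟩ := nsp h hh sh
        obtain ⟨hm', hnw', -⟩ := nsp (ρ h) (S.rm h hh) (rmate h hh sh)
        rw [lo g h hm hnw] at h2
        rw [hi (ρ g) h hm hnw] at h3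
        rw [lo (ρ g) _ hm' hnw'] at h4
        rcases spec g sg with k | k
        · rw [k] at h2; exact lt_asymm h2 h3
        · rw [← k] at h3 h4
          rw [← hs] at h4
          exact V.rn (π g) (πm g hg) h hm (by rw [πr g sg, ← h1, spr g sg]) h2 h3 h4
    · obtain ⟨gm, gw, gs⟩ := nsp g hg sg
      obtain ⟨gm', gw', -⟩ := nsp (ρ g) (S.rm g hg) (rmate g hg sg)
      by_cases sh : h = u ∨ h = v ∨ h = e ∨ h = e'
      · rw [hi h g gm gw] at h2
        rw [lo h _ gm' gw'] at h3
        rw [hi (ρ h) _ gm' gw'] at h4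
        rcases spec h sh with k | k
        · rw [← k] at h4; exact lt_asymm h3 h4
        · rw [← k] at h4
          rw [← gs] at h3 h4
          exact V.rn g gm (π h) (πm h hh) (by rw [πr h sh, h1, spr h sh]) h2 h3 h4
      · obtain ⟨hm, hnw, hs⟩ := nsp h hh sh
        rw [← gs] at h3 h4
        rw [← hs] at h4
        exact V.rn g gm h hm h1 h2 h3 h4
  · -- lv
    intro g hg h hh h1 h2 h3 h4
    by_cases sg : g = e
    · rw [sg] at h3 h4; rw [hE] at h4; exact nob1 h hh h3 h4
    by_cases sg' : g = e'
    · rw [sg'] at h3 h4; rw [hle2] at h4; exact nob2 h hh h3 h4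
    have gm := (mem g).2 ⟨hg, sg, sg'⟩
    have gl := S.lm g hg
    have gl1 : lam g ≠ e := fun k => sg' (by rw [← S.li g hg, k, hE])
    have gl2 : lam g ≠ e' := fun k => sg (by rw [← S.li g hg, k, hle2])
    have gm' := (mem (lam g)).2 ⟨gl, gl1, gl2⟩
    by_cases hx : h = e ∨ h = e'
    · have hlh : l h = a := by rcases hx with rfl | rfl <;> assumption
      have hrh : r h = b := by rcases hx with rfl | rfl <;> assumption
      have hx' : π h = w := by rw [hπ]; simp [hx]
      have gw : g ≠ w := fun k => by rw [← k] at hlw; linarith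
      have gw' : lam g ≠ w := fun k => by rw [← k, S.ll g hg] at hlw; linarith
      rw [hi h g gm gw, hx'] at h3
      rw [lo h _ gm' gw', hx'] at h4
      exact V.lv g gm w wm (by linarith) (by linarith) h3 h4
    · push Not at hx
      exact V.lv g gm h ((mem h).2 ⟨hh, hx⟩) h1 h2 h3 h4
  · -- ln
    intro g hg h hh h1 h2 h3 h4
    by_cases sg : g = e
    · rw [sg] at h2 h3; rw [hE] at h3; exact nob1 h hh h2 h3
    by_cases sg' : g = e'
    · rw [sg'] at h2 h3; rw [hle2] at h3; exact nob2 h hh h2 h3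
    by_cases sh : h = e
    · rw [sh] at h3 h4; rw [hE] at h4; exact nob1 _ (S.lm g hg) h3 h4
    by_cases sh' : h = e'
    · rw [sh'] at h3 h4; rw [hle2] at h4; exact nob2 _ (S.lm g hg) h3 h4
    exact V.ln g ((mem g).2 ⟨hg, sg, sg'⟩) h ((mem h).2 ⟨hh, sh, sh'⟩) h1 h2 h3 h4

lemma Val.congrL {E : Type*} {A : Finset E} {l r : E → ℝ} {ρ lam : E → E} {L L' : E → ℝ}
    (S : Sys A l r ρ lam) (V : Val A l r ρ lam L) (h : ∀ g ∈ A, L' g = L g) :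
    Val A l r ρ lam L' := by
  refine ⟨?_, ?_, ?_, ?_, ?_⟩
  · intro g hg f hf
    rw [h g hg, h f hf]; exact V.inj g hg f hf
  · intro g hg f hf
    rw [h g hg, h f hf, h _ (S.rm g hg)]; exact V.rv g hg f hf
  · intro g hg f hf
    rw [h g hg, h f hf, h _ (S.rm g hg), h _ (S.rm f hf)]; exact V.rn g hg f hf
  · intro g hg f hf
    rw [h g hg, h f hf, h _ (S.lm g hg)]; exact V.lv g hg f hf
  · intro g hg f hf
    rw [h g hg, h f hf, h _ (S.lm g hg), h _ (S.lm f hf)]; exact V.ln g hg f hf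

lemma near_iff {δ x y α : ℝ} (h : δ < |y - x|) (h1 : |α| < δ) :
    (x + α < y ↔ x < y) ∧ (y < x + α ↔ y < x) := by
  rw [abs_lt] at h1
  rcases lt_abs.1 h with h | h
  · constructor <;> constructor <;> intro <;> linarith [h1.1, h1.2]
  · constructor <;> constructor <;> intro <;> linarith [h1.1, h1.2]

lemma insertion_pos {E : Type*} [DecidableEq E] {A : Finset E} {l r : E → ℝ} {ρ lam : E → E}
    {Q : Finset E} {p q : E} {a b : ℝ} {L0 : E → ℝ} (S : Sys A l r ρ lam)
    (H : Run A l r ρ lam Q p q a b) {e : E} (he : e ∈ Q)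
    (V : Val (A \ {e, lam e}) l r (swp ρ (ρ e) (ρ (lam e))) lam L0)
    {x y z : ℝ} (hx : x = 1 ∨ x = -1) (hy : y = 1 ∨ y = -1) (hz : z = 1 ∨ z = -1)
    (huv : L0 (ρ e) < L0 (ρ (lam e))) (hs : x - y + z = 1) :
    ∃ L : E → ℝ, Val A l r ρ lam L ∧ (∀ g ∈ A \ {e, lam e}, L g = L0 g) ∧
      Real.sign (L e - L (ρ e)) = x ∧ Real.sign (L (lam e) - L e) = y ∧
      Real.sign (L (ρ (lam e)) - L (lam e)) = z := by
  obtain ⟨S', -⟩ := H.reduce S he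
  obtain ⟨f1, f2, f3, f4, f5, f6⟩ := H.facts S he
  have heA := H.QA e he
  have he' := H.Qlam e he
  have he'A := S.lm e heA
  have hle := S.li e heA
  obtain ⟨e', hE⟩ : ∃ e', e' = lam e := ⟨_, rfl⟩
  obtain ⟨u, hu⟩ : ∃ u, u = ρ e := ⟨_, rfl⟩
  obtain ⟨v, hv⟩ : ∃ v, v = ρ (lam e) := ⟨_, rfl⟩
  rw [← hu] at f2 f3 f6 S' V huv ⊢
  rw [← hv] at f4 f5 f6 S' V huv ⊢
  rw [← hE] at f1 f3 f5 he' he'A hle hv S' V ⊢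
  have uS : InS Q p q u := hu ▸ H.Qrho e (Or.inr (Or.inr he))
  have vS : InS Q p q v := hv ▸ H.Qrho e' (Or.inr (Or.inr he'))
  have hla : ∀ g, InS Q p q g → l g ≤ a := by
    rintro g (rfl | rfl | h)
    · exact H.pl.le
    · exact H.ql.le
    · exact (H.Ql g h).le
  have uA := H.inA uS
  have vA := H.inA vS
  have hab : a < b := by have := S.lr e heA; rwa [H.Ql e he, H.Qr e he] at this
  have mem : ∀ g, g ∈ A \ {e, e'} ↔ g ∈ A ∧ g ≠ e ∧ g ≠ e' := by
    intro g; simp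
  have um := (mem u).2 ⟨uA, f2, f3⟩
  have vm := (mem v).2 ⟨vA, f4, f5⟩
  have main : ∀ w ∈ A \ {e, e'}, ∀ δ > 0, (∀ g ∈ A, L0 g ≠ L0 w → δ < |L0 g - L0 w|) →
      ∀ α β, |α| < δ → |β| < δ →
      ((w = u ∧ 0 < α ∧ α < β) ∨ (w = v ∧ 0 < β ∧ β < α) ∨ (w = u ∧ β < α ∧ α < 0)) →
      ∃ L : E → ℝ, Val A l r ρ lam L ∧ (∀ g ∈ A \ {e, e'}, L g = L0 g) ∧ L e = L0 w + α ∧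
        L e' = L0 w + β := by
    intro w wm δ hδ hgap α β hα hβ ho
    obtain ⟨L, hL⟩ : ∃ L : E → ℝ, ∀ g, L g = if g = e then L0 w + α else if g = e' then L0 w + β
      else L0 g := ⟨_, fun _ => rfl⟩
    have Le : L e = L0 w + α := by rw [hL]; simp
    have Le' : L e' = L0 w + β := by rw [hL]; simp [f1.symm]
    have Lo : ∀ g ∈ A \ {e, e'}, L g = L0 g := by
      intro g hg
      have := (mem g).1 hg
      rw [hL]; simp [this.2.1, this.2.2]
    have hg : ∀ y ∈ A \ {e, e'}, y ≠ w → δ < |L0 y - L0 w| := by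
      intro y hy hne
      exact hgap y ((mem y).1 hy).1 fun k => hne (V.inj y hy w wm k)
    refine ⟨L, ?_, Lo, Le, Le'⟩
    refine insertion_val (a := a) (b := b) (w := w) S heA hE.symm hu.symm hv.symm (H.Ql e he)
      (H.Ql e' he') (H.Qr e he) (H.Qr e' he') (hla u uS) (hla v vS) hab f1 f2 f3 f4 f5 f6
      (V.congrL S' Lo) ?_ ?_ (by rw [Lo u um, Lo v vm]; exact huv) ?_
    · intro y hy hne
      rw [Lo y hy, Lo w wm, Le]
      exact near_iff (hg y hy hne) hα
    · intro y hy hne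
      rw [Lo y hy, Lo w wm, Le']
      exact near_iff (hg y hy hne) hβ
    · rw [Le, Le', Lo u um, Lo v vm]
      rcases ho with ⟨h, h1, h2⟩ | ⟨h, h1, h2⟩ | ⟨h, h1, h2⟩
      · left; rw [h]; exact ⟨rfl, by linarith, by linarith⟩
      · right; left; rw [h]; exact ⟨rfl, by linarith, by linarith⟩
      · right; right; rw [h]; exact ⟨rfl, by linarith, by linarith⟩
  obtain ⟨δu, hδu, gu⟩ := exists_gap A L0 (L0 u)
  obtain ⟨δv, hδv, gv⟩ := exists_gap A L0 (L0 v)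
  have huvδ : L0 u + δu < L0 v := by
    have := gu v vA huv.ne'
    rw [abs_of_pos (by linarith)] at this
    linarith
  have cases3 : (x = 1 ∧ y = 1 ∧ z = 1) ∨ (x = 1 ∧ y = -1 ∧ z = -1) ∨
      (x = -1 ∧ y = -1 ∧ z = 1) := by
    rcases hx with rfl | rfl <;> rcases hy with rfl | rfl <;> rcases hz with rfl | rfl <;>
      first | (exfalso; norm_num at hs; done) | simp
  rcases cases3 with ⟨rfl, rfl, rfl⟩ | ⟨rfl, rfl, rfl⟩ | ⟨rfl, rfl, rfl⟩
  · obtain ⟨L, k1, k2, k3, k4⟩ := main u um δu hδu gu (δu / 3) (2 * δu / 3)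
      (by rw [abs_of_pos (by linarith)]; linarith) (by rw [abs_of_pos (by linarith)]; linarith)
      (Or.inl ⟨rfl, by linarith, by linarith⟩)
    refine ⟨L, k1, k2, ?_, ?_, ?_⟩
    · rw [k3, k2 u um]; apply Real.sign_of_pos; linarith
    · rw [k4, k3]; apply Real.sign_of_pos; linarith
    · rw [k4, k2 v vm]; apply Real.sign_of_pos; linarith
  · obtain ⟨L, k1, k2, k3, k4⟩ := main v vm δv hδv gv (2 * δv / 3) (δv / 3)
      (by rw [abs_of_pos (by linarith)]; linarith) (by rw [abs_of_pos (by linarith)]; linarith)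
      (Or.inr (Or.inl ⟨rfl, by linarith, by linarith⟩))
    refine ⟨L, k1, k2, ?_, ?_, ?_⟩
    · rw [k3, k2 u um]; apply Real.sign_of_pos; linarith
    · rw [k4, k3]; apply Real.sign_of_neg; linarith
    · rw [k4, k2 v vm]; apply Real.sign_of_neg; linarith
  · obtain ⟨L, k1, k2, k3, k4⟩ := main u um δu hδu gu (-(δu / 3)) (-(2 * δu / 3))
      (by rw [abs_neg, abs_of_pos (by linarith)]; linarith)
      (by rw [abs_neg, abs_of_pos (by linarith)]; linarith)
      (Or.inr (Or.inr ⟨rfl, by linarith, by linarith⟩))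
    refine ⟨L, k1, k2, ?_, ?_, ?_⟩
    · rw [k3, k2 u um]; apply Real.sign_of_neg; linarith
    · rw [k4, k3]; apply Real.sign_of_neg; linarith
    · rw [k4, k2 v vm]; apply Real.sign_of_pos; linarith

lemma insertion_ex {E : Type*} [DecidableEq E] {A : Finset E} {l r : E → ℝ} {ρ lam : E → E}
    {Q : Finset E} {p q : E} {a b : ℝ} {L0 : E → ℝ} (S : Sys A l r ρ lam)
    (H : Run A l r ρ lam Q p q a b) {e : E} (he : e ∈ Q)
    (V : Val (A \ {e, lam e}) l r (swp ρ (ρ e) (ρ (lam e))) lam L0)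
    {x y z : ℝ} (hx : x = 1 ∨ x = -1) (hy : y = 1 ∨ y = -1) (hz : z = 1 ∨ z = -1)
    (hs : x - y + z = Real.sign (L0 (ρ (lam e)) - L0 (ρ e))) :
    ∃ L : E → ℝ, Val A l r ρ lam L ∧ (∀ g ∈ A \ {e, lam e}, L g = L0 g) ∧
      Real.sign (L e - L (ρ e)) = x ∧ Real.sign (L (lam e) - L e) = y ∧
      Real.sign (L (ρ (lam e)) - L (lam e)) = z := by
  rcases lt_trichotomy (L0 (ρ e)) (L0 (ρ (lam e))) with h | h | h
  · rw [sgn_pos' h] at hs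
    exact insertion_pos S H he V hx hy hz h hs
  · rw [h, sub_self, Real.sign_zero] at hs
    rcases hx with rfl | rfl <;> rcases hy with rfl | rfl <;> rcases hz with rfl | rfl <;>
      norm_num at hs
  · rw [sgn_neg' h] at hs
    obtain ⟨S', -⟩ := H.reduce S he
    have nn : ∀ {t : ℝ}, (t = 1 ∨ t = -1) → (-t = 1 ∨ -t = -1) := by
      rintro t (rfl | rfl)
      · right; rfl
      · left; norm_num
    obtain ⟨L, k1, k2, k3, k4, k5⟩ := insertion_pos S H he (V.neg S') (nn hx) (nn hy) (nn hz)
      (by simpa using h) (by linarith)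
    refine ⟨fun g => - L g, k1.neg S, ?_, ?_, ?_, ?_⟩
    · intro g hg; simp only; rw [k2 g hg, neg_neg]
    · rw [← neg_inj, ← k3, ← Real.sign_neg]; congr 1; ring
    · rw [← neg_inj, ← k4, ← Real.sign_neg]; congr 1; ring
    · rw [← neg_inj, ← k5, ← Real.sign_neg]; congr 1; ring

lemma pm_mul {x y : ℝ} (hx : x = 1 ∨ x = -1) (hy : y = 1 ∨ y = -1) : x * y = 1 ∨ x * y = -1 := by
  rcases hx with rfl | rfl <;> rcases hy with rfl | rfl <;> norm_num

lemma pm_sq {x : ℝ} (hx : x = 1 ∨ x = -1) : x * x = 1 := by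
  rcases hx with rfl | rfl <;> norm_num

theorem reverse_ind {E : Type*} [DecidableEq E] {l r : E → ℝ} {lam : E → E}
    {p q : E} {a b : ℝ} (d τl : E → ℝ) (ρ0 : E → E) (hp0 : ρ0 p = q) (hq0 : ρ0 q = p)
    (T : ℝ) (hT : T = 1 ∨ T = -1) (L0 : E → ℝ) (hL0 : d p * Real.sign (L0 q - L0 p) = T)
    (hd : ∀ g, d g = 1 ∨ d g = -1) (hτl : ∀ g, τl g = 1 ∨ τl g = -1) :
    ∀ (N : ℕ) (A : Finset E) (ρ : E → E) (Q : Finset E) (τ : E → ℝ), Q.card = N →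
    Sys A l r ρ lam → Run A l r ρ lam Q p q a b →
    (∀ g, InS Q p q g → d (ρ g) = - d g) → (∀ g ∈ Q, d (lam g) = - d g) →
    (∀ g ∈ A, ¬ InS Q p q g → ρ0 g = ρ g) → (∀ g, τ g = 1 ∨ τ g = -1) →
    (∀ g, InS Q p q g → τ (ρ g) = τ g) → (∀ g ∈ Q, τl (lam g) = τl g) →
    ∑ g ∈ insert p (insert q Q), τ g + ∑ g ∈ Q, τl g = 2 * T →
    Val (A \ Q) l r ρ0 lam L0 →
    ∃ L : E → ℝ, Val A l r ρ lam L ∧ (∀ g ∈ A \ Q, L g = L0 g) ∧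
    (∀ g, InS Q p q g → d g * Real.sign (L (ρ g) - L g) = τ g) ∧
    (∀ g ∈ Q, d g * Real.sign (L (lam g) - L g) = τl g) := by
  intro N
  induction N using Nat.strong_induction_on with
  | _ N ih =>
  intro A ρ Q τ hN S H dρ dl hρ0 hτ τρ τlam hsum V0
  rcases Q.eq_empty_or_nonempty with rfl | hQ
  · have ρp : ρ p = q := by
      rcases H.Qrho p (Or.inl rfl) with h | h | h
      · exact absurd h (S.rne p H.pA)
      · exact h
      · simp at h
    have ρq : ρ q = p := by rw [← ρp, S.ri p H.pA]
    have tq : τ q = τ p := by rw [← ρp]; exact τρ p (Or.inl rfl)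
    have dq : d q = - d p := by rw [← ρp]; exact dρ p (Or.inl rfl)
    simp only [insert_empty_eq, Finset.sum_empty, add_zero] at hsum
    rw [Finset.sum_pair H.pq, tq] at hsum
    have tp : τ p = T := by linarith
    refine ⟨L0, ?_, fun _ _ => rfl, ?_, ?_⟩
    · rw [Finset.sdiff_empty] at V0
      apply V0.congr
      intro g hg
      by_cases h1 : g = p
      · rw [h1, hp0, ρp]
      by_cases h2 : g = q
      · rw [h2, hq0, ρq]
      symm
      apply hρ0 g hg
      rintro (h | h | h)
      · exact h1 h
      · exact h2 h
      · simp at h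
    · rintro g (rfl | rfl | h)
      · rw [ρp, hL0, tp]
      · rw [ρq, tq, tp, ← hL0, dq, sgn_swap (L0 p) (L0 g)]; ring
      · simp at h
    · simp
  have mS : ∀ g, g ∈ insert p (insert q Q) ↔ InS Q p q g := by
    intro g; simp [InS]
  obtain ⟨e, he, hne⟩ : ∃ e ∈ Q, ¬ (τl e = τ e ∧ τ (lam e) = τ e) := by
    by_contra hcon
    push Not at hcon
    have hall := H.conn (fun g => τ g = τ p) ⟨p, Or.inl rfl, rfl⟩
      (fun g hg h => by rw [τρ g hg]; exact h)
      (fun g hg h => by rw [(hcon g hg).2]; exact h)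
    have h1 : ∑ g ∈ insert p (insert q Q), τ g = ((Q.card : ℝ) + 2) * τ p := by
      rw [Finset.sum_congr rfl (g := fun _ => τ p) (fun g hg => hall g ((mS g).1 hg))]
      rw [Finset.sum_const, Finset.card_insert_of_notMem, Finset.card_insert_of_notMem H.qQ]
      · rw [nsmul_eq_mul]; push_cast; ring
      · rw [Finset.mem_insert]
        rintro (h | h)
        · exact H.pq h
        · exact H.pQ h
    have h2 : ∑ g ∈ Q, τl g = (Q.card : ℝ) * τ p := by
      rw [Finset.sum_congr rfl (g := fun _ => τ p)
        (fun g hg => by rw [(hcon g hg).1]; exact hall g (Or.inr (Or.inr hg)))]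
      rw [Finset.sum_const, nsmul_eq_mul]
    rw [h1, h2] at hsum
    have h3 : (0 : ℝ) < Q.card := by exact_mod_cast hQ.card_pos
    rcases hτ p with h | h <;> rcases hT with h' | h' <;> rw [h, h'] at hsum <;> linarith
  obtain ⟨S', H'⟩ := H.reduce S he
  have ins := @insertion_ex E _ A l r ρ lam Q p q a b
  obtain ⟨f1, f2, f3, f4, f5, f6⟩ := H.facts S he
  have heA := H.QA e he
  have he' := H.Qlam e he
  have he'A := S.lm e heA
  have hle := S.li e heA
  have tle := τlam e he
  obtain ⟨e', hE⟩ : ∃ e', e' = lam e := ⟨_, rfl⟩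
  obtain ⟨u, hu⟩ : ∃ u, u = ρ e := ⟨_, rfl⟩
  obtain ⟨v, hv⟩ : ∃ v, v = ρ (lam e) := ⟨_, rfl⟩
  have insx := fun (L1 : E → ℝ) (x y z : ℝ) => ins (L0 := L1) S H he (x := x) (y := y) (z := z)
  rw [← hu] at f2 f3 f6 S' H' insx
  rw [← hv] at f4 f5 f6 S' H' insx
  rw [← hE] at f1 f3 f5 he' he'A hle hv S' H' hne tle insx
  clear ins
  have uS : InS Q p q u := hu ▸ H.Qrho e (Or.inr (Or.inr he))
  have vS : InS Q p q v := hv ▸ H.Qrho e' (Or.inr (Or.inr he'))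
  have uA := H.inA uS
  have vA := H.inA vS
  have hρu : ρ u = e := by rw [hu, S.ri e heA]
  have hρv : ρ v = e' := by rw [hv, S.ri e' he'A]
  have s1 : swp ρ u v u = v := by simp [swp]
  have s2 : swp ρ u v v = u := by simp [swp, f6.symm]
  have s3 : ∀ g, g ≠ u → g ≠ v → swp ρ u v g = ρ g := by
    intro g h1 h2; simp [swp, h1, h2]
  have mem : ∀ g, g ∈ A \ {e, e'} ↔ g ∈ A ∧ g ≠ e ∧ g ≠ e' := by
    intro g; simp
  have memQ : ∀ g, g ∈ Q \ {e, e'} ↔ g ∈ Q ∧ g ≠ e ∧ g ≠ e' := by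
    intro g; simp
  have pe : p ≠ e := fun h => H.pQ (h ▸ he)
  have pe' : p ≠ e' := fun h => H.pQ (h ▸ he')
  have qe : q ≠ e := fun h => H.qQ (h ▸ he)
  have qe' : q ≠ e' := fun h => H.qQ (h ▸ he')
  have inS' : ∀ g, InS (Q \ {e, e'}) p q g ↔ InS Q p q g ∧ g ≠ e ∧ g ≠ e' := by
    intro g
    unfold InS
    rw [memQ]
    constructor
    · rintro (rfl | rfl | h)
      · exact ⟨Or.inl rfl, pe, pe'⟩
      · exact ⟨Or.inr (Or.inl rfl), qe, qe'⟩
      · exact ⟨Or.inr (Or.inr h.1), h.2⟩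
    · rintro ⟨rfl | rfl | h, h2⟩
      · exact Or.inl rfl
      · exact Or.inr (Or.inl rfl)
      · exact Or.inr (Or.inr ⟨h, h2⟩)
  have uS' := (inS' u).2 ⟨uS, f2, f3⟩
  have vS' := (inS' v).2 ⟨vS, f4, f5⟩
  have nS : ∀ g ∈ A, ¬ InS Q p q g → g ∈ A \ {e, e'} ∧ ¬ InS (Q \ {e, e'}) p q g ∧
      g ≠ u ∧ g ≠ v := by
    intro g hg h
    have h1 : g ≠ e := fun k => h (Or.inr (Or.inr (k ▸ he)))
    have h2 : g ≠ e' := fun k => h (Or.inr (Or.inr (k ▸ he')))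
    exact ⟨(mem g).2 ⟨hg, h1, h2⟩, fun k => h ((inS' g).1 k).1, fun k => h (k ▸ uS),
      fun k => h (k ▸ vS)⟩
  have du : d u = - d e := by rw [hu]; exact dρ e (Or.inr (Or.inr he))
  have de' : d e' = - d e := by rw [hE]; exact dl e he
  have dv : d v = - d e' := by rw [hv]; exact dρ e' (Or.inr (Or.inr he'))
  have tu : τ u = τ e := by rw [hu]; exact τρ e (Or.inr (Or.inr he))
  have tv : τ v = τ e' := by rw [hv]; exact τρ e' (Or.inr (Or.inr he'))
  have hAQ : (A \ {e, e'}) \ (Q \ {e, e'}) = A \ Q := by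
    ext g
    simp only [Finset.mem_sdiff, Finset.mem_insert, Finset.mem_singleton]
    constructor
    · rintro ⟨⟨h1, h2⟩, h3⟩
      exact ⟨h1, fun h => h3 ⟨h, h2⟩⟩
    · rintro ⟨h1, h2⟩
      refine ⟨⟨h1, ?_⟩, fun h => h2 h.1⟩
      rintro (rfl | rfl)
      · exact h2 he
      · exact h2 he'
  have hcard : (Q \ {e, e'}).card < N := by
    rw [← hN]
    apply Finset.card_lt_card
    refine ⟨Finset.sdiff_subset, fun h => ?_⟩
    have := h he
    simp at this
  obtain ⟨T', hT'⟩ : ∃ T', T' = τ e + τl e + τ e' := ⟨_, rfl⟩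
  have T'pm : T' = 1 ∨ T' = -1 := by
    rw [hT']
    rcases hτ e with h1 | h1 <;> rcases hτl e with h2 | h2 <;> rcases hτ e' with h3 | h3 <;>
      rw [h1, h2, h3] at hne ⊢ <;>
      first | (exfalso; norm_num at hne; done) | norm_num
  obtain ⟨τ', hτ'⟩ : ∃ τ' : E → ℝ, ∀ g, τ' g = if g = u ∨ g = v then T' else τ g :=
    ⟨_, fun _ => rfl⟩
  have tu' : τ' u = T' := by rw [hτ']; simp
  have tv' : τ' v = T' := by rw [hτ']; simp
  have to' : ∀ g, g ≠ u → g ≠ v → τ' g = τ g := by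
    intro g h1 h2; rw [hτ']; simp [h1, h2]
  have mS' : ∀ g, g ∈ insert p (insert q (Q \ {e, e'})) ↔ InS (Q \ {e, e'}) p q g := by
    intro g; simp [InS]
  have hSS : insert p (insert q Q) \ {e, e'} = insert p (insert q (Q \ {e, e'})) := by
    ext g
    rw [mS', inS', Finset.mem_sdiff, mS]; simp
  have A1 := sum_rem2 (insert p (insert q Q)) ((mS e).2 (Or.inr (Or.inr he)))
    ((mS e').2 (Or.inr (Or.inr he'))) f1 τ
  rw [hSS] at A1
  have A2 := sum_rem2 Q he he' f1 τl
  have A3 := sum_diff2 (insert p (insert q (Q \ {e, e'}))) ((mS' u).2 uS') ((mS' v).2 vS') f6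
    τ τ' (fun g _ h1 h2 => (to' g h1 h2).symm)
  rw [tu, tv, tu', tv', hT'] at A3
  have smate : ∀ g ∈ A, g ≠ e → g ≠ e' → ρ g ≠ u ∧ ρ g ≠ v := by
    intro g hg h1 h2
    have := S.ri g hg
    refine ⟨fun k => h1 ?_, fun k => h2 ?_⟩ <;> rw [← this, k]
    · exact hρu
    · exact hρv
  obtain ⟨L1, V1, g2, g3, g4⟩ := ih _ hcard (A \ {e, e'}) (swp ρ u v) (Q \ {e, e'}) τ' rfl S' H'
    (by
      intro g hg
      obtain ⟨h1, h2, h3⟩ := (inS' g).1 hg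
      by_cases gu : g = u
      · rw [gu, s1, dv, de', du]
      by_cases gv : g = v
      · rw [gv, s2, dv, de', du]; ring
      rw [s3 g gu gv]; exact dρ g h1)
    (by
      intro g hg
      exact dl g ((memQ g).1 hg).1)
    (by
      intro g hg h
      obtain ⟨h1, h2, h3⟩ := (mem g).1 hg
      have h4 : ¬ InS Q p q g := fun k => h ((inS' g).2 ⟨k, h2, h3⟩)
      have h5 := nS g h1 h4
      rw [s3 g h5.2.2.1 h5.2.2.2]; exact hρ0 g h1 h4)
    (by
      intro g; rw [hτ']; split_ifs
      · exact T'pm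
      · exact hτ g)
    (by
      intro g hg
      obtain ⟨h1, h2, h3⟩ := (inS' g).1 hg
      by_cases gu : g = u
      · rw [gu, s1, tu', tv']
      by_cases gv : g = v
      · rw [gv, s2, tu', tv']
      have := smate g (H.inA h1) h2 h3
      rw [s3 g gu gv, to' _ this.1 this.2, to' _ gu gv]; exact τρ g h1)
    (by
      intro g hg
      exact τlam g ((memQ g).1 hg).1)
    (by linarith)
    (by rw [hAQ]; exact V0)
  have hdu := hd u
  have huv : d u * Real.sign (L1 v - L1 u) = T' := by
    have := g3 u uS'
    rwa [s1, tu'] at this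
  have huv2 : Real.sign (L1 v - L1 u) = d u * T' := by
    rw [← huv, ← mul_assoc, pm_sq hdu, one_mul]
  obtain ⟨L, k1, k2, k3, k4, k5⟩ := insx L1 (d u * τ e) (d e * τl e) (d u * τ e') V1
    (pm_mul hdu (hτ e)) (pm_mul (hd e) (hτl e)) (pm_mul hdu (hτ e'))
    (by rw [huv2, hT', du]; ring)
  have um := (mem u).2 ⟨uA, f2, f3⟩
  have vm := (mem v).2 ⟨vA, f4, f5⟩
  have sub : ∀ g ∈ A \ Q, g ∈ A \ {e, e'} := by
    intro g hg
    rw [← hAQ] at hg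
    exact (Finset.mem_sdiff.1 hg).1
  have dd := pm_sq (hd e)
  refine ⟨L, k1, ?_, ?_, ?_⟩
  · intro g hg
    rw [k2 g (sub g hg)]
    apply g2
    rw [hAQ]; exact hg
  · intro g hg
    by_cases h1 : g = e
    · rw [h1, ← hu, sgn_swap, k3, du]; linear_combination τ e * dd
    by_cases h2 : g = e'
    · rw [h2, ← hv, k5, du, de']; linear_combination τ e' * dd
    by_cases h3 : g = u
    · rw [h3, hρu, k3, tu, du]; linear_combination τ e * dd
    by_cases h4 : g = v
    · rw [h4, hρv, sgn_swap, k5, tv, du, dv, de']; linear_combination τ e' * dd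
    have gm := (mem g).2 ⟨H.inA hg, h1, h2⟩
    have gm' := S'.rm g gm
    rw [s3 g h3 h4] at gm'
    have := g3 g ((inS' g).2 ⟨hg, h1, h2⟩)
    rw [s3 g h3 h4, to' g h3 h4] at this
    rw [k2 _ gm, k2 _ gm', this]
  · intro g hg
    by_cases h1 : g = e
    · rw [h1, ← hE, k4]; linear_combination τl e * dd
    by_cases h2 : g = e'
    · rw [h2, hle, tle, sgn_swap, k4, de']; linear_combination τl e * dd
    have gm := (mem g).2 ⟨H.QA g hg, h1, h2⟩
    rw [k2 _ gm, k2 _ (S'.lm g gm)]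
    exact g4 g ((memQ g).2 ⟨hg, h1, h2⟩)

open Classical in
noncomputable def cR {E : Type*} (A : Finset E) (l r L : E → ℝ) (g : E) : ZMod 2 :=
  ∑ h ∈ A, if l h < r g ∧ r g ≤ r h ∧ L g < L h then 1 else 0

open Classical in
noncomputable def cL {E : Type*} (A : Finset E) (l r L : E → ℝ) (g : E) : ZMod 2 :=
  ∑ h ∈ A, if l h ≤ l g ∧ l g < r h ∧ L g < L h then 1 else 0

lemma cL_mirror {E : Type*} (A : Finset E) (l r L : E → ℝ) (g : E) :
    cL A l r L g = cR A (fun x => - r x) (fun x => - l x) L g := by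
  unfold cL cR
  apply Finset.sum_congr rfl
  intro h _
  congr 1
  simp only [neg_lt_neg_iff, neg_le_neg_iff, eq_iff_iff]
  constructor
  · rintro ⟨h1, h2, h3⟩; exact ⟨h2, h1, h3⟩
  · rintro ⟨h1, h2, h3⟩; exact ⟨h2, h1, h3⟩

lemma Sys.mirror {E : Type*} {A : Finset E} {l r : E → ℝ} {ρ lam : E → E}
    (S : Sys A l r ρ lam) : Sys A (fun x => - r x) (fun x => - l x) lam ρ := by
  refine ⟨?_, S.lm, S.li, S.lne, ?_, S.rm, S.ri, S.rne, ?_⟩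
  · intro g hg; have := S.lr g hg; linarith
  · intro g hg; rw [S.ll g hg]
  · intro g hg; rw [S.rr g hg]

lemma Val.mirror {E : Type*} {A : Finset E} {l r : E → ℝ} {ρ lam : E → E} {L : E → ℝ}
    (V : Val A l r ρ lam L) : Val A (fun x => - r x) (fun x => - l x) lam ρ L := by
  refine ⟨V.inj, ?_, ?_, ?_, ?_⟩
  · intro g hg h hh a b
    exact V.lv g hg h hh (by simpa using b) (by simpa using a)
  · intro g hg h hh a
    exact V.ln g hg h hh (by simpa using a)
  · intro g hg h hh a b
    exact V.rv g hg h hh (by simpa using b) (by simpa using a)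
  · intro g hg h hh a
    exact V.rn g hg h hh (by simpa using a)

lemma top2 {E : Type*} {A : Finset E} {l r : E → ℝ} {ρ lam : E → E} {L : E → ℝ}
    (S : Sys A l r ρ lam) (V : Val A l r ρ lam L) {g : E} (hg : g ∈ A) :
    cR A l r L g + cR A l r L (ρ g) = 1 := by
  classical
  have hg' := S.rm g hg
  have gne : L g ≠ L (ρ g) := fun k => S.rne g hg (V.inj _ hg _ hg' k).symm
  unfold cR
  rw [S.rr g hg, ← Finset.sum_add_distrib]
  have step : ∀ h ∈ A, ((if l h < r g ∧ r g ≤ r h ∧ L g < L h then 1 else 0) +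
      (if l h < r g ∧ r g ≤ r h ∧ L (ρ g) < L h then 1 else 0) : ZMod 2) =
      if r h = r g then ((if L g < L h then 1 else 0) + (if L (ρ g) < L h then 1 else 0)) else 0 := by
    intro h hh
    have hlr := S.lr h hh
    by_cases h1 : r h = r g
    · have h2 : l h < r g := by linarith
      simp [h1, h2]
    · rw [if_neg h1]
      by_cases h2 : l h < r g ∧ r g < r h
      · have := V.rv_iff S hg hh h2.1 h2.2
        simp only [this]
        exact CharTwo.add_self_eq_zero _
      · rw [if_neg, if_neg, add_zero]
        · rintro ⟨k1, k2, -⟩; exact h2 ⟨k1, lt_of_le_of_ne k2 (Ne.symm h1)⟩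
        · rintro ⟨k1, k2, -⟩; exact h2 ⟨k1, lt_of_le_of_ne k2 (Ne.symm h1)⟩
  rw [Finset.sum_congr rfl step]
  have sub : ({g, ρ g} : Finset E) ⊆ A := by
    intro x hx; simp at hx; rcases hx with rfl | rfl <;> assumption
  rw [← Finset.sum_sdiff sub, Finset.sum_pair (S.rne g hg).symm]
  have rest : ∑ h ∈ A \ {g, ρ g}, (if r h = r g then ((if L g < L h then 1 else 0) +
      (if L (ρ g) < L h then 1 else 0)) else 0 : ZMod 2) = 0 := by
    have mem : ∀ h ∈ A \ {g, ρ g}, h ∈ A ∧ h ≠ g ∧ h ≠ ρ g := by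
      intro h hh; simpa using hh
    apply Finset.sum_involution (fun h _ => ρ h)
    · intro h hh
      obtain ⟨h1, h2, h3⟩ := mem h hh
      rw [S.rr h h1]
      by_cases hr : r h = r g
      · simp only [if_pos hr]
        have hh' := S.rm h h1
        have n1 : L h ≠ L g := fun k => h2 (V.inj _ h1 _ hg k)
        have n2 : L h ≠ L (ρ g) := fun k => h3 (V.inj _ h1 _ hg' k)
        have n3 : L (ρ h) ≠ L g := fun k => h3 (by rw [← V.inj _ hh' _ hg k, S.ri h h1])
        have n4 : L (ρ h) ≠ L (ρ g) := fun k => h2 (by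
          have := congrArg ρ (V.inj _ hh' _ hg' k)
          rwa [S.ri h h1, S.ri g hg] at this)
        have a1 := V.rn_in S h1 hg hr
        have a2 := V.rn_in S h1 hg' (by rw [S.rr g hg, hr])
        have a3 := V.rn_in S hh' hg (by rw [S.rr h h1, hr])
        have a4 := V.rn_in S hh' hg' (by rw [S.rr h h1, S.rr g hg, hr])
        rw [S.ri g hg] at a2 a4
        rw [S.ri h h1] at a3 a4
        have two : (1 : ZMod 2) + 1 = 0 := by decide
        split_ifs <;> first | (exfalso; grind; done) | (norm_num; done) | decide
      · simp [hr]
    · intro h hh _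
      exact S.rne h (mem h hh).1
    · intro h hh
      obtain ⟨h1, h2, h3⟩ := mem h hh
      have : ρ h ∈ A ∧ ρ h ≠ g ∧ ρ h ≠ ρ g := by
        refine ⟨S.rm h h1, fun k => h3 (by rw [← k, S.ri h h1]), fun k => h2 ?_⟩
        rw [← S.ri h h1, k, S.ri g hg]
      simpa using this
    · intro h hh
      exact S.ri h (mem h hh).1
  rw [rest, S.rr g hg]
  rcases lt_or_gt_of_ne gne with k | k
  · simp [k, not_lt.2 k.le]
  · simp [k, not_lt.2 k.le]

lemma top3 {E : Type*} {A : Finset E} {l r : E → ℝ} {ρ lam : E → E} {L : E → ℝ}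
    (S : Sys A l r ρ lam) (V : Val A l r ρ lam L) {g : E} (hg : g ∈ A) :
    cL A l r L g + cL A l r L (lam g) = 1 := by
  rw [cL_mirror, cL_mirror]; exact top2 S.mirror V.mirror hg

lemma top1_half {E : Type*} {A : Finset E} {l r : E → ℝ} {ρ lam : E → E} {L : E → ℝ}
    (S : Sys A l r ρ lam) (V : Val A l r ρ lam L) {g : E} (hg : g ∈ A) [DecidableRel ((· < ·) : ℝ → ℝ → Prop)] :
    ∑ h ∈ A, (if l g < r h ∧ r h < r g ∧ L g < L h then 1 else 0 : ZMod 2) = 0 := by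
  classical
  apply Finset.sum_involution (fun h _ => ρ h)
  · intro h hh
    rw [S.rr h hh]
    by_cases k : l g < r h ∧ r h < r g
    · have h1 := V.rv_iff S hh hg k.1 k.2
      have n1 : L h ≠ L g := fun e => by
        have := V.inj _ hh _ hg e
        rw [this] at k; exact lt_irrefl _ k.2
      have n2 : L (ρ h) ≠ L g := fun e => by
        have := V.inj _ (S.rm h hh) _ hg e
        rw [← this, S.rr h hh] at k; exact lt_irrefl _ k.2
      have h2 : L g < L h ↔ L g < L (ρ h) := by
        constructor
        · intro h3
          rcases lt_or_gt_of_ne n2 with h4 | h4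
          · exact absurd (h1.2 h4) (by linarith)
          · exact h4
        · intro h3
          rcases lt_or_gt_of_ne n1 with h4 | h4
          · exact absurd (h1.1 h4) (by linarith)
          · exact h4
      simp only [h2]
      exact CharTwo.add_self_eq_zero _
    · rw [if_neg, if_neg, add_zero]
      · rintro ⟨k1, k2, -⟩; exact k ⟨k1, k2⟩
      · rintro ⟨k1, k2, -⟩; exact k ⟨k1, k2⟩
  · intro h hh _; exact S.rne h hh
  · intro h hh; exact S.rm h hh
  · intro h hh; exact S.ri h hh

lemma top1 {E : Type*} {A : Finset E} {l r : E → ℝ} {ρ lam : E → E} {L : E → ℝ}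
    (S : Sys A l r ρ lam) (V : Val A l r ρ lam L) {g : E} (hg : g ∈ A) :
    cL A l r L g = cR A l r L g := by
  classical
  have e1 := top1_half S V hg
  have e2 := top1_half S.mirror V.mirror hg
  have e3 : cL A l r L g + cR A l r L g =
      ∑ h ∈ A, (if l g < r h ∧ r h < r g ∧ L g < L h then 1 else 0 : ZMod 2) +
      ∑ h ∈ A, (if -r g < -l h ∧ -l h < -l g ∧ L g < L h then 1 else 0 : ZMod 2) := by
    unfold cL cR
    rw [← Finset.sum_add_distrib, ← Finset.sum_add_distrib]
    apply Finset.sum_congr rfl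
    intro h hh
    have := S.lr h hh
    have := S.lr g hg
    simp only [neg_lt_neg_iff]
    have two : (1 : ZMod 2) + 1 = 0 := by decide
    by_cases k : L g < L h
    · simp only [k, and_true]
      split_ifs <;> first | (exfalso; grind; done) | (norm_num; done) | decide
    · simp [k]
  rw [e1, e2, add_zero] at e3
  exact CharTwo.add_eq_zero.1 e3

lemma betw_iff {a b y : ℝ} : y ∈ betw a b ↔ (y - a) * (y - b) < 0 := by
  unfold betw
  rw [Set.mem_Ioo, min_lt_iff, lt_max_iff, mul_neg_iff]
  constructor
  · rintro ⟨h1 | h1, h2 | h2⟩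
    · linarith
    · left; constructor <;> linarith
    · right; constructor <;> linarith
    · linarith
  · rintro (⟨h1, h2⟩ | ⟨h1, h2⟩)
    · exact ⟨Or.inl (by linarith), Or.inr (by linarith)⟩
    · exact ⟨Or.inr (by linarith), Or.inl (by linarith)⟩

lemma betw_comm (a b : ℝ) : betw a b = betw b a := by
  unfold betw; rw [min_comm, max_comm]

lemma betw_lt {a b : ℝ} (h : a ≤ b) : betw a b = Set.Ioo a b := by
  unfold betw; rw [min_eq_left h, max_eq_right h]

lemma betw_cross {a b c d : ℝ} (h1 : a < c) (h2 : c < b) (h3 : b < d) :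
    ¬ (Disjoint (betw a b) (betw c d) ∨ betw a b ⊆ betw c d ∨ betw c d ⊆ betw a b) := by
  rw [betw_lt (h1.trans h2).le, betw_lt (h2.trans h3).le]
  rintro (h | h | h)
  · rw [Set.disjoint_left] at h
    exact h (a := (c + b) / 2) ⟨by linarith, by linarith⟩ ⟨by linarith, by linarith⟩
  · have := @h ((a + c) / 2) ⟨by linarith, by linarith⟩
    linarith [this.1]
  · have := @h ((b + d) / 2) ⟨by linarith, by linarith⟩
    linarith [this.2]

lemma betw_nest {a b c d : ℝ} (hab : a ≤ b) (hcd : c ≤ d) (h1 : ¬ (a < c ∧ c < b ∧ b < d))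
    (h2 : ¬ (c < a ∧ a < d ∧ d < b)) :
    Disjoint (betw a b) (betw c d) ∨ betw a b ⊆ betw c d ∨ betw c d ⊆ betw a b := by
  rw [betw_lt hab, betw_lt hcd]
  by_cases k1 : b ≤ c
  · left; rw [Set.disjoint_left]; rintro x ⟨_, h⟩ ⟨h', _⟩; linarith
  by_cases k2 : d ≤ a
  · left; rw [Set.disjoint_left]; rintro x ⟨h, _⟩ ⟨_, h'⟩; linarith
  push Not at k1 k2
  right
  rcases lt_trichotomy a c with h | h | h
  · right
    have : d ≤ b := by
      by_contra k; push Not at k; exact h1 ⟨h, k1, k⟩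
    exact Set.Ioo_subset_Ioo h.le this
  · rcases le_total b d with k | k
    · left; exact Set.Ioo_subset_Ioo h.ge k
    · right; exact Set.Ioo_subset_Ioo h.le k
  · left
    have : b ≤ d := by
      by_contra k; push Not at k; exact h2 ⟨h, k2, k⟩
    exact Set.Ioo_subset_Ioo h.le this

lemma valid_affine {n : ℕ} {x X L : ZMod n → ℝ} {c κ : ℝ} (hκ : κ = 1 ∨ κ = -1)
    (hX : ∀ i, X i = c + κ * x i) : ValidLayering n X L ↔ ValidLayering n x L := by
  have hb : ∀ i j k, X i ∈ betw (X j) (X k) ↔ x i ∈ betw (x j) (x k) := by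
    intro i j k
    rw [betw_iff, betw_iff, hX, hX, hX]
    rcases hκ with rfl | rfl
    · ring_nf
    · ring_nf
  have he : ∀ i j, X i = X j ↔ x i = x j := by
    intro i j
    rw [hX, hX]
    rcases hκ with rfl | rfl <;> constructor <;> intro <;> linarith
  have hs : ∀ i j i' j', Real.sign (X i - X j) = Real.sign (X i' - X j') ↔
      Real.sign (x i - x j) = Real.sign (x i' - x j') := by
    intro i j i' j'
    have : ∀ i j, Real.sign (X i - X j) = κ * Real.sign (x i - x j) := by
      intro i j
      rw [hX, hX]
      rcases hκ with rfl | rfl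
      · have : c + 1 * x i - (c + 1 * x j) = x i - x j := by ring
        rw [this, one_mul]
      · have : c + -1 * x i - (c + -1 * x j) = -(x i - x j) := by ring
        rw [this, Real.sign_neg, neg_one_mul]
    rw [this, this]
    rcases hκ with rfl | rfl <;> constructor <;> intro <;> linarith
  unfold ValidLayering
  simp only [hb, he, hs]

structure Cyc (n : ℕ) (θ X σ : ZMod n → ℝ) : Prop where
  pos : ∀ i, 0 < θ i
  pm : ∀ i, σ i = 1 ∨ σ i = -1
  alt : ∀ i, σ (i + 1) = - σ i
  step : ∀ i, X (i + 1) = X i + σ i * θ i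

noncomputable def zl {n : ℕ} (X : ZMod n → ℝ) : ZMod n → ℝ := fun i => min (X i) (X (i + 1))
noncomputable def zr {n : ℕ} (X : ZMod n → ℝ) : ZMod n → ℝ := fun i => max (X i) (X (i + 1))
open Classical in
noncomputable def zρ {n : ℕ} (σ : ZMod n → ℝ) : ZMod n → ZMod n :=
  fun i => if σ i = 1 then i + 1 else i - 1
open Classical in
noncomputable def zm {n : ℕ} (σ : ZMod n → ℝ) : ZMod n → ZMod n :=
  fun i => if σ i = 1 then i - 1 else i + 1

section
variable {n : ℕ} {θ X σ : ZMod n → ℝ}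

lemma Cyc.alt' (C : Cyc n θ X σ) (i : ZMod n) : σ (i - 1) = - σ i := by
  have := C.alt (i - 1)
  rw [sub_add_cancel] at this; rw [this, neg_neg]

lemma Cyc.pos_case (C : Cyc n θ X σ) {i : ZMod n} (h : σ i = 1) :
    zl X i = X i ∧ zr X i = X (i + 1) ∧ zρ σ i = i + 1 ∧ zm σ i = i - 1 ∧ X i < X (i + 1) := by
  have h1 := C.step i
  rw [h, one_mul] at h1
  have h2 := C.pos i
  have h3 : X i < X (i + 1) := by linarith
  exact ⟨min_eq_left h3.le, max_eq_right h3.le, if_pos h, if_pos h, h3⟩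

lemma Cyc.neg_case (C : Cyc n θ X σ) {i : ZMod n} (h : σ i = -1) :
    zl X i = X (i + 1) ∧ zr X i = X i ∧ zρ σ i = i - 1 ∧ zm σ i = i + 1 ∧ X (i + 1) < X i := by
  have h1 := C.step i
  rw [h] at h1
  have h2 := C.pos i
  have h3 : X (i + 1) < X i := by linarith
  have h4 : ¬ (σ i = 1) := by rw [h]; norm_num
  exact ⟨min_eq_right h3.le, max_eq_left h3.le, if_neg h4, if_neg h4, h3⟩

lemma zsys [NeZero n] (hn : 2 ≤ n) (C : Cyc n θ X σ) :
    Sys Finset.univ (zl X) (zr X) (zρ σ) (zm σ) := by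
  have : Fact (1 < n) := ⟨hn⟩
  have one : (1 : ZMod n) ≠ 0 := one_ne_zero
  have key : ∀ g : ZMod n, zl X g < zr X g ∧ zρ σ (zρ σ g) = g ∧ zρ σ g ≠ g ∧
      zr X (zρ σ g) = zr X g ∧ zm σ (zm σ g) = g ∧ zm σ g ≠ g ∧ zl X (zm σ g) = zl X g := by
    intro g
    rcases C.pm g with h | h
    · obtain ⟨h1, h2, h3, h4, h5⟩ := C.pos_case h
      obtain ⟨a1, a2, a3, a4, a5⟩ := C.neg_case (i := g + 1) (by rw [C.alt, h])
      obtain ⟨b1, b2, b3, b4, b5⟩ := C.neg_case (i := g - 1) (by rw [C.alt', h])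
      rw [sub_add_cancel] at b1 b4
      refine ⟨by rw [h1, h2]; exact h5, by rw [h3, a3]; ring, ?_, by rw [h3, a2, h2],
        by rw [h4, b4], ?_, by rw [h4, b1, h1]⟩
      · rw [h3]; simp
      · rw [h4]; simp
    · obtain ⟨h1, h2, h3, h4, h5⟩ := C.neg_case h
      obtain ⟨a1, a2, a3, a4, a5⟩ := C.pos_case (i := g + 1) (by rw [C.alt, h]; norm_num)
      obtain ⟨b1, b2, b3, b4, b5⟩ := C.pos_case (i := g - 1) (by rw [C.alt', h]; norm_num)
      rw [sub_add_cancel] at b2 b3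
      refine ⟨by rw [h1, h2]; exact h5, by rw [h3, b3], ?_, by rw [h3, b2, h2],
        by rw [h4, a4]; ring, ?_, by rw [h4, a1, h1]⟩
      · rw [h3]; simp
      · rw [h4]; simp
  exact ⟨fun g _ => (key g).1, fun g _ => Finset.mem_univ _, fun g _ => (key g).2.1,
    fun g _ => (key g).2.2.1, fun g _ => (key g).2.2.2.1, fun g _ => Finset.mem_univ _,
    fun g _ => (key g).2.2.2.2.1, fun g _ => (key g).2.2.2.2.2.1, fun g _ => (key g).2.2.2.2.2.2⟩

/-- the crease at the right end of edge `g` -/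
lemma Cyc.cr (C : Cyc n θ X σ) (L : ZMod n → ℝ) (g : ZMod n) : ∃ i, X i = zr X g ∧ σ i = -1 ∧
    betw (L (i - 1)) (L i) = betw (L g) (L (zρ σ g)) ∧
      ((i = g + 1 ∧ σ g = 1) ∨ (i = g ∧ σ g = -1)) := by
  rcases C.pm g with h | h
  · obtain ⟨h1, h2, h3, h4, h5⟩ := C.pos_case h
    refine ⟨g + 1, h2.symm, by rw [C.alt, h], ?_, Or.inl ⟨rfl, h⟩⟩
    rw [add_sub_cancel_right, h3]
  · obtain ⟨h1, h2, h3, h4, h5⟩ := C.neg_case h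
    refine ⟨g, h2.symm, h, ?_, Or.inr ⟨rfl, h⟩⟩
    rw [h3, betw_comm]

lemma Cyc.cl (C : Cyc n θ X σ) (L : ZMod n → ℝ) (g : ZMod n) : ∃ i, X i = zl X g ∧ σ i = 1 ∧
    betw (L (i - 1)) (L i) = betw (L g) (L (zm σ g)) ∧
      ((i = g + 1 ∧ σ g = -1) ∨ (i = g ∧ σ g = 1)) := by
  rcases C.pm g with h | h
  · obtain ⟨h1, h2, h3, h4, h5⟩ := C.pos_case h
    refine ⟨g, h1.symm, h, ?_, Or.inr ⟨rfl, h⟩⟩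
    rw [h4, betw_comm]
  · obtain ⟨h1, h2, h3, h4, h5⟩ := C.neg_case h
    refine ⟨g + 1, h1.symm, by rw [C.alt, h]; norm_num, ?_, Or.inl ⟨rfl, h⟩⟩
    rw [add_sub_cancel_right, h4]

lemma Cyc.sgn (C : Cyc n θ X σ) (i : ZMod n) : Real.sign (X (i + 1) - X i) = σ i := by
  rcases C.pm i with h | h
  · rw [h]; exact sgn_pos' (C.pos_case h).2.2.2.2
  · rw [h]; exact sgn_neg' (C.neg_case h).2.2.2.2

lemma zval [NeZero n] (hn : 2 ≤ n) (C : Cyc n θ X σ) (L : ZMod n → ℝ) :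
    ValidLayering n X L ↔ Val Finset.univ (zl X) (zr X) (zρ σ) (zm σ) L := by
  have S := zsys hn C
  have U : ∀ g : ZMod n, g ∈ Finset.univ := Finset.mem_univ
  have hb : ∀ e, betw (X e) (X (e + 1)) = Set.Ioo (zl X e) (zr X e) := fun e => rfl
  constructor
  · rintro ⟨hinj, h1, h2⟩
    refine ⟨fun g _ h _ k => hinj k, ?_, ?_, ?_, ?_⟩
    · intro g _ h _ a1 a2 a3 a4
      obtain ⟨i, i1, i2, i3, -⟩ := C.cr L g
      apply h1 i h
      · rw [hb, i1]; exact ⟨a1, a2⟩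
      · rw [i3, betw_lt (by linarith)]; exact ⟨a3, a4⟩
    · intro g _ h _ a1 a2 a3 a4
      obtain ⟨i, i1, i2, i3, i4⟩ := C.cr L g
      obtain ⟨j, j1, j2, j3, j4⟩ := C.cr L h
      have hij : i ≠ j := by
        intro hij
        rcases i4 with ⟨k1, k2⟩ | ⟨k1, k2⟩ <;> rcases j4 with ⟨k3, k4⟩ | ⟨k3, k4⟩
        · have : g = h := by
            have : g + 1 = h + 1 := by rw [← k1, ← k3, hij]
            simpa using this
          rw [this] at a2; exact lt_irrefl _ a2
        · have : zρ σ g = h := by rw [(C.pos_case k2).2.2.1, ← k1, ← k3, hij]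
          rw [this] at a3; exact lt_irrefl _ a3
        · have : zρ σ g = h := by rw [(C.neg_case k2).2.2.1, ← k1, hij, k3]; ring
          rw [this] at a3; exact lt_irrefl _ a3
        · have : g = h := by rw [← k1, ← k3, hij]
          rw [this] at a2; exact lt_irrefl _ a2
      have := h2 i j hij (by rw [i1, j1, a1]) (by rw [C.sgn, C.sgn, i2, j2])
      rw [i3, j3] at this
      exact betw_cross a2 a3 a4 this
    · intro g _ h _ a1 a2 a3 a4
      obtain ⟨i, i1, i2, i3, -⟩ := C.cl L g
      apply h1 i h
      · rw [hb, i1]; exact ⟨a1, a2⟩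
      · rw [i3, betw_lt (by linarith)]; exact ⟨a3, a4⟩
    · intro g _ h _ a1 a2 a3 a4
      obtain ⟨i, i1, i2, i3, i4⟩ := C.cl L g
      obtain ⟨j, j1, j2, j3, j4⟩ := C.cl L h
      have hij : i ≠ j := by
        intro hij
        rcases i4 with ⟨k1, k2⟩ | ⟨k1, k2⟩ <;> rcases j4 with ⟨k3, k4⟩ | ⟨k3, k4⟩
        · have : g = h := by
            have : g + 1 = h + 1 := by rw [← k1, ← k3, hij]
            simpa using this
          rw [this] at a2; exact lt_irrefl _ a2
        · have : zm σ g = h := by rw [(C.neg_case k2).2.2.2.1, ← k1, ← k3, hij]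
          rw [this] at a3; exact lt_irrefl _ a3
        · have : zm σ g = h := by rw [(C.pos_case k2).2.2.2.1, ← k1, hij, k3]; ring
          rw [this] at a3; exact lt_irrefl _ a3
        · have : g = h := by rw [← k1, ← k3, hij]
          rw [this] at a2; exact lt_irrefl _ a2
      have := h2 i j hij (by rw [i1, j1, a1]) (by rw [C.sgn, C.sgn, i2, j2])
      rw [i3, j3] at this
      exact betw_cross a2 a3 a4 this
  · intro V
    -- each crease comes from an edge with increasing order
    have lowR : ∀ i, σ i = -1 → ∃ g, X i = zr X g ∧ L g ≤ L (zρ σ g) ∧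
        betw (L (i - 1)) (L i) = betw (L g) (L (zρ σ g)) := by
      intro i hi
      obtain ⟨h1, h2, h3, h4, h5⟩ := C.neg_case hi
      rcases le_total (L i) (L (zρ σ i)) with k | k
      · exact ⟨i, h2.symm, k, by rw [h3, betw_comm]⟩
      · refine ⟨zρ σ i, by rw [S.rr i (U i), h2], by rw [S.ri i (U i)]; exact k, ?_⟩
        rw [S.ri i (U i), h3]
    have lowL : ∀ i, σ i = 1 → ∃ g, X i = zl X g ∧ L g ≤ L (zm σ g) ∧
        betw (L (i - 1)) (L i) = betw (L g) (L (zm σ g)) := by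
      intro i hi
      obtain ⟨h1, h2, h3, h4, h5⟩ := C.pos_case hi
      rcases le_total (L i) (L (zm σ i)) with k | k
      · exact ⟨i, h1.symm, k, by rw [h4, betw_comm]⟩
      · refine ⟨zm σ i, by rw [S.ll i (U i), h1], by rw [S.li i (U i)]; exact k, ?_⟩
        rw [S.li i (U i), h4]
    refine ⟨fun g h k => V.inj g (U g) h (U h) k, ?_, ?_⟩
    · intro i e h1 h2
      rw [hb] at h1
      rcases C.pm i with hi | hi
      · obtain ⟨g, g1, g2, g3⟩ := lowL i hi
        rw [g3, betw_lt g2] at h2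
        rw [g1] at h1
        exact V.lv g (U g) e (U e) h1.1 h1.2 h2.1 h2.2
      · obtain ⟨g, g1, g2, g3⟩ := lowR i hi
        rw [g3, betw_lt g2] at h2
        rw [g1] at h1
        exact V.rv g (U g) e (U e) h1.1 h1.2 h2.1 h2.2
    · intro i j hij hx hs
      rw [C.sgn, C.sgn] at hs
      rcases C.pm i with hi | hi
      · obtain ⟨g, g1, g2, g3⟩ := lowL i hi
        obtain ⟨h, h1, h2, h3⟩ := lowL j (by rw [← hs, hi])
        rw [g3, h3]
        have e : zl X g = zl X h := by rw [← g1, ← h1, hx]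
        apply betw_nest g2 h2
        · rintro ⟨a, b, c⟩; exact V.ln g (U g) h (U h) e a b c
        · rintro ⟨a, b, c⟩; exact V.ln h (U h) g (U g) e.symm a b c
      · obtain ⟨g, g1, g2, g3⟩ := lowR i hi
        obtain ⟨h, h1, h2, h3⟩ := lowR j (by rw [← hs, hi])
        rw [g3, h3]
        have e : zr X g = zr X h := by rw [← g1, ← h1, hx]
        apply betw_nest g2 h2
        · rintro ⟨a, b, c⟩; exact V.rn g (U g) h (U h) e a b c
        · rintro ⟨a, b, c⟩; exact V.rn h (U h) g (U g) e.symm a b c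
end

lemma zconst {n : ℕ} [NeZero n] {α : Type*} {f : ZMod n → α} (h : ∀ i, f (i + 1) = f i)
    (i j : ZMod n) : f i = f j := by
  have key : ∀ (k : ℕ) (i : ZMod n), f (i + (k : ZMod n)) = f i := by
    intro k
    induction k with
    | zero => intro i; simp
    | succ k ih => intro i; rw [Nat.cast_succ, ← add_assoc, h, ih]
  have := key (j - i).val i
  rw [ZMod.natCast_zmod_val, add_sub_cancel] at this
  exact this.symm

open Classical in
noncomputable def sg2 (z : ZMod 2) : ℝ := if z = 0 then 1 else -1

lemma sg2_flip {a b : ZMod 2} (h : a + b = 1) : sg2 b = - sg2 a := by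
  have : ∀ a b : ZMod 2, a + b = 1 → (a = 0 ∧ b = 1) ∨ (a = 1 ∧ b = 0) := by decide
  rcases this a b h with ⟨rfl, rfl⟩ | ⟨rfl, rfl⟩ <;> simp [sg2]

lemma sg2_sq (a : ZMod 2) : sg2 a = 1 ∨ sg2 a = -1 := by
  unfold sg2; split_ifs <;> simp

lemma zreal {n : ℕ} [NeZero n] (hn : 2 ≤ n) {θ X σ L : ZMod n → ℝ} (C : Cyc n θ X σ)
    (V : Val Finset.univ (zl X) (zr X) (zρ σ) (zm σ) L) (p : ZMod n) (μ : ZMod n → MV) (ε : ℝ) :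
    Realizes n L μ ε ↔ ∃ s : ZMod n → ℝ, (∀ i, s i = 1 ∨ s i = -1) ∧ (∀ i, s (i + 1) = -s i) ∧
      s p * sg2 (cL Finset.univ (zl X) (zr X) L p) = ε ∧
      ∀ i, μ i = MV.valley ↔ s (i - 1) = Real.sign (L i - L (i - 1)) := by
  have S := zsys hn C
  have hc : ∀ i, sg2 (cL Finset.univ (zl X) (zr X) L (i + 1)) =
      - sg2 (cL Finset.univ (zl X) (zr X) L i) := by
    intro i
    rcases C.pm i with h | h
    · apply sg2_flip
      rw [top1 S V (Finset.mem_univ _), top1 S V (Finset.mem_univ _), ← (C.pos_case h).2.2.1]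
      exact top2 S V (Finset.mem_univ _)
    · apply sg2_flip
      rw [← (C.neg_case h).2.2.2.1]
      exact top3 S V (Finset.mem_univ _)
  have hs : ∀ s : ZMod n → ℝ, (∀ i, s (i + 1) = -s i) → ∀ i j,
      s i * sg2 (cL Finset.univ (zl X) (zr X) L i) =
      s j * sg2 (cL Finset.univ (zl X) (zr X) L j) := by
    intro s hs
    apply zconst (f := fun i => s i * sg2 (cL Finset.univ (zl X) (zr X) L i))
    intro i
    simp only [hs, hc]; ring
  have ht : ∀ t, (∀ j, L j ≤ L t) → sg2 (cL Finset.univ (zl X) (zr X) L t) = 1 := by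
    intro t ht
    have : cL Finset.univ (zl X) (zr X) L t = 0 := by
      unfold cL
      apply Finset.sum_eq_zero
      intro h _
      rw [if_neg]
      rintro ⟨_, _, k⟩
      exact absurd (ht h) (not_le.2 k)
    rw [this]; simp [sg2]
  constructor
  · rintro ⟨t, h1, s, h2, h3, h4, h5⟩
    refine ⟨s, h2, h3, ?_, h5⟩
    rw [hs s h3 p t, ht t h1, mul_one, h4]
  · rintro ⟨s, h2, h3, h4, h5⟩
    obtain ⟨t, -, h1⟩ := Finset.exists_max_image (Finset.univ : Finset (ZMod n)) L ⟨0, Finset.mem_univ _⟩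
    have h1' : ∀ j, L j ≤ L t := fun j => h1 j (Finset.mem_univ _)
    refine ⟨t, h1', s, h2, h3, ?_, h5⟩
    rw [← h4, hs s h3 p t, ht t h1', mul_one]

lemma val_succ_cases {n : ℕ} [NeZero n] (hn : 2 ≤ n) (i : ZMod n) :
    (i.val + 1 < n ∧ (i + 1).val = i.val + 1) ∨ (i.val + 1 = n ∧ i + 1 = 0) := by
  have h := ZMod.val_lt i
  rcases Nat.lt_or_ge (i.val + 1) n with h1 | h1
  · left
    refine ⟨h1, ?_⟩
    have : i + 1 = ((i.val + 1 : ℕ) : ZMod n) := by push_cast; rw [ZMod.natCast_zmod_val]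
    rw [this, ZMod.val_natCast_of_lt h1]
  · right
    have h2 : i.val + 1 = n := by omega
    refine ⟨h2, ?_⟩
    have : i + 1 = ((i.val + 1 : ℕ) : ZMod n) := by push_cast; rw [ZMod.natCast_zmod_val]
    rw [this, h2, ZMod.natCast_self]

lemma folded_cyc {n : ℕ} [NeZero n] {θ : ZMod n → ℝ} (h : IsClosedCycle n θ) :
    Cyc n θ (foldedX n θ) (fun i => (-1) ^ i.val) := by
  obtain ⟨h1, h2, h3, h4⟩ := h
  refine ⟨h3, fun i => neg_one_pow_eq_or ℝ _, ?_, ?_⟩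
  · intro i
    rcases val_succ_cases h2 i with ⟨_, k⟩ | ⟨k, k'⟩
    · simp only [k, pow_succ]; ring
    · simp only [k', ZMod.val_zero, pow_zero]
      have : Odd i.val := by
        rw [← k] at h1
        by_contra hc
        rw [Nat.not_odd_iff_even] at hc
        rw [Nat.even_add_one] at h1
        exact h1 hc
      rw [this.neg_one_pow]; norm_num
  · intro i
    unfold foldedX
    have e : θ i = θ ((i.val : ℕ) : ZMod n) := by rw [ZMod.natCast_zmod_val]
    rcases val_succ_cases h2 i with ⟨_, k⟩ | ⟨k, k'⟩
    · rw [k, Finset.sum_range_succ, e]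
    · rw [k', ZMod.val_zero, Finset.sum_range_zero, e]
      have : Finset.range n = Finset.range (i.val + 1) := by rw [k]
      rw [this, Finset.sum_range_succ] at h4
      exact h4.symm

lemma Cyc.closed {n : ℕ} [NeZero n] {θ X σ : ZMod n → ℝ} (C : Cyc n θ X σ) (h1 : Even n)
    (hn : 2 ≤ n) : IsClosedCycle n θ := by
  refine ⟨h1, hn, C.pos, ?_⟩
  have hσ : ∀ j : ℕ, σ (j : ZMod n) = σ 0 * (-1) ^ j := by
    intro j
    induction j with
    | zero => simp
    | succ j ih => rw [Nat.cast_succ, C.alt, ih, pow_succ]; ring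
  have hs : σ 0 * σ 0 = 1 := by rcases C.pm 0 with h | h <;> rw [h] <;> norm_num
  have key : ∀ N : ℕ, X (N : ZMod n) =
      X 0 + σ 0 * ∑ j ∈ Finset.range N, (-1 : ℝ) ^ j * θ (j : ZMod n) := by
    intro N
    induction N with
    | zero => simp
    | succ N ih => rw [Nat.cast_succ, C.step, ih, Finset.sum_range_succ, hσ]; ring
  have := key n
  rw [ZMod.natCast_self] at this
  have h0 : σ 0 * ∑ j ∈ Finset.range n, (-1 : ℝ) ^ j * θ (j : ZMod n) = 0 := by linarith
  rcases mul_eq_zero.1 h0 with h | h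
  · rw [h] at hs; norm_num at hs
  · exact h

lemma Cyc.unique {n : ℕ} [NeZero n] {θ X σ X' σ' : ZMod n → ℝ} (C : Cyc n θ X σ)
    (C' : Cyc n θ X' σ') : ∃ c κ : ℝ, (κ = 1 ∨ κ = -1) ∧ ∀ i, X i = c + κ * X' i := by
  have e1 : ∀ i, σ i * σ' i = σ 0 * σ' 0 := fun i =>
    zconst (f := fun i => σ i * σ' i) (fun i => by simp only [C.alt, C'.alt]; ring) i 0
  have e1' : ∀ i, σ i = σ 0 * σ' 0 * σ' i := by
    intro i
    rw [← e1 i]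
    rcases C'.pm i with h | h <;> rw [h] <;> ring
  have e2 : ∀ i, X i - σ 0 * σ' 0 * X' i = X 0 - σ 0 * σ' 0 * X' 0 := fun i =>
    zconst (f := fun i => X i - σ 0 * σ' 0 * X' i) (fun i => by
      simp only [C.step, C'.step]; rw [e1' i]; ring) i 0
  refine ⟨X 0 - σ 0 * σ' 0 * X' 0, σ 0 * σ' 0, ?_, fun i => by rw [← e2 i]; ring⟩
  rcases C.pm 0 with h | h <;> rcases C'.pm 0 with h' | h' <;> rw [h, h'] <;> norm_num

/-- flat foldability in terms of a coordinate system -/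
lemma flat_iff {n : ℕ} [NeZero n] (h1 : Even n) (hn : 2 ≤ n) {θ X σ : ZMod n → ℝ}
    (C : Cyc n θ X σ) (p : ZMod n) (μ : ZMod n → MV) (d : Des) :
    FlatFoldable n θ μ d ↔ ∃ L : ZMod n → ℝ,
      Val Finset.univ (zl X) (zr X) (zρ σ) (zm σ) L ∧
      ∃ s : ZMod n → ℝ, (∀ i, s i = 1 ∨ s i = -1) ∧ (∀ i, s (i + 1) = -s i) ∧
      s p * sg2 (cL Finset.univ (zl X) (zr X) L p) = epsOf d ∧
      ∀ i, μ i = MV.valley ↔ s (i - 1) = Real.sign (L i - L (i - 1)) := by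
  obtain ⟨c, κ, hκ, hX⟩ := C.unique (folded_cyc (C.closed h1 hn))
  unfold FlatFoldable
  apply exists_congr
  intro L
  rw [← valid_affine hκ hX, zval hn C]
  exact and_congr_right fun V => zreal hn C V p μ _

structure Setup (n : ℕ) (θ X σ : ZMod n → ℝ) (m : ZMod n) (k : ℕ) : Prop where
  C : Cyc n θ X σ
  ke : Even k
  k2 : 2 ≤ k
  kn : k + 2 ≤ n
  s0 : σ (m - 1) = 1
  r1 : θ m < θ (m - 1)
  r2 : ∀ j : ℕ, j < k → θ (m + (j : ZMod n)) = θ m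
  r3 : θ m < θ (m + (k : ZMod n))

open Classical in
noncomputable def zQ {n : ℕ} (m : ZMod n) (k : ℕ) : Finset (ZMod n) :=
  (Finset.range k).image (fun j : ℕ => m + (j : ZMod n))

def zφ {n : ℕ} (m : ZMod n) (k : ℕ) : ZMod (n - k) → ZMod n :=
  fun j => m + (k : ZMod n) + (j.val : ZMod n)

open Classical in
noncomputable def zρ0 {n : ℕ} (σ : ZMod n → ℝ) (m : ZMod n) (k : ℕ) : ZMod n → ZMod n :=
  fun g => if g = m - 1 then m + (k : ZMod n) else if g = m + (k : ZMod n) then m - 1 else zρ σ g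

lemma zrep {n : ℕ} [NeZero n] (m g : ZMod n) : ∃ t : ℕ, t < n ∧ g = m + (t : ZMod n) :=
  ⟨(g - m).val, ZMod.val_lt _, by rw [ZMod.natCast_zmod_val]; ring⟩

lemma zuniq {n : ℕ} (m : ZMod n) {i j : ℕ} (hi : i < n) (hj : j < n)
    (h : m + (i : ZMod n) = m + (j : ZMod n)) : i = j := by
  have h' := add_left_cancel h
  rw [ZMod.natCast_eq_natCast_iff'] at h'
  rwa [Nat.mod_eq_of_lt hi, Nat.mod_eq_of_lt hj] at h'

lemma zm1 {n : ℕ} [NeZero n] (m : ZMod n) : m - 1 = m + ((n - 1 : ℕ) : ZMod n) := by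
  have : 1 ≤ n := Nat.one_le_iff_ne_zero.2 (NeZero.ne n)
  rw [Nat.cast_sub this, ZMod.natCast_self]; simp [sub_eq_add_neg]

section
variable {n : ℕ} [NeZero n] {θ X σ : ZMod n → ℝ} {m : ZMod n} {k : ℕ}

lemma memQ (hk : k ≤ n) {t : ℕ} (ht : t < n) : m + (t : ZMod n) ∈ zQ m k ↔ t < k := by
  unfold zQ
  rw [Finset.mem_image]
  constructor
  · rintro ⟨j, hj, h⟩
    rw [Finset.mem_range] at hj
    rw [← zuniq m (by omega) ht h]; exact hj
  · intro h; exact ⟨t, Finset.mem_range.2 h, rfl⟩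

lemma zφ_eq [NeZero (n - k)] (j : ZMod (n - k)) :
    zφ m k j = m + ((k + j.val : ℕ) : ZMod n) ∧ k + j.val < n := by
  have := ZMod.val_lt j
  refine ⟨by unfold zφ; push_cast; ring, by omega⟩

lemma zφ_inj [NeZero (n - k)] : Function.Injective (zφ (n := n) m k) := by
  intro i j h
  rw [(zφ_eq i).1, (zφ_eq j).1] at h
  have := zuniq m (zφ_eq (m := m) i).2 (zφ_eq (m := m) j).2 h
  exact ZMod.val_injective _ (by omega)

lemma zφ_notin [NeZero (n - k)] (j : ZMod (n - k)) : zφ m k j ∉ zQ m k := by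
  have h := zφ_eq (m := m) j
  rw [h.1, memQ (by omega) h.2]; omega

lemma zφ_at [NeZero (n - k)] {t : ℕ} (h1 : k ≤ t) (h2 : t < n) :
    zφ m k ((t - k : ℕ) : ZMod (n - k)) = m + (t : ZMod n) := by
  rw [(zφ_eq _).1, ZMod.val_natCast_of_lt (by omega)]
  congr 2; omega

lemma zφ_surj [NeZero (n - k)] {g : ZMod n} (hk : k ≤ n) (h : g ∉ zQ m k) : ∃ j, zφ m k j = g := by
  obtain ⟨t, ht, rfl⟩ := zrep m g
  rw [memQ hk ht] at h
  exact ⟨_, zφ_at (by omega) ht⟩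

lemma zφ_zero : zφ (n := n) m k 0 = m + (k : ZMod n) := by
  unfold zφ; simp

lemma zφ_succ [NeZero (n - k)] (j : ZMod (n - k)) (h : j + 1 ≠ 0) :
    zφ m k (j + 1) = zφ m k j + 1 := by
  have : 1 ≤ n - k := Nat.one_le_iff_ne_zero.2 (NeZero.ne _)
  by_cases h1 : n - k = 1
  · exfalso; apply h
    have := ZMod.val_lt (j + 1)
    rw [← ZMod.val_eq_zero]; omega
  rcases val_succ_cases (by omega) j with ⟨_, e⟩ | ⟨_, e⟩
  · unfold zφ; rw [e]; push_cast; ring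
  · exact absurd e h

lemma zφ_last [NeZero (n - k)] (j : ZMod (n - k)) (h : j + 1 = 0) (hn : k + 2 ≤ n) :
    zφ m k j = m - 1 := by
  rcases val_succ_cases (by omega) j with ⟨_, e⟩ | ⟨e, _⟩
  · rw [h, ZMod.val_zero] at e; omega
  · rw [zm1, (zφ_eq j).1]; congr 2; omega

lemma zφ_pred [NeZero (n - k)] (j : ZMod (n - k)) (h : j ≠ 0) :
    zφ m k (j - 1) = zφ m k j - 1 := by
  have := zφ_succ (m := m) (j - 1) (by rwa [sub_add_cancel])
  rw [sub_add_cancel] at this; rw [this]; ring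

lemma zφ_neg [NeZero (n - k)] (hn : k + 2 ≤ n) : zφ (n := n) m k (-1) = m - 1 :=
  zφ_last _ (by simp) hn

lemma Setup.σm (H : Setup n θ X σ m k) : σ m = -1 := by
  have := H.C.alt (m - 1)
  rw [sub_add_cancel, H.s0] at this; exact this

lemma alt_pow {s : ZMod n → ℝ} (hs : ∀ i, s (i + 1) = - s i) (g : ZMod n) (j : ℕ) :
    s (g + (j : ZMod n)) = (-1) ^ j * s g := by
  induction j with
  | zero => simp
  | succ j ih => rw [Nat.cast_succ, ← add_assoc, hs, ih, pow_succ]; ring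

lemma Setup.σq (H : Setup n θ X σ m k) : σ (m + (k : ZMod n)) = -1 := by
  rw [alt_pow H.C.alt, H.ke.neg_one_pow, H.σm]; norm_num

lemma Setup.Xm (H : Setup n θ X σ m k) : X m = X (m - 1) + θ (m - 1) := by
  have := H.C.step (m - 1)
  rw [sub_add_cancel, H.s0] at this; linarith

lemma Setup.XQ (H : Setup n θ X σ m k) (j : ℕ) (hj : j ≤ k) :
    X (m + (j : ZMod n)) = if Even j then X m else X m - θ m := by
  induction j with
  | zero => simp
  | succ j ih =>
    rw [Nat.cast_succ, ← add_assoc, H.C.step, ih (by omega), H.r2 j (by omega),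
      alt_pow H.C.alt, H.σm]
    by_cases h : Even j
    · rw [if_pos h, h.neg_one_pow, if_neg (by rw [Nat.even_add_one]; simpa using h)]; ring
    · rw [if_neg h, (Nat.not_even_iff_odd.1 h).neg_one_pow, if_pos (by rw [Nat.even_add_one]; simpa using h)]; ring

lemma Setup.Xk (H : Setup n θ X σ m k) : X (m + (k : ZMod n)) = X m := by
  rw [H.XQ k le_rfl, if_pos H.ke]

lemma Setup.Xφ [NeZero (n - k)] (H : Setup n θ X σ m k) (j : ZMod (n - k)) :
    X (zφ m k (j + 1)) = X (zφ m k j + 1) := by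
  by_cases h : j + 1 = 0
  · rw [h, zφ_zero, zφ_last j h H.kn, sub_add_cancel, H.Xk]
  · rw [zφ_succ j h]

lemma Setup.altφ [NeZero (n - k)] (H : Setup n θ X σ m k) {s : ZMod n → ℝ}
    (hs : ∀ i, s (i + 1) = - s i) (j : ZMod (n - k)) :
    s (zφ m k (j + 1)) = - s (zφ m k j) := by
  by_cases h : j + 1 = 0
  · rw [h, zφ_zero, zφ_last j h H.kn, alt_pow hs, H.ke.neg_one_pow, one_mul, ← hs, sub_add_cancel]
  · rw [zφ_succ j h, hs]

lemma Setup.cyc [NeZero (n - k)] (H : Setup n θ X σ m k) :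
    Cyc (n - k) (evenShrink n θ m k) (fun j => X (zφ m k j)) (fun j => σ (zφ m k j)) :=
  ⟨fun j => H.C.pos _, fun j => H.C.pm _, fun j => H.altφ H.C.alt j,
    fun j => by simp only [H.Xφ, H.C.step]; rfl⟩

lemma Setup.pq (H : Setup n θ X σ m k) : m - 1 ≠ m + (k : ZMod n) := by
  intro h
  have h1 := H.σq
  rw [← h, H.s0] at h1; norm_num at h1

lemma Setup.pQ (H : Setup n θ X σ m k) : m - 1 ∉ zQ m k := by
  have := H.kn
  rw [zm1, memQ (by omega) (by omega)]; omega

lemma Setup.qQ (H : Setup n θ X σ m k) : m + (k : ZMod n) ∉ zQ m k := by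
  have := H.kn
  rw [memQ (by omega) (by omega)]; omega

lemma Setup.φρ [NeZero (n - k)] (H : Setup n θ X σ m k) (j : ZMod (n - k)) :
    zφ m k (zρ (fun j => σ (zφ m k j)) j) = zρ0 σ m k (zφ m k j) := by
  unfold zρ0
  by_cases h : zφ m k j = m - 1
  · rw [if_pos h]
    have : σ (zφ m k j) = 1 := by rw [h, H.s0]
    rw [(H.cyc.pos_case this).2.2.1]
    have : j = -1 := zφ_inj (by rw [h, zφ_neg H.kn])
    rw [this, neg_add_cancel, zφ_zero]
  rw [if_neg h]
  by_cases h' : zφ m k j = m + (k : ZMod n)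
  · rw [if_pos h']
    have : σ (zφ m k j) = -1 := by rw [h', H.σq]
    rw [(H.cyc.neg_case this).2.2.1]
    have : j = 0 := zφ_inj (by rw [h', zφ_zero])
    rw [this, zero_sub, zφ_neg H.kn]
  rw [if_neg h']
  rcases H.C.pm (zφ m k j) with e | e
  · rw [(H.cyc.pos_case e).2.2.1, (H.C.pos_case e).2.2.1, zφ_succ]
    intro k; exact h (zφ_last j k H.kn)
  · rw [(H.cyc.neg_case e).2.2.1, (H.C.neg_case e).2.2.1, zφ_pred]
    rintro rfl; exact h' zφ_zero

lemma Setup.φm [NeZero (n - k)] (H : Setup n θ X σ m k) (j : ZMod (n - k)) :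
    zφ m k (zm (fun j => σ (zφ m k j)) j) = zm σ (zφ m k j) := by
  rcases H.C.pm (zφ m k j) with e | e
  · rw [(H.cyc.pos_case e).2.2.2.1, (H.C.pos_case e).2.2.2.1, zφ_pred]
    rintro rfl
    rw [zφ_zero, H.σq] at e; norm_num at e
  · rw [(H.cyc.neg_case e).2.2.2.1, (H.C.neg_case e).2.2.2.1, zφ_succ]
    intro k
    rw [zφ_last j k H.kn, H.s0] at e; norm_num at e

lemma Setup.φl [NeZero (n - k)] (H : Setup n θ X σ m k) (j : ZMod (n - k)) :
    zl (fun j => X (zφ m k j)) j = zl X (zφ m k j) := by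
  unfold zl; simp only [H.Xφ]

lemma Setup.φr [NeZero (n - k)] (H : Setup n θ X σ m k) (j : ZMod (n - k)) :
    zr (fun j => X (zφ m k j)) j = zr X (zφ m k j) := by
  unfold zr; simp only [H.Xφ]
end

lemma val_transfer {E F : Type*} {A : Finset E} {B : Finset F} {l r : E → ℝ} {ρ lam : E → E}
    {l' r' : F → ℝ} {ρ' lam' : F → F} {φ : F → E} (hB : ∀ j, j ∈ B)
    (hφA : ∀ j, φ j ∈ A) (hs : ∀ g ∈ A, ∃ j, φ j = g) (hi : Function.Injective φ)
    (hl : ∀ j, l' j = l (φ j)) (hr : ∀ j, r' j = r (φ j)) (hρ : ∀ j, φ (ρ' j) = ρ (φ j))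
    (hm : ∀ j, φ (lam' j) = lam (φ j)) (L : E → ℝ) :
    Val B l' r' ρ' lam' (fun j => L (φ j)) ↔ Val A l r ρ lam L := by
  constructor
  · intro V
    refine ⟨?_, ?_, ?_, ?_, ?_⟩
    · intro g hg h hh e
      obtain ⟨i, rfl⟩ := hs g hg
      obtain ⟨j, rfl⟩ := hs h hh
      rw [V.inj i (hB i) j (hB j) e]
    · intro g hg h hh
      obtain ⟨i, rfl⟩ := hs g hg
      obtain ⟨j, rfl⟩ := hs h hh
      have := V.rv i (hB i) j (hB j)
      simpa only [hl, hr, hρ, hm] using this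
    · intro g hg h hh
      obtain ⟨i, rfl⟩ := hs g hg
      obtain ⟨j, rfl⟩ := hs h hh
      have := V.rn i (hB i) j (hB j)
      simpa only [hl, hr, hρ, hm] using this
    · intro g hg h hh
      obtain ⟨i, rfl⟩ := hs g hg
      obtain ⟨j, rfl⟩ := hs h hh
      have := V.lv i (hB i) j (hB j)
      simpa only [hl, hr, hρ, hm] using this
    · intro g hg h hh
      obtain ⟨i, rfl⟩ := hs g hg
      obtain ⟨j, rfl⟩ := hs h hh
      have := V.ln i (hB i) j (hB j)
      simpa only [hl, hr, hρ, hm] using this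
  · intro V
    refine ⟨?_, ?_, ?_, ?_, ?_⟩
    · intro i _ j _ e
      exact hi (V.inj _ (hφA i) _ (hφA j) e)
    · intro i _ j _
      have := V.rv _ (hφA i) _ (hφA j)
      simpa only [hl, hr, hρ, hm] using this
    · intro i _ j _
      have := V.rn _ (hφA i) _ (hφA j)
      simpa only [hl, hr, hρ, hm] using this
    · intro i _ j _
      have := V.lv _ (hφA i) _ (hφA j)
      simpa only [hl, hr, hρ, hm] using this
    · intro i _ j _
      have := V.ln _ (hφA i) _ (hφA j)
      simpa only [hl, hr, hρ, hm] using this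

section
variable {n : ℕ} [NeZero n] {θ X σ : ZMod n → ℝ} {m : ZMod n} {k : ℕ}

lemma ze_succ (m : ZMod n) (i : ℕ) : m - 1 + ((i + 1 : ℕ) : ZMod n) = m + (i : ZMod n) := by
  push_cast; ring

lemma memQ' (H : Setup n θ X σ m k) {g : ZMod n} :
    g ∈ zQ m k ↔ ∃ i : ℕ, 1 ≤ i ∧ i ≤ k ∧ g = m - 1 + (i : ZMod n) := by
  have := H.kn
  constructor
  · intro h
    obtain ⟨t, ht, rfl⟩ := zrep m g
    rw [memQ (by omega) ht] at h
    exact ⟨t + 1, by omega, by omega, by rw [ze_succ]⟩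
  · rintro ⟨i, h1, h2, rfl⟩
    obtain ⟨i, rfl⟩ : ∃ j, i = j + 1 := ⟨i - 1, by omega⟩
    rw [ze_succ, memQ (by omega) (by omega)]; omega

lemma memS (H : Setup n θ X σ m k) {g : ZMod n} :
    InS (zQ m k) (m - 1) (m + (k : ZMod n)) g ↔ ∃ i : ℕ, i ≤ k + 1 ∧ g = m - 1 + (i : ZMod n) := by
  unfold InS
  rw [memQ' H]
  constructor
  · rintro (rfl | rfl | ⟨i, h1, h2, rfl⟩)
    · exact ⟨0, by omega, by simp⟩
    · exact ⟨k + 1, by omega, by rw [ze_succ]⟩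
    · exact ⟨i, by omega, rfl⟩
  · rintro ⟨i, h1, rfl⟩
    by_cases h0 : i = 0
    · left; simp [h0]
    by_cases h2 : i = k + 1
    · right; left; rw [h2, ze_succ]
    · right; right; exact ⟨i, by omega, by omega, rfl⟩

lemma Setup.σe (H : Setup n θ X σ m k) (i : ℕ) : σ (m - 1 + (i : ZMod n)) = (-1) ^ i := by
  rw [alt_pow H.C.alt, H.s0, mul_one]

lemma Setup.even_e (H : Setup n θ X σ m k) {i : ℕ} (h : Even i) :
    zρ σ (m - 1 + (i : ZMod n)) = m - 1 + ((i + 1 : ℕ) : ZMod n) ∧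
    zm σ (m - 1 + (i : ZMod n)) = m - 1 + (i : ZMod n) - 1 := by
  have : σ (m - 1 + (i : ZMod n)) = 1 := by rw [H.σe, h.neg_one_pow]
  obtain ⟨_, _, a, b, _⟩ := H.C.pos_case this
  rw [a, b]; push_cast; exact ⟨by ring, by ring⟩

lemma Setup.odd_e (H : Setup n θ X σ m k) {i : ℕ} (h : Odd i) :
    zm σ (m - 1 + (i : ZMod n)) = m - 1 + ((i + 1 : ℕ) : ZMod n) ∧
    zρ σ (m - 1 + (i : ZMod n)) = m - 1 + ((i - 1 : ℕ) : ZMod n) := by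
  have : σ (m - 1 + (i : ZMod n)) = -1 := by rw [H.σe, h.neg_one_pow]
  obtain ⟨_, _, a, b, _⟩ := H.C.neg_case this
  have : 1 ≤ i := by obtain ⟨c, rfl⟩ := h; omega
  rw [a, b, Nat.cast_sub this]; push_cast; exact ⟨by ring, by ring⟩

lemma Setup.run (H : Setup n θ X σ m k) :
    Run Finset.univ (zl X) (zr X) (zρ σ) (zm σ) (zQ m k) (m - 1) (m + (k : ZMod n))
      (X m - θ m) (X m) := by
  obtain ⟨p1, p2, -, -, -⟩ := H.C.pos_case H.s0
  obtain ⟨q1, q2, -, -, -⟩ := H.C.neg_case H.σq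
  have hk2 := H.k2
  have hkn := H.kn
  obtain ⟨c, hc⟩ := H.ke
  have pos := H.C.pos m
  have hX := H.Xm
  have hXk := H.Xk
  have hq := H.C.step (m + (k : ZMod n))
  rw [H.σq, hXk] at hq
  have r1 := H.r1
  have r3 := H.r3
  have hQ : ∀ g ∈ zQ m k, zl X g = X m - θ m ∧ zr X g = X m := by
    intro g hg
    obtain ⟨t, ht, rfl⟩ := zrep m g
    rw [memQ (by omega) ht] at hg
    have e1 := H.XQ t (by omega)
    have e2 := H.XQ (t + 1) (by omega)
    rw [Nat.cast_succ, ← add_assoc] at e2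
    unfold zl zr
    by_cases h : Even t
    · rw [if_pos h] at e1
      rw [if_neg (by rw [Nat.even_add_one]; simpa using h)] at e2
      rw [e1, e2]
      exact ⟨min_eq_right (by linarith), max_eq_left (by linarith)⟩
    · rw [if_neg h] at e1
      rw [if_pos (by rw [Nat.even_add_one]; simpa using h)] at e2
      rw [e1, e2]
      exact ⟨min_eq_left (by linarith), max_eq_right (by linarith)⟩
  refine ⟨fun _ _ => Finset.mem_univ _, Finset.mem_univ _, Finset.mem_univ _, H.pq, H.pQ, H.qQ,
    fun g hg => (hQ g hg).1, fun g hg => (hQ g hg).2, ?_, ?_, ?_, ?_, ?_, ?_, ?_⟩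
  · rw [p2, sub_add_cancel]
  · rw [q2, hXk]
  · rw [p1]; linarith
  · rw [q1, hq]; linarith
  · intro g hg
    rw [memQ' H] at hg ⊢
    obtain ⟨i, h1, h2, rfl⟩ := hg
    rcases Nat.even_or_odd i with h | h
    · obtain ⟨u, hu⟩ := h
      refine ⟨i - 1, by omega, by omega, ?_⟩
      rw [(H.even_e ⟨u, hu⟩).2, Nat.cast_sub h1]; push_cast; ring
    · obtain ⟨u, hu⟩ := h
      exact ⟨i + 1, by omega, by omega, (H.odd_e ⟨u, hu⟩).1⟩
  · intro g hg
    rw [memS H] at hg ⊢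
    obtain ⟨i, h2, rfl⟩ := hg
    rcases Nat.even_or_odd i with h | h
    · obtain ⟨u, hu⟩ := h
      exact ⟨i + 1, by omega, (H.even_e ⟨u, hu⟩).1⟩
    · obtain ⟨u, hu⟩ := h
      exact ⟨i - 1, by omega, (H.odd_e ⟨u, hu⟩).2⟩
  · intro D hD hρ hm
    have S := zsys (by omega) H.C
    have up : ∀ i : ℕ, i ≤ k →
        (D (m - 1 + (i : ZMod n)) ↔ D (m - 1 + ((i + 1 : ℕ) : ZMod n))) := by
      intro i hi
      rcases Nat.even_or_odd i with h | h
      · have e := (H.even_e h).1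
        have e' := S.ri (m - 1 + (i : ZMod n)) (Finset.mem_univ _)
        rw [e] at e'
        constructor
        · intro hd; rw [← e]; exact hρ _ ((memS H).2 ⟨i, by omega, rfl⟩) hd
        · intro hd; rw [← e']; exact hρ _ ((memS H).2 ⟨i + 1, by omega, rfl⟩) hd
      · have e := (H.odd_e h).1
        have e' := S.li (m - 1 + (i : ZMod n)) (Finset.mem_univ _)
        rw [e] at e'
        obtain ⟨u, hu⟩ := h
        constructor
        · intro hd; rw [← e]; exact hm _ ((memQ' H).2 ⟨i, by omega, by omega, rfl⟩) hd
        · intro hd; rw [← e']; exact hm _ ((memQ' H).2 ⟨i + 1, by omega, by omega, rfl⟩) hd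
    have all : ∀ i : ℕ, i ≤ k + 1 → (D (m - 1 + ((0 : ℕ) : ZMod n)) ↔ D (m - 1 + (i : ZMod n))) := by
      intro i
      induction i with
      | zero => intro _; rfl
      | succ i ih => intro hi; rw [ih (by omega), up i (by omega)]
    obtain ⟨g, g1, g2⟩ := hD
    rw [memS H] at g1
    obtain ⟨i, hi, rfl⟩ := g1
    intro g hg
    rw [memS H] at hg
    obtain ⟨j, hj, rfl⟩ := hg
    rw [← all j hj, all i hi]; exact g2

lemma Setup.val_iff [NeZero (n - k)] (H : Setup n θ X σ m k) (L : ZMod n → ℝ) :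
    Val Finset.univ (zl (fun j => X (zφ m k j))) (zr (fun j => X (zφ m k j)))
      (zρ (fun j => σ (zφ m k j))) (zm (fun j => σ (zφ m k j))) (fun j => L (zφ m k j)) ↔
    Val (Finset.univ \ zQ m k) (zl X) (zr X) (zρ0 σ m k) (zm σ) L := by
  have := H.kn
  refine val_transfer (φ := zφ m k) (fun j => Finset.mem_univ j) ?_ ?_ zφ_inj H.φl H.φr H.φρ H.φm L
  · intro j; exact Finset.mem_sdiff.2 ⟨Finset.mem_univ _, zφ_notin j⟩
  · intro g hg; exact zφ_surj (by omega) (Finset.mem_sdiff.1 hg).2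

lemma Setup.cL_eq [NeZero (n - k)] (H : Setup n θ X σ m k) (L : ZMod n → ℝ) (L' : ZMod (n - k) → ℝ)
    (hL : ∀ j, zl X (zφ m k j) < X m - θ m → (L' (-1) < L' j ↔ L (m - 1) < L (zφ m k j))) :
    cL Finset.univ (zl (fun j => X (zφ m k j))) (zr (fun j => X (zφ m k j))) L' (-1) =
    cL Finset.univ (zl X) (zr X) L (m - 1) := by
  classical
  have hkn := H.kn
  have R := H.run
  unfold cL
  rw [← Finset.sum_sdiff (Finset.subset_univ (zQ m k)) (f := fun h =>
    (if zl X h ≤ zl X (m - 1) ∧ zl X (m - 1) < zr X h ∧ L (m - 1) < L h then (1 : ZMod 2) else 0)),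
    Finset.sum_eq_zero (s := zQ m k), add_zero]
  · apply Finset.sum_bij (fun j _ => zφ m k j)
    · intro j _; exact Finset.mem_sdiff.2 ⟨Finset.mem_univ _, zφ_notin j⟩
    · intro i _ j _ e; exact zφ_inj e
    · intro g hg
      obtain ⟨j, hj⟩ := zφ_surj (by omega) (Finset.mem_sdiff.1 hg).2
      exact ⟨j, Finset.mem_univ _, hj⟩
    · intro j _
      rw [H.φl, H.φl, H.φr, zφ_neg H.kn]
      by_cases h : zl X (zφ m k j) ≤ zl X (m - 1)
      · simp only [hL j (lt_of_le_of_lt h R.pl)]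
      · rw [if_neg (fun k => h k.1), if_neg (fun k => h k.1)]
  · intro h hh
    rw [if_neg]
    rintro ⟨k, -, -⟩
    rw [R.Ql h hh] at k
    exact absurd R.pl (not_lt.2 k)

open Classical in
lemma Setup.sums (H : Setup n θ X σ m k) (T : ZMod n → ℝ) :
    ∑ g ∈ insert (m - 1) (insert (m + (k : ZMod n)) (zQ m k)), (if σ g = 1 then T (g + 1) else T g) +
      ∑ g ∈ zQ m k, (if σ g = 1 then T g else T (g + 1)) =
    2 * ∑ j ∈ Finset.range (k + 1), T (m + (j : ZMod n)) := by
  have hkn := H.kn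
  rw [Finset.sum_insert (by simp only [Finset.mem_insert, not_or]; exact ⟨H.pq, H.pQ⟩),
    Finset.sum_insert H.qQ, if_pos H.s0, if_neg (by rw [H.σq]; norm_num), sub_add_cancel]
  have e : ∑ g ∈ zQ m k, (if σ g = 1 then T (g + 1) else T g) +
      ∑ g ∈ zQ m k, (if σ g = 1 then T g else T (g + 1)) =
      ∑ j ∈ Finset.range k, (T (m + (j : ZMod n)) + T (m + ((j + 1 : ℕ) : ZMod n))) := by
    rw [← Finset.sum_add_distrib]
    unfold zQ
    rw [Finset.sum_image]
    · apply Finset.sum_congr rfl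
      intro j _
      push_cast
      rw [← add_assoc]
      split_ifs <;> ring
    · intro i hi j hj h
      simp only [Finset.coe_range, Set.mem_Iio] at hi hj
      exact zuniq m (by omega) (by omega) h
  rw [Finset.sum_add_distrib] at e
  have s1 := Finset.sum_range_succ (fun j : ℕ => T (m + (j : ZMod n))) k
  have s2 := Finset.sum_range_succ' (fun j : ℕ => T (m + (j : ZMod n))) k
  simp only [Nat.cast_zero, add_zero] at s2
  linarith
end

open Classical in
noncomputable def tv (x : MV) : ℝ := if x = MV.valley then 1 else -1

lemma tv_pm (x : MV) : tv x = 1 ∨ tv x = -1 := by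
  unfold tv; split_ifs <;> simp

lemma sign_pm {x y : ℝ} (h : x ≠ y) : Real.sign (y - x) = 1 ∨ Real.sign (y - x) = -1 := by
  rcases lt_or_gt_of_ne h with h | h
  · left; exact sgn_pos' h
  · right; exact sgn_neg' h

lemma tv_iff {x : MV} {s u : ℝ} (hs : s = 1 ∨ s = -1) (hu : u = 1 ∨ u = -1) :
    (x = MV.valley ↔ s = u) ↔ s * u = tv x := by
  unfold tv
  rcases hs with rfl | rfl <;> rcases hu with rfl | rfl <;> by_cases h : x = MV.valley <;>
    simp [h] <;> norm_num

lemma count_sum {n : ℕ} (μ : ZMod n → MV) (m : ZMod n) (k : ℕ) :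
    ∑ j ∈ Finset.range (k + 1), tv (μ (m + (j : ZMod n))) =
      (runCount n μ m k MV.valley : ℝ) - (runCount n μ m k MV.mountain : ℝ) := by
  unfold runCount
  rw [Finset.card_filter, Finset.card_filter]
  push_cast
  rw [← Finset.sum_sub_distrib]
  apply Finset.sum_congr rfl
  intro j _
  unfold tv
  cases μ (m + (j : ZMod n)) <;> simp

lemma count_of {n : ℕ} {μ : ZMod n → MV} {m : ZMod n} {k : ℕ} {T : ℝ} (hT : T = 1 ∨ T = -1)
    (h : ∑ j ∈ Finset.range (k + 1), tv (μ (m + (j : ZMod n))) = T) :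
    (runCount n μ m k MV.mountain = runCount n μ m k MV.valley + 1 ∨
          runCount n μ m k MV.valley = runCount n μ m k MV.mountain + 1) ∧
    tv (runMajority n μ m k) = T := by
  rw [count_sum] at h
  unfold runMajority
  rcases hT with rfl | rfl
  · have : (runCount n μ m k MV.valley : ℝ) = ((runCount n μ m k MV.mountain + 1 : ℕ) : ℝ) := by
      push_cast; linarith
    have := Nat.cast_injective this
    refine ⟨Or.inr this, ?_⟩
    rw [if_neg (by omega)]; simp [tv]
  · have : (runCount n μ m k MV.mountain : ℝ) = ((runCount n μ m k MV.valley + 1 : ℕ) : ℝ) := by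
      push_cast; linarith
    have := Nat.cast_injective this
    refine ⟨Or.inl this, ?_⟩
    rw [if_pos (by omega)]; simp [tv]

lemma count_back {n : ℕ} {μ : ZMod n → MV} {m : ZMod n} {k : ℕ}
    (h : runCount n μ m k MV.mountain = runCount n μ m k MV.valley + 1 ∨
          runCount n μ m k MV.valley = runCount n μ m k MV.mountain + 1) :
    ∑ j ∈ Finset.range (k + 1), tv (μ (m + (j : ZMod n))) = tv (runMajority n μ m k) := by
  rw [count_sum]
  unfold runMajority
  rcases h with h | h
  · rw [if_pos (by omega), h]; simp [tv]
  · rw [if_neg (by omega), h]; simp [tv]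

section
variable {n : ℕ} [NeZero n] {θ X σ : ZMod n → ℝ} {m : ZMod n} {k : ℕ}

lemma alt_pred {s : ZMod n → ℝ} (hs : ∀ i, s (i + 1) = - s i) (i : ZMod n) : s (i - 1) = - s i := by
  have := hs (i - 1)
  rw [sub_add_cancel] at this; rw [this, neg_neg]

/-- the weight at the right end of an edge, as a crease weight -/
lemma Cyc.wr (C : Cyc n θ X σ) {s : ZMod n → ℝ} (hs : ∀ i, s (i + 1) = - s i) (L T : ZMod n → ℝ)
    (hT : ∀ i, s (i - 1) * Real.sign (L i - L (i - 1)) = T i) (g : ZMod n) :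
    (s g * Real.sign (L (zρ σ g) - L g) = (if σ g = 1 then T (g + 1) else T g)) ∧
    (s g * Real.sign (L (zm σ g) - L g) = (if σ g = 1 then T g else T (g + 1))) := by
  have h1 : s g * Real.sign (L (g + 1) - L g) = T (g + 1) := by
    have := hT (g + 1)
    rwa [add_sub_cancel_right] at this
  have h2 : s g * Real.sign (L (g - 1) - L g) = T g := by
    rw [← hT g, alt_pred hs, sgn_swap]; ring
  rcases C.pm g with h | h
  · obtain ⟨_, _, e1, e2, _⟩ := C.pos_case h
    rw [if_pos h, if_pos h, e1, e2]; exact ⟨h1, h2⟩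
  · obtain ⟨_, _, e1, e2, _⟩ := C.neg_case h
    have h' : ¬ σ g = 1 := by rw [h]; norm_num
    rw [if_neg h', if_neg h', e1, e2]; exact ⟨h2, h1⟩

lemma Cyc.alts (C : Cyc n θ X σ) {s : ZMod n → ℝ} (hs : ∀ i, s (i + 1) = - s i) (g : ZMod n) :
    s (zρ σ g) = - s g ∧ s (zm σ g) = - s g := by
  rcases C.pm g with h | h
  · obtain ⟨_, _, e1, e2, _⟩ := C.pos_case h
    rw [e1, e2]; exact ⟨hs g, alt_pred hs g⟩
  · obtain ⟨_, _, e1, e2, _⟩ := C.neg_case h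
    rw [e1, e2]; exact ⟨alt_pred hs g, hs g⟩

lemma Setup.ρ0_p : zρ0 σ m k (m - 1) = m + (k : ZMod n) := if_pos rfl

lemma Setup.ρ0_q (H : Setup n θ X σ m k) : zρ0 σ m k (m + (k : ZMod n)) = m - 1 := by
  unfold zρ0; rw [if_neg H.pq.symm, if_pos rfl]

lemma Setup.ρ0_o (g : ZMod n) (h : ¬ InS (zQ m k) (m - 1) (m + (k : ZMod n)) g) :
    zρ0 σ m k g = zρ σ g := by
  unfold zρ0
  rw [if_neg (fun e => h (Or.inl e)), if_neg (fun e => h (Or.inr (Or.inl e)))]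

lemma Setup.forward [NeZero (n - k)] (H : Setup n θ X σ m k) (hn : Even n) (hnk : Even (n - k))
    (μ : ZMod n → MV) (d : Des) (hf : FlatFoldable n θ μ d) :
    (runCount n μ m k MV.mountain = runCount n μ m k MV.valley + 1 ∨
          runCount n μ m k MV.valley = runCount n μ m k MV.mountain + 1) ∧
        FlatFoldable (n - k) (evenShrink n θ m k) (evenRestrict n μ m k) d := by
  classical
  have hkn := H.kn
  rw [flat_iff hn (by omega) H.C (m - 1)] at hf
  obtain ⟨L, V, s, s1, s2, s3, s4⟩ := hf
  have S := zsys (by omega) H.C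
  have one : ∀ i : ZMod n, i - 1 ≠ i := by
    intro i
    have : Fact (1 < n) := ⟨by omega⟩
    simp
  have Lne : ∀ i j : ZMod n, i ≠ j → L i ≠ L j := fun i j h e =>
    h (V.inj i (Finset.mem_univ _) j (Finset.mem_univ _) e)
  have hT : ∀ i, s (i - 1) * Real.sign (L i - L (i - 1)) = tv (μ i) := fun i =>
    (tv_iff (s1 _) (sign_pm (Lne _ _ (one i)))).1 (s4 i)
  obtain ⟨L1, V1, c2, c3, c4, c5⟩ := forward_ind s (zρ0 σ m k) Setup.ρ0_p H.ρ0_q (zQ m k).card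
    Finset.univ (zρ σ) (zQ m k) L rfl S V H.run (fun g _ => (H.C.alts s2 g).1)
    (fun g _ => (H.C.alts s2 g).2) (fun g _ h => Setup.ρ0_o g h)
  have hw := fun g => H.C.wr s2 L _ hT g
  have e := H.sums (fun i => tv (μ i))
  rw [Finset.sum_congr rfl (fun g _ => (hw g).1), Finset.sum_congr rfl (fun g _ => (hw g).2)] at c5
  rw [e] at c5
  have c6 := mul_left_cancel₀ (two_ne_zero) c5
  have hpm : s (m - 1) * Real.sign (L (m + (k : ZMod n)) - L (m - 1)) = 1 ∨
      s (m - 1) * Real.sign (L (m + (k : ZMod n)) - L (m - 1)) = -1 := by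
    rcases s1 (m - 1) with h | h <;> rcases sign_pm (Lne _ _ H.pq) with h' | h' <;>
      rw [h, h'] <;> norm_num
  obtain ⟨k1, k2⟩ := count_of hpm c6
  refine ⟨k1, ?_⟩
  rw [flat_iff hnk (by omega) H.cyc (-1)]
  have R := H.run
  have mem : ∀ j, zφ m k j ∈ Finset.univ \ zQ m k := fun j =>
    Finset.mem_sdiff.2 ⟨Finset.mem_univ _, zφ_notin j⟩
  have mp : m - 1 ∈ Finset.univ \ zQ m k := Finset.mem_sdiff.2 ⟨Finset.mem_univ _, H.pQ⟩
  have mq : m + (k : ZMod n) ∈ Finset.univ \ zQ m k := Finset.mem_sdiff.2 ⟨Finset.mem_univ _, H.qQ⟩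
  have L1ne : ∀ i ∈ Finset.univ \ zQ m k, ∀ j ∈ Finset.univ \ zQ m k, i ≠ j → L1 i ≠ L1 j :=
    fun i hi j hj h e => h (V1.inj i hi j hj e)
  have V' := (H.val_iff L1).2 V1
  refine ⟨fun j => L1 (zφ m k j), V', fun j => s (zφ m k j), fun j => s1 _,
    fun j => H.altφ s2 j, ?_, ?_⟩
  · rw [H.cL_eq L (fun j => L1 (zφ m k j))]
    · simp only [zφ_neg H.kn]; exact s3
    · intro j hj
      simp only [zφ_neg H.kn]
      exact c2 _ mp _ (mem j) R.pl hj
  · intro j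
    have hj : zφ m k (j - 1) ≠ zφ m k j := by
      intro h
      have h := zφ_inj h
      have : Fact (1 < n - k) := ⟨by omega⟩
      simp at h
    rw [tv_iff (s1 _) (sign_pm (L1ne _ (mem _) _ (mem _) hj))]
    by_cases h0 : j = 0
    · have : evenRestrict n μ m k j = runMajority n μ m k := by
        unfold evenRestrict; rw [if_pos h0]
      rw [this, k2, h0, zero_sub, zφ_neg H.kn, zφ_zero,
        sgn_congr (c2 _ mp _ mq R.pl R.ql) (L1ne _ mp _ mq H.pq) (Lne _ _ H.pq)]
    · have : evenRestrict n μ m k j = μ (zφ m k j) := by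
        unfold evenRestrict; rw [if_neg h0]; rfl
      rw [this, ← hT, zφ_pred j h0]
      congr 1
      have hmem : zφ m k j - 1 ∈ Finset.univ \ zQ m k := by rw [← zφ_pred j h0]; exact mem _
      have key : L1 (zφ m k j - 1) < L1 (zφ m k j) ↔ L (zφ m k j - 1) < L (zφ m k j) := by
        rcases H.C.pm (zφ m k j - 1) with h | h
        · have e := (H.C.pos_case h).2.2.1
          rw [sub_add_cancel] at e
          have := c3 (zφ m k j - 1) (Finset.mem_univ _) (by
            rintro (a | a | a)
            · have a' : zφ m k j = m := by
                have := congrArg (· + 1) a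
                simpa using this
              have h2 := H.σm
              rw [← zφ_pred j h0, ← zφ_neg H.kn] at a
              have := zφ_inj a
              exact h0 (by linear_combination this)
            · rw [a, H.σq] at h; norm_num at h
            · exact (Finset.mem_sdiff.1 hmem).2 a)
          rwa [e] at this
        · have e := (H.C.neg_case h).2.2.2.1
          rw [sub_add_cancel] at e
          have := c4 (zφ m k j - 1) hmem
          rwa [e] at this
      exact sgn_congr key (L1ne _ hmem _ (mem j) (one _)) (Lne _ _ (one _))

lemma Setup.backward [NeZero (n - k)] (H : Setup n θ X σ m k) (hn : Even n) (hnk : Even (n - k))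
    (μ : ZMod n → MV) (d : Des)
    (hc : runCount n μ m k MV.mountain = runCount n μ m k MV.valley + 1 ∨
          runCount n μ m k MV.valley = runCount n μ m k MV.mountain + 1)
    (hf : FlatFoldable (n - k) (evenShrink n θ m k) (evenRestrict n μ m k) d) :
    FlatFoldable n θ μ d := by
  classical
  have hkn := H.kn
  rw [flat_iff hnk (by omega) H.cyc (-1)] at hf
  obtain ⟨L', V', s', s1, s2, s3, s4⟩ := hf
  obtain ⟨L0, hL0⟩ : ∃ L0 : ZMod n → ℝ, ∀ j, L0 (zφ m k j) = L' j :=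
    ⟨fun g => L' (Function.invFun (zφ m k) g), fun j => by
      simp only [Function.leftInverse_invFun zφ_inj j]⟩
  have hL' : L' = fun j => L0 (zφ m k j) := funext fun j => (hL0 j).symm
  subst hL'
  have V0 := (H.val_iff L0).1 V'
  have S := zsys (by omega) H.C
  obtain ⟨s, hs, t2, t1⟩ : ∃ s : ZMod n → ℝ, (∀ j, s (zφ m k j) = s' j) ∧
      (∀ i, s (i + 1) = - s i) ∧ (∀ i, s i = 1 ∨ s i = -1) := by
    refine ⟨fun i => s' (-1) * σ i, ?_, ?_, ?_⟩
    · intro j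
      have e := zconst (f := fun j => s' j * σ (zφ m k j))
        (fun j => by simp only [s2, H.altφ H.C.alt]; ring) (-1) j
      simp only [zφ_neg H.kn, H.s0, mul_one] at e
      show s' (-1) * σ (zφ m k j) = s' j
      rw [e]
      rcases H.C.pm (zφ m k j) with h | h <;> rw [h] <;> ring
    · intro i; simp only [H.C.alt]; ring
    · intro i
      show s' (-1) * σ i = 1 ∨ s' (-1) * σ i = -1
      rcases H.C.pm i with h | h <;> rcases s1 (-1) with h' | h' <;> rw [h, h'] <;> norm_num
  have hj : ∀ j : ZMod (n - k), j - 1 ≠ j := by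
    intro j
    have : Fact (1 < n - k) := ⟨by omega⟩
    simp
  have hT' : ∀ j, s (zφ m k (j - 1)) * Real.sign (L0 (zφ m k j) - L0 (zφ m k (j - 1))) =
      tv (evenRestrict n μ m k j) := by
    intro j
    rw [hs]
    exact (tv_iff (s1 _) (sign_pm fun e => hj j (V'.inj _ (Finset.mem_univ _) _
      (Finset.mem_univ _) e))).1 (s4 j)
  have h00 := hT' 0
  rw [zero_sub, zφ_neg H.kn, zφ_zero] at h00
  have hr0 : evenRestrict n μ m k 0 = runMajority n μ m k := by unfold evenRestrict; rw [if_pos rfl]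
  rw [hr0] at h00
  have hsum := H.sums (fun i => tv (μ i))
  rw [count_back hc] at hsum
  have R := H.run
  have mem : ∀ j, zφ m k j ∈ Finset.univ \ zQ m k := fun j =>
    Finset.mem_sdiff.2 ⟨Finset.mem_univ _, zφ_notin j⟩
  have U : ∀ g : ZMod n, g ∈ Finset.univ := Finset.mem_univ
  have hρ : ∀ g, (if σ (zρ σ g) = 1 then tv (μ (zρ σ g + 1)) else tv (μ (zρ σ g))) =
      (if σ g = 1 then tv (μ (g + 1)) else tv (μ g)) := by
    intro g
    have e := (H.C.alts H.C.alt g).1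
    rcases H.C.pm g with h | h
    · rw [if_pos h, (H.C.pos_case h).2.2.1, if_neg (by rw [H.C.alt, h]; norm_num)]
    · have h' : ¬ σ g = 1 := by rw [h]; norm_num
      have h2 : σ (g - 1) = 1 := by rw [H.C.alt', h]; norm_num
      rw [if_neg h', (H.C.neg_case h).2.2.1, if_pos h2, sub_add_cancel]
  have hm : ∀ g, (if σ (zm σ g) = 1 then tv (μ (zm σ g)) else tv (μ (zm σ g + 1))) =
      (if σ g = 1 then tv (μ g) else tv (μ (g + 1))) := by
    intro g
    rcases H.C.pm g with h | h
    · rw [if_pos h, (H.C.pos_case h).2.2.2.1, if_neg (by rw [H.C.alt', h]; norm_num),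
        sub_add_cancel]
    · have h' : ¬ σ g = 1 := by rw [h]; norm_num
      have h2 : σ (g + 1) = 1 := by rw [H.C.alt, h]; norm_num
      rw [if_neg h', (H.C.neg_case h).2.2.2.1, if_pos h2]
  obtain ⟨L, V, l1, l2, l3⟩ := reverse_ind s (fun g => if σ g = 1 then tv (μ g) else tv (μ (g + 1)))
    (zρ0 σ m k) Setup.ρ0_p H.ρ0_q (tv (runMajority n μ m k)) (tv_pm _) L0 h00 t1
    (fun g => by split_ifs <;> exact tv_pm _) (zQ m k).card Finset.univ (zρ σ) (zQ m k)
    (fun g => if σ g = 1 then tv (μ (g + 1)) else tv (μ g)) rfl S R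
    (fun g _ => (H.C.alts t2 g).1) (fun g _ => (H.C.alts t2 g).2) (fun g _ h => Setup.ρ0_o g h)
    (fun g => by split_ifs <;> exact tv_pm _) (fun g _ => hρ g) (fun g _ => hm g) hsum V0
  rw [flat_iff hn (by omega) H.C (m - 1)]
  have one : ∀ i : ZMod n, i - 1 ≠ i := by
    intro i
    have : Fact (1 < n) := ⟨by omega⟩
    simp
  refine ⟨L, V, s, t1, t2, ?_, ?_⟩
  · rw [← H.cL_eq L (fun j => L0 (zφ m k j)), ← zφ_neg H.kn, hs]
    · exact s3
    · intro j _
      rw [← zφ_neg H.kn, l1 _ (mem _), l1 _ (mem _)]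
  · intro i
    rw [tv_iff (t1 _) (sign_pm fun e => one i (V.inj _ (U _) _ (U _) e))]
    obtain ⟨t, ht, rfl⟩ := zrep m i
    by_cases htk : t ≤ k
    · have e0 : m + (t : ZMod n) - 1 = m - 1 + (t : ZMod n) := by ring
      rcases H.C.pm (m + (t : ZMod n) - 1) with h | h
      · have := l2 (m + (t : ZMod n) - 1) ((memS H).2 ⟨t, by omega, e0⟩)
        rw [if_pos h, (H.C.pos_case h).2.2.1, sub_add_cancel] at this
        exact this
      · have h1 : 1 ≤ t := by
          by_contra h1
          have : t = 0 := by omega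
          rw [this, Nat.cast_zero, add_zero, H.s0] at h
          norm_num at h
        have := l3 (m + (t : ZMod n) - 1) ((memQ' H).2 ⟨t, h1, by omega, e0⟩)
        rw [if_neg (by rw [h]; norm_num), (H.C.neg_case h).2.2.2.1, sub_add_cancel] at this
        exact this
    · push Not at htk
      have e1 := zφ_at (m := m) htk.le ht
      have h0 : ((t - k : ℕ) : ZMod (n - k)) ≠ 0 := by
        intro h
        have := congrArg ZMod.val h
        rw [ZMod.val_natCast_of_lt (by omega), ZMod.val_zero] at this
        omega
      generalize ((t - k : ℕ) : ZMod (n - k)) = j at e1 h0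
      rw [← e1, ← zφ_pred j h0, l1 _ (mem _), l1 _ (mem _), hT']
      unfold evenRestrict; rw [if_neg h0]; rfl
end

/-- Case D: for a run of `k` (even) equal minimal lengths surrounded by strictly
longer edges, `f'` is again a closed cycle, and an MV assignment is flat
foldable iff the numbers of mountains and valleys among the `k + 1` creases of
the run differ by exactly 1 and the induced assignment (new crease getting the
majority type) is flat foldable on `f'` (with the same designation). -/
theorem even_run_reduction (n : ℕ) (θ : ZMod n → ℝ) (hcc : IsClosedCycle n θ)
    (hne : ∃ i j : ZMod n, θ i ≠ θ j)
    (m : ZMod n) (k : ℕ) (hk2 : 2 ≤ k) (hkeven : Even k)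
    (hrun₁ : θ m < θ (m - 1))
    (hrun₂ : ∀ j : ℕ, j < k → θ (m + (j : ZMod n)) = θ m)
    (hrun₃ : θ m < θ (m + (k : ZMod n))) :
    IsClosedCycle (n - k) (evenShrink n θ m k) ∧
    ∀ (μ : ZMod n → MV) (d : Des),
      FlatFoldable n θ μ d ↔
        (runCount n μ m k MV.mountain = runCount n μ m k MV.valley + 1 ∨
          runCount n μ m k MV.valley = runCount n μ m k MV.mountain + 1) ∧
        FlatFoldable (n - k) (evenShrink n θ m k) (evenRestrict n μ m k) d := by
  have hn := hcc.1
  have hn2 := hcc.2.1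
  have : NeZero n := ⟨by omega⟩
  have hkn : k + 2 ≤ n := by
    have h1 : k < n := by
      by_contra h
      push Not at h
      have := hrun₂ (n - 1) (by omega)
      rw [← zm1] at this
      linarith
    obtain ⟨a, ha⟩ := hn
    obtain ⟨b, hb⟩ := hkeven
    omega
  have : NeZero (n - k) := ⟨by omega⟩
  have hnk : Even (n - k) := Even.tsub hn hkeven
  have C0 := folded_cyc hcc
  obtain ⟨X, σ, H⟩ : ∃ X σ, Setup n θ X σ m k := by
    rcases C0.pm (m - 1) with h | h
    · exact ⟨_, _, C0, hkeven, hk2, hkn, h, hrun₁, hrun₂, hrun₃⟩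
    · refine ⟨fun i => - foldedX n θ i, fun i => - (-1) ^ i.val, ⟨C0.pos, ?_, ?_, ?_⟩,
        hkeven, hk2, hkn, ?_, hrun₁, hrun₂, hrun₃⟩
      · intro i
        rcases C0.pm i with h | h
        · right; rw [h]
        · left; rw [h]; norm_num
      · intro i; have := C0.alt i; rw [this]
      · intro i; have := C0.step i; rw [this]; ring
      · rw [h]; norm_num
  refine ⟨H.cyc.closed hnk (by omega), fun μ d => ⟨H.forward hn hnk μ d, ?_⟩⟩
  rintro ⟨h1, h2⟩
  exact H.backward hn hnk μ d h1 h2
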